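/- Let (X,d,m) be a length PI space having the deformation property, let E ⊆ X be a volume-constrained minimizer of the perimeter, and let B ⊆ X be a bounded set. Then there exist constants r̄ > 0 and C > 1 such that for every x ∈ ∂^e E ∩ B and every r ∈ (0, r̄) one has both 1/C ≤ m(B_r(x) ∩ E)/m(B_r(x)) ≤ 1 − 1/C and 1/C ≤ r·P(E, B_r(x))/m(B_r(x)) ≤ C. -/

import Mathlib

open MeasureTheory Metric Set Filter Topology ENNReal Bornology
open scoped symmDiff

noncomputable section

variable {X : Type*}

/-- The slope (pointwise Lipschitz constant) of `f` at `x`, computed within `Ω`.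
It vanishes at points that are isolated in `Ω`. -/
def slopeOn [MetricSpace X] (Ω : Set X) (f : X → ℝ) (x : X) : ℝ≥0∞ :=
  Filter.limsup (fun y => ENNReal.ofReal (|f x - f y| / dist x y)) (𝓝[Ω \ {x}] x)

/-- The slope of `f`. -/
def mSlope [MetricSpace X] (f : X → ℝ) (x : X) : ℝ≥0∞ := slopeOn Set.univ f x

/-- `f` is locally Lipschitz on `Ω`. -/
def LocLipOn [MetricSpace X] (Ω : Set X) (f : X → ℝ) : Prop :=
  ∀ x ∈ Ω, ∃ r > (0:ℝ), ∃ K : NNReal, LipschitzOnWith K f (Metric.ball x r ∩ Ω)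

/-- Convergence `fn → f` in `L¹_loc(Ω)` w.r.t. the measure `m`. -/
def TendstoL1loc [MetricSpace X] [MeasurableSpace X] (m : Measure X) (Ω : Set X)
    (fn : ℕ → X → ℝ) (f : X → ℝ) : Prop :=
  ∀ K : Set X, K ⊆ Ω → IsCompact K →
    Tendsto (fun n => ∫⁻ x in K, ENNReal.ofReal |fn n x - f x| ∂m) atTop (𝓝 0)

/-- The total variation `|Df|(B)` of `f : X → ℝ` on the set `B`. -/
def totVar [MetricSpace X] [MeasurableSpace X] (m : Measure X) (f : X → ℝ) (B : Set X) : ℝ≥0∞ :=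
  ⨅ (Ω : Set X) (_ : IsOpen Ω) (_ : B ⊆ Ω),
    ⨅ (fn : ℕ → X → ℝ) (_ : ∀ n, LocLipOn Ω (fn n)) (_ : TendstoL1loc m Ω fn f),
      Filter.liminf (fun n => ∫⁻ x in Ω, slopeOn Ω (fn n) x ∂m) atTop

/-- The perimeter `P(E, B)` of a set `E` in `B`. -/
def Per [MetricSpace X] [MeasurableSpace X] (m : Measure X) (E B : Set X) : ℝ≥0∞ :=
  totVar m (Set.indicator E fun _ => (1:ℝ)) B

/-- `E` has locally finite perimeter. -/
def HasLocFinPer [MetricSpace X] [MeasurableSpace X] (m : Measure X) (E : Set X) : Prop :=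
  ∀ x : X, ∃ r > (0:ℝ), Per m E (Metric.ball x r) < ∞

/-- `E` has finite perimeter. -/
def HasFinPer [MetricSpace X] [MeasurableSpace X] (m : Measure X) (E : Set X) : Prop :=
  Per m E Set.univ < ∞

/-- `m` is finite on bounded sets. -/
def BoundedlyFinite [MetricSpace X] [MeasurableSpace X] (m : Measure X) : Prop :=
  ∀ B : Set X, Bornology.IsBounded B → m B < ∞

/-- Uniformly locally doubling with doubling function `C_D`. -/
def UnifLocDoublingWith [MetricSpace X] [MeasurableSpace X] (C_D : ℝ → ℝ) (m : Measure X) : Prop :=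
  ∀ R : ℝ, 0 < R → ∀ x : X, ∀ r : ℝ, 0 < r → r < R →
    m (Metric.ball x (2 * r)) ≤ ENNReal.ofReal (C_D R) * m (Metric.ball x r)

/-- Weak local (1,1)-Poincaré inequality with dilation `lam` and constant function `C_P`. -/
def WeakPoincareWith [MetricSpace X] [MeasurableSpace X] (lam : ℝ) (C_P : ℝ → ℝ)
    (m : Measure X) : Prop :=
  ∀ f : X → ℝ, LocLipOn Set.univ f → ∀ R : ℝ, 0 < R → ∀ x : X, ∀ r : ℝ, 0 < r → r < R →
    (∫⁻ y in Metric.ball x r,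
        ENNReal.ofReal |f y - ⨍ z in Metric.ball x r, f z ∂m| ∂m) / m (Metric.ball x r)
      ≤ ENNReal.ofReal (C_P R * r) *
          ((∫⁻ y in Metric.ball x (lam * r), mSlope f y ∂m) / m (Metric.ball x (lam * r)))

/-- `(X, d, m)` is a PI space. -/
def IsPIspace [MetricSpace X] [MeasurableSpace X] (m : Measure X) : Prop :=
  (∃ C_D : ℝ → ℝ, (∀ R, 0 < R → 0 < C_D R) ∧ UnifLocDoublingWith C_D m) ∧
  (∃ lam : ℝ, 1 ≤ lam ∧ ∃ C_P : ℝ → ℝ, (∀ R, 0 < R → 0 < C_P R) ∧ WeakPoincareWith lam C_P m)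

/-- `(X, d)` is a length space: the distance between two points is the infimum of the
lengths of continuous curves joining them. -/
def IsLengthSpace (X : Type*) [MetricSpace X] : Prop :=
  ∀ p q : X, ENNReal.ofReal (dist p q) =
    ⨅ (γ : ℝ → X) (_ : ContinuousOn γ (Set.Icc 0 1)) (_ : γ 0 = p) (_ : γ 1 = q),
      eVariationOn γ (Set.Icc 0 1)

/-- Essential interior `E^{(1)}`. -/
def essInt [MetricSpace X] [MeasurableSpace X] (m : Measure X) (E : Set X) : Set X :=
  { x | Tendsto (fun r : ℝ => m (E ∩ Metric.ball x r) / m (Metric.ball x r)) (𝓝[>] 0) (𝓝 1) }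

/-- Essential exterior `E^{(0)}`. -/
def essExt [MetricSpace X] [MeasurableSpace X] (m : Measure X) (E : Set X) : Set X :=
  { x | Tendsto (fun r : ℝ => m (E ∩ Metric.ball x r) / m (Metric.ball x r)) (𝓝[>] 0) (𝓝 0) }

/-- Essential boundary `∂^e E`. -/
def essBdry [MetricSpace X] [MeasurableSpace X] (m : Measure X) (E : Set X) : Set X :=
  (essInt m E ∪ essExt m E)ᶜ

/-- The two deformation inequalities hold for `E` at `x` with radius `R` and constant `C`. -/
def DeformIneq [MetricSpace X] [MeasurableSpace X] (m : Measure X) (E : Set X) (x : X)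
    (R C : ℝ) : Prop :=
  ∀ y ∈ Metric.ball x R, ∀ r ∈ Set.Ioo (0:ℝ) R,
    Per m (E \ Metric.ball y r) (Metric.ball x (2 * R)) ≤
      ENNReal.ofReal C * m (Metric.ball y r ∩ E) / ENNReal.ofReal r +
        Per m E (Metric.ball x (2 * R)) ∧
    Per m (E ∪ Metric.ball y r) (Metric.ball x (2 * R)) ≤
      ENNReal.ofReal C * m (Metric.ball y r \ E) / ENNReal.ofReal r +
        Per m E (Metric.ball x (2 * R))

/-- The deformation inequalities hold for `E` at `x` with radius `R` and some constant. -/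
def DeformAt [MetricSpace X] [MeasurableSpace X] (m : Measure X) (E : Set X) (x : X)
    (R : ℝ) : Prop :=
  0 < R ∧ R ≤ 1 ∧ ∃ C : ℝ, 0 ≤ C ∧ DeformIneq m E x R C

/-- `R_x(E)`: the maximal radius in `(0,1]` for which the deformation inequalities hold. -/
def deformRadius [MetricSpace X] [MeasurableSpace X] (m : Measure X) (E : Set X) (x : X) : ℝ :=
  sSup { R : ℝ | DeformAt m E x R }

/-- `(X, d, m)` has the deformation property. -/
def DeformationProperty [MetricSpace X] [MeasurableSpace X] (m : Measure X) : Prop :=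
  ∀ E : Set X, MeasurableSet E → HasLocFinPer m E → ∀ x : X, ∃ R : ℝ, DeformAt m E x R

/-- `E` is a volume-constrained minimizer of the perimeter. -/
def VolConstMin [MetricSpace X] [MeasurableSpace X] (m : Measure X) (E : Set X) : Prop :=
  MeasurableSet E ∧ HasLocFinPer m E ∧
    ∀ F K : Set X, MeasurableSet F → IsCompact K →
      m ((E ∆ F) \ K) = 0 → m (E ∩ K) = m (F ∩ K) → Per m E K ≤ Per m F K

/-- `E` is an isoperimetric set. -/
def IsIsoperimetricSet [MetricSpace X] [MeasurableSpace X] (m : Measure X) (E : Set X) : Prop :=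
  MeasurableSet E ∧ HasFinPer m E ∧ 0 < m E ∧ m E < ∞ ∧
    ∀ F : Set X, MeasurableSet F → m F = m E → Per m E Set.univ ≤ Per m F Set.univ

namespace PerimeterDensity

section Slope

section Slope

variable {X : Type*} [MetricSpace X]

theorem limsup_add_le_ennreal {ι : Type*} {l : Filter ι} (u v : ι → ℝ≥0∞) :
    limsup (fun i => u i + v i) l ≤ limsup u l + limsup v l := by
  refine ENNReal.le_of_forall_pos_le_add fun ε hε hfin => ?_
  have hε' : (0 : ℝ≥0∞) < (ε / 2 : NNReal) := by exact_mod_cast half_pos hε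
  have hu : limsup u l < limsup u l + (ε / 2 : NNReal) :=
    ENNReal.lt_add_right (lt_of_le_of_lt le_self_add hfin).ne hε'.ne'
  have hv : limsup v l < limsup v l + (ε / 2 : NNReal) :=
    ENNReal.lt_add_right (lt_of_le_of_lt le_add_self hfin).ne hε'.ne'
  refine limsup_le_of_le (by isBoundedDefault) ?_
  filter_upwards [eventually_lt_of_limsup_lt hu, eventually_lt_of_limsup_lt hv] with i h1 h2
  calc u i + v i ≤ (limsup u l + (ε / 2 : NNReal)) + (limsup v l + (ε / 2 : NNReal)) :=
        add_le_add h1.le h2.le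
    _ = limsup u l + limsup v l + ε := by
        rw [add_add_add_comm, ← ENNReal.coe_add, add_halves]

theorem mSlope_eq (f : X → ℝ) (x : X) :
    mSlope f x = limsup (fun y => ENNReal.ofReal (|f x - f y| / dist x y)) (𝓝[≠] x) := by
  simp [mSlope, slopeOn, ← Set.compl_eq_univ_sdiff]

theorem slopeOn_eq_mSlope {Ω : Set X} (hΩ : IsOpen Ω) (f : X → ℝ) {x : X} (hx : x ∈ Ω) :
    slopeOn Ω f x = mSlope f x := by
  rw [mSlope_eq, slopeOn]
  have h : 𝓝[Ω \ {x}] x = 𝓝[≠] x := by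
    rw [Set.sdiff_eq]
    exact nhdsWithin_inter_of_mem (mem_nhdsWithin_of_mem_nhds (hΩ.mem_nhds hx))
  rw [h]

theorem mSlope_congr {f g : X → ℝ} {x : X} (h : f =ᶠ[𝓝 x] g) : mSlope f x = mSlope g x := by
  rw [mSlope_eq, mSlope_eq]
  refine limsup_congr ?_
  filter_upwards [mem_nhdsWithin_of_mem_nhds h] with y hy
  rw [h.eq_of_nhds, show f y = g y from hy]

theorem mSlope_const (c : ℝ) (x : X) : mSlope (fun _ => c) x = 0 := by
  rw [mSlope_eq]
  simp only [sub_self, abs_zero, zero_div, ENNReal.ofReal_zero]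
  exact le_antisymm (limsup_le_of_le (by isBoundedDefault) (Eventually.of_forall fun _ => le_rfl))
    bot_le

theorem mSlope_const_sub (c : ℝ) (f : X → ℝ) (x : X) :
    mSlope (fun y => c - f y) x = mSlope f x := by
  rw [mSlope_eq, mSlope_eq]
  congr 1
  ext y
  rw [show c - f x - (c - f y) = -(f x - f y) by ring, abs_neg]

theorem mSlope_add_le (f g : X → ℝ) (x : X) :
    mSlope (fun y => f y + g y) x ≤ mSlope f x + mSlope g x := by
  rw [mSlope_eq, mSlope_eq, mSlope_eq]
  refine le_trans (limsup_le_limsup (Eventually.of_forall fun y => ?_)) (limsup_add_le_ennreal _ _)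
  dsimp only
  rw [← ENNReal.ofReal_add (by positivity) (by positivity), ← add_div]
  gcongr
  rw [show f x + g x - (f y + g y) = (f x - f y) + (g x - g y) by ring]
  exact abs_add_le _ _

theorem mSlope_glue_le {φ f g : X → ℝ} {K : NNReal} (hφ : LipschitzWith K φ) {x : X}
    (hf : ContinuousAt f x) (hg : ContinuousAt g x) (h0 : 0 ≤ φ x) (h1 : φ x ≤ 1) :
    mSlope (fun y => φ y * f y + (1 - φ y) * g y) x ≤
      ENNReal.ofReal (φ x) * mSlope f x + ENNReal.ofReal (1 - φ x) * mSlope g x +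
        K * ENNReal.ofReal |f x - g x| := by
  rcases (𝓝[≠] x).eq_or_neBot with hbot | hne
  · rw [mSlope_eq, hbot, limsup_bot]
    exact bot_le
  have hlim : limsup (fun y => (K : ℝ≥0∞) * ENNReal.ofReal |f y - g y|) (𝓝[≠] x)
      = K * ENNReal.ofReal |f x - g x| := by
    refine Tendsto.limsup_eq (ENNReal.Tendsto.const_mul ?_ (Or.inr ENNReal.coe_ne_top))
    exact ((ENNReal.continuous_ofReal.continuousAt).tendsto.comp
      ((hf.sub hg).abs.tendsto)).mono_left nhdsWithin_le_nhds
  rw [← hlim]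
  simp only [mSlope_eq]
  rw [← ENNReal.limsup_const_mul_of_ne_top ENNReal.ofReal_ne_top,
    ← ENNReal.limsup_const_mul_of_ne_top ENNReal.ofReal_ne_top]
  refine le_trans ?_ (add_le_add_left (limsup_add_le_ennreal _ _) _)
  refine le_trans ?_ (limsup_add_le_ennreal _ _)
  refine limsup_le_limsup ?_
  filter_upwards [self_mem_nhdsWithin] with y hy
  have hd : 0 < dist x y := dist_pos.2 (Ne.symm hy)
  have hK : |φ x - φ y| ≤ K * dist x y := by
    simpa [Real.dist_eq] using hφ.dist_le_mul x y
  rw [← ENNReal.ofReal_mul h0, ← ENNReal.ofReal_mul (sub_nonneg.2 h1),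
    ← ENNReal.ofReal_coe_nnreal, ← ENNReal.ofReal_mul K.coe_nonneg, ← ENNReal.ofReal_add (by positivity)
      (mul_nonneg (sub_nonneg.2 h1) (by positivity)),
    ← ENNReal.ofReal_add (add_nonneg (by positivity)
      (mul_nonneg (sub_nonneg.2 h1) (by positivity))) (by positivity)]
  refine ENNReal.ofReal_le_ofReal ?_
  rw [div_le_iff₀ hd]
  have e : φ x * f x + (1 - φ x) * g x - (φ y * f y + (1 - φ y) * g y)
      = φ x * (f x - f y) + (1 - φ x) * (g x - g y) + (φ x - φ y) * (f y - g y) := by ring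
  rw [e]
  have e2 : (φ x * (|f x - f y| / dist x y) + (1 - φ x) * (|g x - g y| / dist x y)
      + K * |f y - g y|) * dist x y
      = φ x * |f x - f y| + (1 - φ x) * |g x - g y| + (K * dist x y) * |f y - g y| := by
    field_simp
  rw [e2]
  refine (abs_add_le _ _).trans (add_le_add ((abs_add_le _ _).trans (add_le_add ?_ ?_)) ?_)
  · rw [abs_mul, abs_of_nonneg h0]
  · rw [abs_mul, abs_of_nonneg (sub_nonneg.2 h1)]
  · rw [abs_mul]
    gcongr

theorem LocLipOn.continuousAt {A : Set X} (hA : IsOpen A) {f : X → ℝ} (hf : LocLipOn A f) {x : X}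
    (hx : x ∈ A) : ContinuousAt f x := by
  obtain ⟨r, hr, K, hK⟩ := hf x hx
  exact hK.continuousOn.continuousAt (inter_mem (ball_mem_nhds x hr) (hA.mem_nhds hx))

theorem LocLipOn.mono {A B : Set X} {f : X → ℝ} (hf : LocLipOn A f) (h : B ⊆ A) :
    LocLipOn B f := by
  intro x hx
  obtain ⟨r, hr, K, hK⟩ := hf x (h hx)
  exact ⟨r, hr, K, hK.mono (inter_subset_inter_right _ h)⟩

/-- On an open set, being locally Lipschitz is a property of germs. -/
theorem locLipOn_iff {A : Set X} (hA : IsOpen A) {f : X → ℝ} :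
    LocLipOn A f ↔ ∀ x ∈ A, ∃ s ∈ 𝓝 x, ∃ K : NNReal, LipschitzOnWith K f s := by
  constructor
  · intro h x hx
    obtain ⟨r, hr, K, hK⟩ := h x hx
    exact ⟨_, inter_mem (ball_mem_nhds x hr) (hA.mem_nhds hx), K, hK⟩
  · intro h x hx
    obtain ⟨s, hs, K, hK⟩ := h x hx
    obtain ⟨r, hr, hrs⟩ := Metric.mem_nhds_iff.1 hs
    exact ⟨r, hr, K, hK.mono (inter_subset_left.trans hrs)⟩

theorem lipschitzOnWith_mul {f g : X → ℝ} {s : Set X} {K L : NNReal} {a b : ℝ}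
    (hf : LipschitzOnWith K f s) (hg : LipschitzOnWith L g s)
    (ha : ∀ x ∈ s, |f x| ≤ a) (hb : ∀ x ∈ s, |g x| ≤ b) :
    ∃ M : NNReal, LipschitzOnWith M (fun x => f x * g x) s := by
  rcases s.eq_empty_or_nonempty with rfl | ⟨x0, hx0⟩
  · exact ⟨0, by simp⟩
  have ha0 : 0 ≤ a := (abs_nonneg _).trans (ha x0 hx0)
  have hb0 : 0 ≤ b := (abs_nonneg _).trans (hb x0 hx0)
  refine ⟨⟨a * L + b * K, by positivity⟩, LipschitzOnWith.of_dist_le_mul fun x hx y hy => ?_⟩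
  have h1 := hf.dist_le_mul x hx y hy
  have h2 := hg.dist_le_mul x hx y hy
  rw [Real.dist_eq] at h1 h2 ⊢
  have e : f x * g x - f y * g y = f x * (g x - g y) + g y * (f x - f y) := by ring
  rw [e]
  refine (abs_add_le _ _).trans ?_
  rw [abs_mul, abs_mul]
  calc |f x| * |g x - g y| + |g y| * |f x - f y|
      ≤ a * (L * dist x y) + b * (K * dist x y) := by
        gcongr
        · exact ha x hx
        · exact hb y hy
    _ = (a * L + b * K) * dist x y := by ring

theorem exists_lipschitzOn_mul {f g : X → ℝ} {x : X}
    (hf : ∃ s ∈ 𝓝 x, ∃ K : NNReal, LipschitzOnWith K f s)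
    (hg : ∃ s ∈ 𝓝 x, ∃ K : NNReal, LipschitzOnWith K g s) :
    ∃ s ∈ 𝓝 x, ∃ K : NNReal, LipschitzOnWith K (fun y => f y * g y) s := by
  obtain ⟨s, hs, K, hK⟩ := hf
  obtain ⟨t, ht, L, hL⟩ := hg
  have cf : ContinuousAt f x := hK.continuousOn.continuousAt hs
  have cg : ContinuousAt g x := hL.continuousOn.continuousAt ht
  have bf : ∀ᶠ y in 𝓝 x, |f y| ≤ |f x| + 1 :=
    (cf.abs.eventually (gt_mem_nhds (lt_add_one |f x|))).mono fun _ h => le_of_lt h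
  have bg : ∀ᶠ y in 𝓝 x, |g y| ≤ |g x| + 1 :=
    (cg.abs.eventually (gt_mem_nhds (lt_add_one |g x|))).mono fun _ h => le_of_lt h
  refine ⟨(s ∩ t) ∩ ({y | |f y| ≤ |f x| + 1} ∩ {y | |g y| ≤ |g x| + 1}),
    inter_mem (inter_mem hs ht) (inter_mem bf bg), ?_⟩
  exact lipschitzOnWith_mul (hK.mono fun y hy => hy.1.1) (hL.mono fun y hy => hy.1.2)
    (fun y hy => hy.2.1) (fun y hy => hy.2.2)

theorem exists_lipschitzOn_add {f g : X → ℝ} {x : X}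
    (hf : ∃ s ∈ 𝓝 x, ∃ K : NNReal, LipschitzOnWith K f s)
    (hg : ∃ s ∈ 𝓝 x, ∃ K : NNReal, LipschitzOnWith K g s) :
    ∃ s ∈ 𝓝 x, ∃ K : NNReal, LipschitzOnWith K (fun y => f y + g y) s := by
  obtain ⟨s, hs, K, hK⟩ := hf
  obtain ⟨t, ht, L, hL⟩ := hg
  exact ⟨s ∩ t, inter_mem hs ht, K + L,
    (hK.mono inter_subset_left).add (hL.mono inter_subset_right)⟩

theorem exists_lipschitzOn_congr {f g : X → ℝ} {x : X} (h : f =ᶠ[𝓝 x] g)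
    (hf : ∃ s ∈ 𝓝 x, ∃ K : NNReal, LipschitzOnWith K f s) :
    ∃ s ∈ 𝓝 x, ∃ K : NNReal, LipschitzOnWith K g s := by
  obtain ⟨s, hs, K, hK⟩ := hf
  refine ⟨s ∩ {y | f y = g y}, inter_mem hs h, K, fun y hy z hz => ?_⟩
  rw [← show f y = g y from hy.2, ← show f z = g z from hz.2]
  exact hK hy.1 hz.1

theorem mSlope_eq_iInf {A : Set X} (hA : IsOpen A) (f : X → ℝ) {x : X} (hx : x ∈ A) :
    mSlope f x = ⨅ n : ℕ, ⨆ y ∈ {y | y ∈ A ∧ 0 < dist x y ∧ dist x y < 1 / ((n : ℝ) + 1)},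
      ENNReal.ofReal (|f x - f y| / dist x y) := by
  rw [mSlope_eq]
  have hb : (𝓝[≠] x).HasAntitoneBasis
      fun n : ℕ => {y | dist x y < 1 / ((n : ℝ) + 1)} ∩ {x}ᶜ := by
    refine ⟨?_, ?_⟩
    · have h1 := Metric.nhds_basis_ball_inv_nat_succ (x := x)
      have h2 := nhdsWithin_hasBasis h1 {x}ᶜ
      simpa [ball, dist_comm] using h2
    · intro i j hij y hy
      refine ⟨?_, hy.2⟩
      have h1 : dist x y < 1 / ((j : ℝ) + 1) := hy.1
      exact lt_of_lt_of_le h1 (by gcongr)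
  refine le_antisymm ?_ ?_
  · refine le_iInf fun n => limsup_le_of_le (by isBoundedDefault) ?_
    filter_upwards [hb.1.mem_of_mem (i := n) trivial, mem_nhdsWithin_of_mem_nhds (hA.mem_nhds hx)]
      with y hy hyA
    exact le_iSup₂_of_le y ⟨hyA, dist_pos.2 (Ne.symm hy.2), hy.1⟩ le_rfl
  · rw [hb.1.limsup_eq_iInf_iSup]
    refine le_iInf₂ fun n _ => iInf_le_of_le n ?_
    refine iSup₂_le fun y hy => le_iSup₂_of_le y ⟨hy.2.2, ?_⟩ le_rfl
    exact fun h => (dist_pos.1 hy.2.1) (by simpa using h.symm)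

theorem measurable_indicator_mSlope [MeasurableSpace X] [BorelSpace X] {A : Set X} (hA : IsOpen A)
    {f : X → ℝ} (hf : ∀ x ∈ A, ContinuousAt f x) :
    Measurable (A.indicator (mSlope f)) := by
  set S : ℕ → X → ℝ≥0∞ := fun n x =>
    ⨆ y ∈ {y | y ∈ A ∧ 0 < dist x y ∧ dist x y < 1 / ((n : ℝ) + 1)},
      ENNReal.ofReal (|f x - f y| / dist x y) with hS
  have h1 : A.indicator (mSlope f) = fun x => ⨅ n, A.indicator (S n) x := by
    ext x
    by_cases hx : x ∈ A
    · simp only [indicator_of_mem hx]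
      exact mSlope_eq_iInf hA f hx
    · simp [indicator_of_notMem hx]
  rw [h1]
  refine Measurable.iInf fun n => measurable_of_Ioi fun c => ?_
  have h2 : A.indicator (S n) ⁻¹' Ioi c = {x | x ∈ A ∧ c < S n x} := by
    ext x
    by_cases hx : x ∈ A <;> simp [hx]
  rw [h2]
  refine IsOpen.measurableSet (isOpen_iff_mem_nhds.2 ?_)
  rintro x ⟨hxA, hx⟩
  simp only [hS, lt_iSup_iff] at hx
  obtain ⟨y, hy, hxy⟩ := hx
  have c1 : ContinuousAt (fun z => ENNReal.ofReal (|f z - f y| / dist z y)) x := by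
    refine ENNReal.continuous_ofReal.continuousAt.comp ?_
    exact (((hf x hxA).sub continuousAt_const).abs).div
      (continuousAt_id.dist continuousAt_const) hy.2.1.ne'
  have c2 : ContinuousAt (fun z => dist z y) x := continuousAt_id.dist continuousAt_const
  filter_upwards [hA.mem_nhds hxA, c1.eventually (lt_mem_nhds hxy),
    c2.eventually (lt_mem_nhds hy.2.1), c2.eventually (gt_mem_nhds hy.2.2)] with z h1 h2 h3 h4
  refine ⟨h1, ?_⟩
  simp only [hS, lt_iSup_iff]
  exact ⟨y, ⟨hy.1, h3, h4⟩, h2⟩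

theorem aemeasurable_mSlope [MeasurableSpace X] [BorelSpace X] {m : Measure X} {A : Set X}
    (hA : IsOpen A) {f : X → ℝ} (hf : LocLipOn A f) : AEMeasurable (mSlope f) (m.restrict A) := by
  rw [← aemeasurable_indicator_iff hA.measurableSet]
  exact (measurable_indicator_mSlope hA fun x hx =>
    LocLipOn.continuousAt hA hf hx).aemeasurable

end Slope

end Slope

section PerimeterBasics

section Perimeter

variable {X : Type*} [MetricSpace X] [MeasurableSpace X] {m : Measure X} {E F : Set X}

/-- The characteristic function of a set. -/
abbrev charFn (E : Set X) : X → ℝ := E.indicator fun _ => (1 : ℝ)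

theorem liminf_add_liminf_le_ennreal (u v : ℕ → ℝ≥0∞) :
    liminf u atTop + liminf v atTop ≤ liminf (fun n => u n + v n) atTop := by
  simp only [liminf_eq_iSup_iInf_of_nat]
  rw [ENNReal.iSup_add_iSup_of_monotone]
  · exact iSup_mono fun n => le_iInf₂ fun i hi => add_le_add (iInf₂_le i hi) (iInf₂_le i hi)
  · exact fun a b hab => le_iInf₂ fun i hi => iInf₂_le i (hab.trans hi)
  · exact fun a b hab => le_iInf₂ fun i hi => iInf₂_le i (hab.trans hi)

theorem TendstoL1loc.mono {A B : Set X} {fn : ℕ → X → ℝ} {f : X → ℝ}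
    (h : TendstoL1loc m A fn f) (hBA : B ⊆ A) : TendstoL1loc m B fn f :=
  fun K hK hc => h K (hK.trans hBA) hc

theorem TendstoL1loc.comp {A : Set X} {fn : ℕ → X → ℝ} {f : X → ℝ}
    (h : TendstoL1loc m A fn f) {φ : ℕ → ℕ} (hφ : Tendsto φ atTop atTop) :
    TendstoL1loc m A (fun n => fn (φ n)) f :=
  fun K hK hc => (h K hK hc).comp hφ

theorem setLIntegral_slopeOn [BorelSpace X] {A : Set X} (hA : IsOpen A) (f : X → ℝ) :
    ∫⁻ x in A, slopeOn A f x ∂m = ∫⁻ x in A, mSlope f x ∂m :=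
  setLIntegral_congr_fun hA.measurableSet fun _ hx => slopeOn_eq_mSlope hA f hx

theorem per_le_liminf [BorelSpace X] {A : Set X} (hA : IsOpen A) {fn : ℕ → X → ℝ}
    (hL : ∀ n, LocLipOn A (fn n)) (hT : TendstoL1loc m A fn (charFn E)) :
    Per m E A ≤ liminf (fun n => ∫⁻ x in A, mSlope (fn n) x ∂m) atTop := by
  refine iInf_le_of_le A (iInf_le_of_le hA (iInf_le_of_le subset_rfl
    (iInf_le_of_le fn (iInf_le_of_le hL (iInf_le_of_le hT ?_)))))
  simp only [setLIntegral_slopeOn hA]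
  exact le_rfl

theorem per_le_of_tendsto [BorelSpace X] {A : Set X} (hA : IsOpen A) {fn : ℕ → X → ℝ}
    (hL : ∀ n, LocLipOn A (fn n)) (hT : TendstoL1loc m A fn (charFn E)) {c : ℝ≥0∞}
    {δ : ℕ → ℝ≥0∞} (hδ : Tendsto δ atTop (𝓝 0))
    (hc : ∀ n, ∫⁻ x in A, mSlope (fn n) x ∂m ≤ c + δ n) : Per m E A ≤ c := by
  refine (per_le_liminf hA hL hT).trans ?_
  refine (liminf_le_liminf (Eventually.of_forall hc)).trans ?_
  have : Tendsto (fun n => c + δ n) atTop (𝓝 (c + 0)) := tendsto_const_nhds.add hδ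
  rw [this.liminf_eq, add_zero]

theorem exists_seq [BorelSpace X] {A : Set X} {c : ℝ≥0∞} (h : Per m E A < c) :
    ∃ fn : ℕ → X → ℝ, (∀ n, LocLipOn A (fn n)) ∧ TendstoL1loc m A fn (charFn E) ∧
      ∀ n, ∫⁻ x in A, mSlope (fn n) x ∂m ≤ c := by
  simp only [Per, totVar, iInf_lt_iff] at h
  obtain ⟨Ω, hΩ, hAΩ, fn, hL, hT, hlim⟩ := h
  obtain ⟨φ, hφ, hlt⟩ := extraction_of_frequently_atTop
    (frequently_lt_of_liminf_lt (by isBoundedDefault) hlim)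
  refine ⟨fun n => fn (φ n), fun n => LocLipOn.mono (hL _) hAΩ,
    TendstoL1loc.comp (TendstoL1loc.mono hT hAΩ) hφ.tendsto_atTop, fun n => ?_⟩
  refine le_trans ?_ (hlt n).le
  rw [setLIntegral_slopeOn hΩ]
  exact lintegral_mono_set hAΩ

theorem per_mono {A B : Set X} (h : A ⊆ B) : Per m E A ≤ Per m E B := by
  refine le_iInf fun Ω => le_iInf fun hΩ => le_iInf fun hB => ?_
  exact iInf_le_of_le Ω (iInf_le_of_le hΩ (iInf_le_of_le (h.trans hB) le_rfl))

theorem exists_isOpen_per_lt [BorelSpace X] {K : Set X} {c : ℝ≥0∞} (h : Per m E K < c) :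
    ∃ Ω, IsOpen Ω ∧ K ⊆ Ω ∧ Per m E Ω < c := by
  have h' := h
  simp only [Per, totVar, iInf_lt_iff] at h
  obtain ⟨Ω, hΩ, hAΩ, fn, hL, hT, hlim⟩ := h
  refine ⟨Ω, hΩ, hAΩ, lt_of_le_of_lt (per_le_liminf hΩ hL hT) ?_⟩
  simpa only [setLIntegral_slopeOn hΩ] using hlim

theorem per_empty_right [BorelSpace X] : Per m E ∅ = 0 := by
  refine le_antisymm ((per_le_liminf isOpen_empty (fn := fun _ _ => 0) ?_ ?_).trans ?_) bot_le
  · exact fun n x hx => absurd hx (notMem_empty _)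
  · intro K hK _
    simp [subset_empty_iff.1 hK]
  · simp

theorem tendstoL1loc_congr {A : Set X} (hA : MeasurableSet A) {fn : ℕ → X → ℝ}
    (h : m ((E ∆ F) ∩ A) = 0) (hT : TendstoL1loc m A fn (charFn E)) :
    TendstoL1loc m A fn (charFn F) := by
  intro K hK hc
  refine (hT K hK hc).congr fun n => lintegral_congr_ae ?_
  have : ∀ᵐ x ∂m.restrict A, x ∉ E ∆ F := by
    rw [ae_restrict_iff' hA, ae_iff]
    convert h using 2
    ext x
    simp [and_comm]
  filter_upwards [ae_restrict_of_ae_restrict_of_subset hK this] with x hx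
  have hiff : x ∈ E ↔ x ∈ F := by
    by_contra hne
    exact hx (by rw [Set.mem_symmDiff]; tauto)
  by_cases hxE : x ∈ E
  · simp [charFn, hxE, hiff.1 hxE]
  · simp [charFn, hxE, mt hiff.2 hxE]

/-- The perimeter in an open set depends only on the trace of the set up to null sets. -/
theorem per_congr_le [BorelSpace X] {A : Set X} (hA : IsOpen A) (h : m ((E ∆ F) ∩ A) = 0) :
    Per m F A ≤ Per m E A := by
  refine le_of_forall_gt fun c hc => ?_
  obtain ⟨c', hc1, hc2⟩ := exists_between hc
  obtain ⟨fn, hL, hT, hle⟩ := exists_seq hc1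
  refine lt_of_le_of_lt (per_le_of_tendsto (δ := fun _ => 0) hA hL
    (tendstoL1loc_congr hA.measurableSet h hT) tendsto_const_nhds fun n => ?_) hc2
  simpa using hle n

theorem per_congr [BorelSpace X] {A : Set X} (hA : IsOpen A) (h : m ((E ∆ F) ∩ A) = 0) :
    Per m E A = Per m F A :=
  le_antisymm (per_congr_le hA (by rwa [symmDiff_comm])) (per_congr_le hA h)

theorem per_congr_inter [BorelSpace X] {A : Set X} (hA : IsOpen A) (h : E ∩ A = F ∩ A) :
    Per m E A = Per m F A := by
  refine per_congr hA ?_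
  have : (E ∆ F) ∩ A = ∅ := by
    ext x
    have := Set.ext_iff.1 h x
    simp only [mem_inter_iff, Set.mem_symmDiff, mem_empty_iff_false, iff_false] at *
    tauto
  simp [this]

theorem per_empty_left [BorelSpace X] {A : Set X} (hA : IsOpen A) : Per m ∅ A = 0 := by
  refine le_antisymm ((per_le_liminf hA (fn := fun _ _ => 0) ?_ ?_).trans ?_) bot_le
  · exact fun n x hx => ⟨1, one_pos, 0, fun _ _ _ _ => by simp⟩
  · intro K hK _
    simp [charFn]
  · simp [mSlope_const]

theorem per_compl_le [BorelSpace X] {A : Set X} : Per m Eᶜ A ≤ Per m E A := by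
  refine le_iInf fun Ω => le_iInf fun hΩ => le_iInf fun hB => le_iInf fun fn => le_iInf fun hL =>
    le_iInf fun hT => ?_
  refine (per_mono hB).trans ((per_le_liminf hΩ (fn := fun n x => 1 - fn n x) ?_ ?_).trans ?_)
  · intro n x hx
    obtain ⟨r, hr, K, hK⟩ := hL n x hx
    refine ⟨r, hr, K, LipschitzOnWith.of_dist_le_mul fun y hy z hz => ?_⟩
    rw [dist_sub_left]
    exact hK.dist_le_mul y hy z hz
  · intro K hK hc
    refine (hT K hK hc).congr fun n => lintegral_congr fun x => ?_
    congr 1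
    by_cases hx : x ∈ E
    · simp [charFn, hx, abs_sub_comm]
    · simp [charFn, hx]
  · simp only [mSlope_const_sub, setLIntegral_slopeOn hΩ]
    exact le_rfl

theorem per_compl [BorelSpace X] (E A : Set X) : Per m Eᶜ A = Per m E A :=
  le_antisymm per_compl_le (by simpa using per_compl_le (m := m) (E := Eᶜ) (A := A))

theorem per_add_le_of_disjoint [BorelSpace X] {A B Ω : Set X} (hA : IsOpen A) (hB : IsOpen B)
    (hAB : Disjoint A B) (hAΩ : A ⊆ Ω) (hBΩ : B ⊆ Ω) :
    Per m E A + Per m E B ≤ Per m E Ω := by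
  refine le_of_forall_gt fun c hc => ?_
  obtain ⟨c', hc1, hc2⟩ := exists_between hc
  obtain ⟨fn, hL, hT, hle⟩ := exists_seq hc1
  refine lt_of_le_of_lt ?_ hc2
  have h1 := per_le_liminf hA (fun n => LocLipOn.mono (hL n) hAΩ) (TendstoL1loc.mono hT hAΩ)
  have h2 := per_le_liminf hB (fun n => LocLipOn.mono (hL n) hBΩ) (TendstoL1loc.mono hT hBΩ)
  refine (add_le_add h1 h2).trans ((liminf_add_liminf_le_ennreal _ _).trans ?_)
  refine liminf_le_of_le (by isBoundedDefault) fun b hb => ?_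
  obtain ⟨n, hn⟩ := hb.exists
  refine hn.trans (le_trans ?_ (hle n))
  rw [← lintegral_union hB.measurableSet hAB]
  exact lintegral_mono_set (union_subset hAΩ hBΩ)

theorem sum_per_le [BorelSpace X] {ι : Type*} (s : Finset ι) {A : ι → Set X} {Ω : Set X}
    (hA : ∀ i ∈ s, IsOpen (A i)) (hd : (s : Set ι).PairwiseDisjoint A)
    (hAΩ : ∀ i ∈ s, A i ⊆ Ω) : ∑ i ∈ s, Per m E (A i) ≤ Per m E Ω := by
  classical
  induction s using Finset.induction_on generalizing Ω with
  | empty => simp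
  | insert i s hi ih =>
    rw [Finset.sum_insert hi]
    have hopen : IsOpen (⋃ j ∈ s, A j) :=
      isOpen_biUnion fun j hj => hA j (Finset.mem_insert_of_mem hj)
    have h1 := ih (Ω := ⋃ j ∈ s, A j) (fun j hj => hA j (Finset.mem_insert_of_mem hj))
      (hd.subset (by simp)) (fun j hj => subset_biUnion_of_mem (u := A) hj)
    refine (add_le_add le_rfl h1).trans
      (per_add_le_of_disjoint (hA i (Finset.mem_insert_self _ _)) hopen ?_
        (hAΩ i (Finset.mem_insert_self _ _))
        (iUnion₂_subset fun j hj => hAΩ j (Finset.mem_insert_of_mem hj)))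
    rw [disjoint_iUnion₂_right]
    intro j hj
    exact hd (by simp) (by simp [hj]) (fun h => hi (h ▸ hj))

theorem tsum_per_le [BorelSpace X] {ι : Type*} {A : ι → Set X} {Ω : Set X}
    (hA : ∀ i, IsOpen (A i)) (hd : Pairwise fun i j => Disjoint (A i) (A j))
    (hAΩ : ∀ i, A i ⊆ Ω) : ∑' i, Per m E (A i) ≤ Per m E Ω := by
  rw [ENNReal.tsum_eq_iSup_sum]
  exact iSup_le fun s => sum_per_le s (fun i _ => hA i) (fun i _ j _ h => hd h)
    fun i _ => hAΩ i

end Perimeter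

end PerimeterBasics

section Gluing

section GlueLipschitz

variable {X : Type*} [MetricSpace X]

theorem locLipOn_glue {A B V : Set X} (hA : IsOpen A) (hB : IsOpen B) (hV : IsOpen V)
    {φ : X → ℝ} {K : NNReal} (hφ : LipschitzWith K φ)
    (hVA : V ∩ tsupport φ ⊆ A) (hVB : V ∩ tsupport (fun x => 1 - φ x) ⊆ B)
    {f g : X → ℝ} (hf : LocLipOn A f) (hg : LocLipOn B g) :
    LocLipOn V (fun x => φ x * f x + (1 - φ x) * g x) := by
  rw [locLipOn_iff hV]
  intro x hx
  refine exists_lipschitzOn_add ?_ ?_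
  · by_cases h : x ∈ tsupport φ
    · exact exists_lipschitzOn_mul ⟨univ, univ_mem, K, hφ.lipschitzOnWith⟩
        ((locLipOn_iff hA).1 hf x (hVA ⟨hx, h⟩))
    · have h0 := notMem_tsupport_iff_eventuallyEq.1 h
      refine exists_lipschitzOn_congr (f := fun _ => (0 : ℝ)) ?_ ⟨univ, univ_mem, 0, by
        intro y _ z _; simp⟩
      filter_upwards [h0] with y hy
      simp [hy]
  · by_cases h : x ∈ tsupport fun x => 1 - φ x
    · refine exists_lipschitzOn_mul ⟨univ, univ_mem, K, ?_⟩
        ((locLipOn_iff hB).1 hg x (hVB ⟨hx, h⟩))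
      refine LipschitzOnWith.of_dist_le_mul fun y _ z _ => ?_
      rw [dist_sub_left]
      exact hφ.dist_le_mul y z
    · have h0 := notMem_tsupport_iff_eventuallyEq.1 h
      refine exists_lipschitzOn_congr (f := fun _ => (0 : ℝ)) ?_ ⟨univ, univ_mem, 0, by
        intro y _ z _; simp⟩
      filter_upwards [h0] with y hy
      simp [show 1 - φ y = 0 from hy]

end GlueLipschitz

section Glue

variable {X : Type*} [MetricSpace X] [MeasurableSpace X] [BorelSpace X] {m : Measure X}
  {E F : Set X}

theorem exists_seq_le_add {A : Set X} (h : Per m E A ≠ ∞) {ε : ℝ≥0∞} (hε : ε ≠ 0) :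
    ∃ fn : ℕ → X → ℝ, (∀ n, LocLipOn A (fn n)) ∧ TendstoL1loc m A fn (charFn E) ∧
      ∀ n, ∫⁻ x in A, mSlope (fn n) x ∂m ≤ Per m E A + ε :=
  exists_seq (ENNReal.lt_add_right h hε)

theorem aemeasurable_abs_sub_charFn (hE : MeasurableSet E) {A : Set X} (hA : IsOpen A)
    {f : X → ℝ} (hf : LocLipOn A f) :
    AEMeasurable (fun x => ENNReal.ofReal |f x - charFn E x|) (m.restrict A) := by
  have h1 : AEMeasurable f (m.restrict A) :=
    ContinuousOn.aemeasurable
      (fun x hx => (LocLipOn.continuousAt hA hf hx).continuousWithinAt) hA.measurableSet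
  have h2 : Measurable (charFn E) := measurable_const.indicator hE
  exact ((continuous_abs.measurable.comp_aemeasurable (h1.sub h2.aemeasurable))).ennreal_ofReal

theorem per_union_le_add (hE : MeasurableSet E) {U : Set X} (hU : IsOpen U) (hEF : Disjoint E F) :
    Per m (E ∪ F) U ≤ Per m E U + Per m F U := by
  refine ENNReal.le_of_forall_pos_le_add fun ε hε hfin => ?_
  have hε' : ((ε / 2 : NNReal) : ℝ≥0∞) ≠ 0 := by exact_mod_cast (half_pos hε).ne'
  obtain ⟨f, hfL, hfT, hfle⟩ := exists_seq_le_add (ENNReal.add_ne_top.1 hfin.ne).1 hε'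
  obtain ⟨g, hgL, hgT, hgle⟩ := exists_seq_le_add (ENNReal.add_ne_top.1 hfin.ne).2 hε'
  refine per_le_of_tendsto (fn := fun n x => f n x + g n x) (δ := fun _ => 0) hU ?_ ?_
    tendsto_const_nhds ?_
  · intro n
    rw [locLipOn_iff hU]
    exact fun x hx => exists_lipschitzOn_add ((locLipOn_iff hU).1 (hfL n) x hx)
      ((locLipOn_iff hU).1 (hgL n) x hx)
  · intro K hK hc
    have h1 := (hfT K hK hc).add (hgT K hK hc)
    rw [add_zero] at h1
    refine tendsto_of_tendsto_of_tendsto_of_le_of_le tendsto_const_nhds h1 (fun _ => bot_le)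
      fun n => ?_
    dsimp only
    rw [← lintegral_add_left' ((aemeasurable_abs_sub_charFn hE hU (hfL n)).mono_measure
      (Measure.restrict_mono hK le_rfl))]
    refine lintegral_mono fun x => ?_
    rw [← ENNReal.ofReal_add (abs_nonneg _) (abs_nonneg _)]
    refine ENNReal.ofReal_le_ofReal ?_
    have : charFn (E ∪ F) x = charFn E x + charFn F x := by
      rw [charFn, indicator_union_of_disjoint hEF]
    rw [this, add_sub_add_comm]
    exact abs_add_le _ _
  · intro n
    calc ∫⁻ x in U, mSlope (fun x => f n x + g n x) x ∂m
        ≤ ∫⁻ x in U, (mSlope (f n) x + mSlope (g n) x) ∂m :=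
          lintegral_mono fun x => mSlope_add_le _ _ x
      _ = ∫⁻ x in U, mSlope (f n) x ∂m + ∫⁻ x in U, mSlope (g n) x ∂m :=
          lintegral_add_left' (aemeasurable_mSlope hU (hfL n)) _
      _ ≤ (Per m E U + (ε / 2 : NNReal)) + (Per m F U + (ε / 2 : NNReal)) :=
          add_le_add (hfle n) (hgle n)
      _ = Per m E U + Per m F U + ε + 0 := by
          rw [add_add_add_comm, ← ENNReal.coe_add, add_halves, add_zero]

/-- Gluing by a Lipschitz partition of unity: the perimeter is subadditive on open sets
overlapping in a compact transition region. -/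
theorem per_le_add_of_glue (hE : MeasurableSet E) {A B V C : Set X} (hA : IsOpen A)
    (hB : IsOpen B) (hV : IsOpen V) {φ : X → ℝ} {K : NNReal} (hφ : LipschitzWith K φ)
    (h0 : ∀ x, 0 ≤ φ x) (h1 : ∀ x, φ x ≤ 1)
    (hVA : V ∩ tsupport φ ⊆ A) (hVB : V ∩ tsupport (fun x => 1 - φ x) ⊆ B)
    (hC : IsCompact C) (hCA : C ⊆ A) (hCB : C ⊆ B)
    (hVC : V ∩ tsupport φ ∩ tsupport (fun x => 1 - φ x) ⊆ C) :
    Per m E V ≤ Per m E A + Per m E B := by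
  refine ENNReal.le_of_forall_pos_le_add fun ε hε hfin => ?_
  have hε' : ((ε / 2 : NNReal) : ℝ≥0∞) ≠ 0 := by exact_mod_cast (half_pos hε).ne'
  obtain ⟨f, hfL, hfT, hfle⟩ := exists_seq_le_add (ENNReal.add_ne_top.1 hfin.ne).1 hε'
  obtain ⟨g, hgL, hgT, hgle⟩ := exists_seq_le_add (ENNReal.add_ne_top.1 hfin.ne).2 hε'
  have hsub : ∀ (h : X → ℝ) {D S : Set X}, IsOpen D → LocLipOn D h → S ⊆ D →
      MeasurableSet S →
      AEMeasurable (S.indicator fun x => ENNReal.ofReal |h x - charFn E x|) m := by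
    intro h D S hD hL hS hSm
    rw [aemeasurable_indicator_iff hSm]
    exact (aemeasurable_abs_sub_charFn hE hD hL).mono_measure (Measure.restrict_mono hS le_rfl)
  have hCm : MeasurableSet C := hC.measurableSet
  refine per_le_of_tendsto (fn := fun n x => φ x * f n x + (1 - φ x) * g n x)
    (δ := fun n => K * (∫⁻ x in C, ENNReal.ofReal |f n x - charFn E x| ∂m
      + ∫⁻ x in C, ENNReal.ofReal |g n x - charFn E x| ∂m)) hV
    (fun n => locLipOn_glue hA hB hV hφ hVA hVB (hfL n) (hgL n)) ?_ ?_ ?_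
  · intro Q hQ hQc
    have hS : IsCompact (Q ∩ tsupport φ) := hQc.inter_right (isClosed_tsupport _)
    have hT : IsCompact (Q ∩ tsupport fun x => 1 - φ x) := hQc.inter_right (isClosed_tsupport _)
    have hSA : Q ∩ tsupport φ ⊆ A := (inter_subset_inter_left _ hQ).trans hVA
    have hTB : (Q ∩ tsupport fun x => 1 - φ x) ⊆ B := (inter_subset_inter_left _ hQ).trans hVB
    have hlim := (hfT _ hSA hS).add (hgT _ hTB hT)
    rw [add_zero] at hlim
    refine tendsto_of_tendsto_of_tendsto_of_le_of_le tendsto_const_nhds hlim (fun _ => bot_le)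
      fun n => ?_
    dsimp only
    rw [← lintegral_indicator hS.measurableSet, ← lintegral_indicator hT.measurableSet,
      ← lintegral_indicator hQc.measurableSet,
      ← lintegral_add_left' (hsub _ hA (hfL n) hSA hS.measurableSet)]
    refine lintegral_mono fun x => ?_
    by_cases hxQ : x ∈ Q
    swap
    · simp [hxQ]
    rw [indicator_of_mem hxQ]
    have e : φ x * f n x + (1 - φ x) * g n x - charFn E x
        = φ x * (f n x - charFn E x) + (1 - φ x) * (g n x - charFn E x) := by ring
    rw [e]
    refine (ENNReal.ofReal_le_ofReal (abs_add_le _ _)).trans ?_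
    rw [ENNReal.ofReal_add (abs_nonneg _) (abs_nonneg _)]
    refine add_le_add ?_ ?_
    · by_cases hx : x ∈ tsupport φ
      · rw [indicator_of_mem (show x ∈ Q ∩ tsupport φ from ⟨hxQ, hx⟩)]
        refine ENNReal.ofReal_le_ofReal ?_
        rw [abs_mul, abs_of_nonneg (h0 x)]
        exact mul_le_of_le_one_left (abs_nonneg _) (h1 x)
      · rw [image_eq_zero_of_notMem_tsupport hx]
        simp
    · by_cases hx : x ∈ tsupport fun x => 1 - φ x
      · rw [indicator_of_mem (show x ∈ Q ∩ tsupport (fun x => 1 - φ x) from ⟨hxQ, hx⟩)]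
        refine ENNReal.ofReal_le_ofReal ?_
        rw [abs_mul, abs_of_nonneg (sub_nonneg.2 (h1 x))]
        exact mul_le_of_le_one_left (abs_nonneg _) (by linarith [h0 x])
      · have hx0 : 1 - φ x = 0 :=
          image_eq_zero_of_notMem_tsupport (f := fun x => 1 - φ x) hx
        rw [hx0]
        simp
  · have := ENNReal.Tendsto.const_mul (a := (K : ℝ≥0∞)) ((hfT C hCA hC).add (hgT C hCB hC))
      (Or.inr ENNReal.coe_ne_top)
    simpa using this
  · intro n
    have hmA : AEMeasurable (A.indicator (mSlope (f n))) m :=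
      (aemeasurable_indicator_iff hA.measurableSet).2 (aemeasurable_mSlope hA (hfL n))
    have hmB : AEMeasurable (B.indicator (mSlope (g n))) m :=
      (aemeasurable_indicator_iff hB.measurableSet).2 (aemeasurable_mSlope hB (hgL n))
    have hpt : ∀ x ∈ V, mSlope (fun y => φ y * f n y + (1 - φ y) * g n y) x ≤
        A.indicator (mSlope (f n)) x + (B.indicator (mSlope (g n)) x +
          K * (C.indicator (fun x => ENNReal.ofReal |f n x - charFn E x|) x
            + C.indicator (fun x => ENNReal.ofReal |g n x - charFn E x|) x)) := by
      intro x hx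
      by_cases hx1 : x ∈ tsupport φ
      · by_cases hx2 : x ∈ tsupport fun x => 1 - φ x
        · have hxC : x ∈ C := hVC ⟨⟨hx, hx1⟩, hx2⟩
          rw [indicator_of_mem hxC, indicator_of_mem hxC, indicator_of_mem (hCA hxC),
            indicator_of_mem (hCB hxC), ← add_assoc]
          refine (mSlope_glue_le hφ (LocLipOn.continuousAt hA (hfL n) (hCA hxC))
            (LocLipOn.continuousAt hB (hgL n) (hCB hxC)) (h0 x) (h1 x)).trans ?_
          refine add_le_add (add_le_add ?_ ?_) ?_
          · exact mul_le_of_le_one_left bot_le (by simpa using h1 x)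
          · exact mul_le_of_le_one_left bot_le (by simpa using h0 x)
          · rw [← ENNReal.ofReal_add (abs_nonneg _) (abs_nonneg _)]
            gcongr
            rw [← sub_sub_sub_cancel_right (f n x) (g n x) (charFn E x)]
            exact abs_sub _ _
        · have hz := notMem_tsupport_iff_eventuallyEq.1 hx2
          have : (fun y => φ y * f n y + (1 - φ y) * g n y) =ᶠ[𝓝 x] f n := by
            filter_upwards [hz] with y hy
            have hy' : 1 - φ y = 0 := hy
            rw [hy', show φ y = 1 by linarith]
            ring
          rw [mSlope_congr this, indicator_of_mem (hVA ⟨hx, hx1⟩)]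
          exact le_self_add
      · have hz := notMem_tsupport_iff_eventuallyEq.1 hx1
        have hx2 : x ∈ tsupport fun x => 1 - φ x := by
          refine subset_tsupport _ ?_
          simp [image_eq_zero_of_notMem_tsupport hx1]
        have : (fun y => φ y * f n y + (1 - φ y) * g n y) =ᶠ[𝓝 x] g n := by
          filter_upwards [hz] with y hy
          have hy' : φ y = 0 := hy
          rw [hy']
          ring
        rw [mSlope_congr this, indicator_of_mem (hVB ⟨hx, hx2⟩)]
        exact le_add_left le_self_add
    have hi1 := hsub _ hA (hfL n) hCA hCm
    calc ∫⁻ x in V, mSlope (fun y => φ y * f n y + (1 - φ y) * g n y) x ∂m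
        ≤ ∫⁻ x in V, (A.indicator (mSlope (f n)) x + (B.indicator (mSlope (g n)) x +
          K * (C.indicator (fun x => ENNReal.ofReal |f n x - charFn E x|) x
            + C.indicator (fun x => ENNReal.ofReal |g n x - charFn E x|) x))) ∂m :=
          setLIntegral_mono' hV.measurableSet hpt
      _ ≤ ∫⁻ x, (A.indicator (mSlope (f n)) x + (B.indicator (mSlope (g n)) x +
          K * (C.indicator (fun x => ENNReal.ofReal |f n x - charFn E x|) x
            + C.indicator (fun x => ENNReal.ofReal |g n x - charFn E x|) x))) ∂m :=
          setLIntegral_le_lintegral _ _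
      _ = ∫⁻ x in A, mSlope (f n) x ∂m + (∫⁻ x in B, mSlope (g n) x ∂m +
          K * (∫⁻ x in C, ENNReal.ofReal |f n x - charFn E x| ∂m
            + ∫⁻ x in C, ENNReal.ofReal |g n x - charFn E x| ∂m)) := by
          rw [lintegral_add_left' hmA, lintegral_add_left' hmB,
            lintegral_const_mul' _ _ ENNReal.coe_ne_top, lintegral_add_left' hi1,
            lintegral_indicator hA.measurableSet, lintegral_indicator hB.measurableSet,
            lintegral_indicator hCm, lintegral_indicator hCm]
      _ ≤ (Per m E A + (ε / 2 : NNReal)) + ((Per m E B + (ε / 2 : NNReal)) + _) :=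
          add_le_add (hfle n) (add_le_add (hgle n) le_rfl)
      _ = _ := by
          rw [← add_assoc, add_add_add_comm, ← ENNReal.coe_add, add_halves]

end Glue

end Gluing

section Radial

section Ramp

/-- The piecewise linear function that is `0` before `a` and `1` after `b`. -/
def ramp (a b t : ℝ) : ℝ := max 0 (min 1 ((t - a) / (b - a)))

theorem ramp_nonneg (a b t : ℝ) : 0 ≤ ramp a b t := le_max_left _ _

theorem ramp_le_one (a b t : ℝ) : ramp a b t ≤ 1 := max_le zero_le_one (min_le_left _ _)

theorem ramp_of_le {a b t : ℝ} (hab : a < b) (h : t ≤ a) : ramp a b t = 0 := by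
  refine max_eq_left ((min_le_right _ _).trans ?_)
  exact div_nonpos_of_nonpos_of_nonneg (by linarith) (by linarith)

theorem ramp_of_ge {a b t : ℝ} (hab : a < b) (h : b ≤ t) : ramp a b t = 1 := by
  have : 1 ≤ (t - a) / (b - a) := by
    rw [le_div_iff₀ (by linarith)]
    linarith
  rw [ramp, min_eq_left this]
  exact max_eq_right zero_le_one

theorem lipschitzWith_ramp {a b : ℝ} (hab : a < b) :
    LipschitzWith (Real.toNNReal (1 / (b - a))) (ramp a b) := by
  refine LipschitzWith.const_max (LipschitzWith.const_min ?_ 1) 0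
  refine LipschitzWith.of_dist_le_mul fun x y => ?_
  have hb : 0 < b - a := by linarith
  rw [Real.coe_toNNReal _ (by positivity), Real.dist_eq, Real.dist_eq, ← sub_div, abs_div,
    abs_of_pos hb, sub_sub_sub_cancel_right]
  exact le_of_eq (by ring)

theorem lipschitzWith_ramp_comp {X : Type*} [MetricSpace X] {a b : ℝ} (hab : a < b) {f : X → ℝ}
    (hf : LipschitzWith 1 f) :
    LipschitzWith (Real.toNNReal (1 / (b - a))) fun x => ramp a b (f x) := by
  have h := (lipschitzWith_ramp hab).comp hf
  rwa [mul_one] at h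

theorem tsupport_ramp_subset {X : Type*} [MetricSpace X] {a b : ℝ} (hab : a < b) {f : X → ℝ}
    (hf : Continuous f) : tsupport (fun x => ramp a b (f x)) ⊆ {x | a ≤ f x} := by
  refine closure_minimal (fun x hx => ?_) (isClosed_le continuous_const hf)
  by_contra h
  exact hx (ramp_of_le hab (le_of_lt (not_le.1 h)))

theorem tsupport_one_sub_ramp_subset {X : Type*} [MetricSpace X] {a b : ℝ} (hab : a < b)
    {f : X → ℝ} (hf : Continuous f) :
    tsupport (fun x => 1 - ramp a b (f x)) ⊆ {x | f x ≤ b} := by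
  refine closure_minimal (fun x hx => ?_) (isClosed_le hf continuous_const)
  by_contra h
  exact hx (by simp [ramp_of_ge hab (le_of_lt (not_le.1 h))])

end Ramp

section RadialGlue

variable {X : Type*} [MetricSpace X] [MeasurableSpace X] [BorelSpace X] {m : Measure X}
  {E F : Set X}

theorem per_le_add_radial [ProperSpace X] (hE : MeasurableSet E) {Ω : Set X} (hΩ : IsOpen Ω)
    {z : X} {α β : ℝ} (hαβ : α < β) (h : ∀ x, α ≤ dist x z → dist x z ≤ β → x ∈ Ω) :
    Per m E Ω ≤ Per m E (Ω \ closedBall z α) + Per m E (Ω ∩ ball z β) := by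
  obtain ⟨a, h1, h2⟩ := exists_between hαβ
  obtain ⟨b, h3, h4⟩ := exists_between h2
  have hd : LipschitzWith 1 fun x => dist x z := LipschitzWith.dist_left z
  have ht1 := tsupport_ramp_subset h3 hd.continuous
  have ht2 := tsupport_one_sub_ramp_subset h3 hd.continuous
  refine per_le_add_of_glue (C := {x | a ≤ dist x z} ∩ closedBall z b) hE
    (hΩ.sdiff isClosed_closedBall) (hΩ.inter isOpen_ball) hΩ
    (lipschitzWith_ramp_comp h3 hd) (fun x => ramp_nonneg _ _ _) (fun x => ramp_le_one _ _ _)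
    ?_ ?_ ((isCompact_closedBall z b).inter_left (isClosed_le continuous_const hd.continuous))
    ?_ ?_ ?_
  · rintro x ⟨hx, hx'⟩
    refine ⟨hx, fun hc => ?_⟩
    have h5 : a ≤ dist x z := ht1 hx'
    have h6 : dist x z ≤ α := hc
    linarith
  · rintro x ⟨hx, hx'⟩
    exact ⟨hx, lt_of_le_of_lt (show dist x z ≤ b from ht2 hx') h4⟩
  · rintro x ⟨hx, hx'⟩
    have h5 : a ≤ dist x z := hx
    have h6 : dist x z ≤ b := hx'
    refine ⟨h x (by linarith) (by linarith), fun hc => ?_⟩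
    have h6 : dist x z ≤ α := hc
    linarith
  · rintro x ⟨hx, hx'⟩
    have h5 : a ≤ dist x z := hx
    have h6 : dist x z ≤ b := hx'
    exact ⟨h x (by linarith) (by linarith), lt_of_le_of_lt h6 h4⟩
  · rintro x ⟨⟨hx, hx1⟩, hx2⟩
    exact ⟨ht1 hx1, ht2 hx2⟩

theorem exists_isOpen_per_lt_top [ProperSpace X] (hE : MeasurableSet E)
    (hfin : HasLocFinPer m E) {K : Set X} (hK : IsCompact K) :
    ∃ V, IsOpen V ∧ K ⊆ V ∧ Per m E V < ∞ := by
  suffices h : IsCompact (closure K) ∧ ∃ V, IsOpen V ∧ closure K ⊆ V ∧ Per m E V < ∞ by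
    obtain ⟨_, V, h1, h2, h3⟩ := h
    exact ⟨V, h1, subset_closure.trans h2, h3⟩
  refine hK.induction_on
    (p := fun S => IsCompact (closure S) ∧ ∃ V, IsOpen V ∧ closure S ⊆ V ∧ Per m E V < ∞)
    ?_ ?_ ?_ ?_
  · exact ⟨by simp, ∅, isOpen_empty, by simp, by simp [per_empty_right]⟩
  · rintro S T hST ⟨hc, V, h1, h2, h3⟩
    exact ⟨hc.of_isClosed_subset isClosed_closure (closure_mono hST), V, h1,
      (closure_mono hST).trans h2, h3⟩
  · rintro S T ⟨hc1, V1, ho1, hs1, hf1⟩ ⟨hc2, V2, ho2, hs2, hf2⟩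
    rw [closure_union]
    refine ⟨hc1.union hc2, ?_⟩
    rcases (closure S).eq_empty_or_nonempty with he | hne
    · exact ⟨V2, ho2, by simpa [he] using hs2, hf2⟩
    obtain ⟨δ1, hδ1, hV1⟩ := hc1.exists_cthickening_subset_open ho1 hs1
    obtain ⟨δ2, hδ2, hV2⟩ := hc2.exists_cthickening_subset_open ho2 hs2
    have hδ : δ1 / 2 < δ1 := half_lt_self hδ1
    have hd : LipschitzWith 1 fun x => infDist x (closure S) := lipschitz_infDist_pt _
    have ht1 := tsupport_ramp_subset hδ hd.continuous
    have ht2 := tsupport_one_sub_ramp_subset hδ hd.continuous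
    have hle : ∀ x, infDist x (closure S) ≤ δ1 → x ∈ cthickening δ1 (closure S) := by
      intro x hx
      rw [cthickening_eq_preimage_infEDist, mem_preimage, mem_Iic]
      rw [infDist] at hx
      exact (ENNReal.le_ofReal_iff_toReal_le (infEDist_ne_top hne) hδ1.le).2 hx
    have hth : ∀ x, x ∈ thickening (δ1 / 2) (closure S) → infDist x (closure S) < δ1 / 2 := by
      intro x hx
      rwa [mem_thickening_iff_infDist_lt hne] at hx
    refine ⟨thickening (δ1 / 2) (closure S) ∪ thickening δ2 (closure T),
      isOpen_thickening.union isOpen_thickening,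
      union_subset_union (self_subset_thickening (half_pos hδ1) _)
        (self_subset_thickening hδ2 _), lt_of_le_of_lt ?_ (ENNReal.add_lt_top.2 ⟨hf2, hf1⟩)⟩
    have key : ∀ x ∈ thickening (δ1 / 2) (closure S) ∪ thickening δ2 (closure T),
        δ1 / 2 ≤ infDist x (closure S) → x ∈ cthickening δ2 (closure T) := by
      rintro x (hx | hx) h'
      · exact absurd (hth x hx) (not_lt.2 h')
      · exact thickening_subset_cthickening _ _ hx
    refine per_le_add_of_glue (C := cthickening δ1 (closure S) ∩ cthickening δ2 (closure T)) hE
      ho2 ho1 (isOpen_thickening.union isOpen_thickening)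
      (lipschitzWith_ramp_comp hδ hd) (fun x => ramp_nonneg _ _ _) (fun x => ramp_le_one _ _ _)
      ?_ ?_ (hc1.cthickening.inter hc2.cthickening) (inter_subset_right.trans hV2)
      (inter_subset_left.trans hV1) ?_
    · rintro x ⟨hx, hx'⟩
      exact hV2 (key x hx (ht1 hx'))
    · rintro x ⟨hx, hx'⟩
      exact hV1 (hle x (ht2 hx'))
    · rintro x ⟨⟨hx, hx1⟩, hx2⟩
      exact ⟨hle x (ht2 hx2), key x hx (ht1 hx1)⟩
  · intro x _
    obtain ⟨r, hr, hfin⟩ := hfin x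
    have hs : closure (ball x (r / 2)) ⊆ closedBall x (r / 2) := closure_ball_subset_closedBall
    refine ⟨ball x (r / 2), mem_nhdsWithin_of_mem_nhds (ball_mem_nhds x (half_pos hr)),
      (isCompact_closedBall x (r / 2)).of_isClosed_subset isClosed_closure hs, ball x r,
      isOpen_ball, hs.trans (closedBall_subset_ball (half_lt_self hr)), hfin⟩

end RadialGlue

section Slice

variable {X : Type*} [MetricSpace X]

theorem mSlope_ramp_mul_le {x : X} {t z : ℝ} (htz : t < z) {f : X → ℝ} {y : X}
    (hf : ContinuousAt f y) :
    mSlope (fun p => ramp t z (dist p x) * f p) y ≤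
      ENNReal.ofReal (ramp t z (dist y x)) * mSlope f y + ENNReal.ofReal (1 / (z - t)) *
        ({p | t ≤ dist p x} ∩ closedBall x z).indicator (fun p => ENNReal.ofReal |f p|) y := by
  have hd : LipschitzWith 1 fun p => dist p x := LipschitzWith.dist_left x
  rcases lt_or_ge (dist y x) t with h | h
  · have : (fun p => ramp t z (dist p x) * f p) =ᶠ[𝓝 y] fun _ => 0 := by
      filter_upwards [hd.continuous.continuousAt.eventually (gt_mem_nhds h)] with p hp
      simp [ramp_of_le htz (le_of_lt hp)]
    rw [mSlope_congr this, mSlope_const]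
    exact bot_le
  rcases lt_or_ge z (dist y x) with h' | h'
  · have : (fun p => ramp t z (dist p x) * f p) =ᶠ[𝓝 y] f := by
      filter_upwards [hd.continuous.continuousAt.eventually (lt_mem_nhds h')] with p hp
      simp [ramp_of_ge htz (le_of_lt hp)]
    rw [mSlope_congr this, ramp_of_ge htz h'.le]
    simp
  · rw [indicator_of_mem (show y ∈ {p | t ≤ dist p x} ∩ closedBall x z from ⟨h, h'⟩)]
    have := mSlope_glue_le (lipschitzWith_ramp_comp htz hd) hf
      (continuousAt_const (y := (0 : ℝ))) (ramp_nonneg t z (dist y x)) (ramp_le_one t z (dist y x))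
    simpa [mSlope_const, ENNReal.ofReal] using this

theorem mSlope_one_sub_ramp_mul_le {x : X} {t z : ℝ} (htz : t < z) {f : X → ℝ} {y : X}
    (hf : ContinuousAt f y) :
    mSlope (fun p => (1 - ramp t z (dist p x)) * f p) y ≤
      ENNReal.ofReal (1 - ramp t z (dist y x)) * mSlope f y + ENNReal.ofReal (1 / (z - t)) *
        ({p | t ≤ dist p x} ∩ closedBall x z).indicator (fun p => ENNReal.ofReal |f p|) y := by
  have hd : LipschitzWith 1 fun p => dist p x := LipschitzWith.dist_left x
  rcases lt_or_ge z (dist y x) with h | h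
  · have : (fun p => (1 - ramp t z (dist p x)) * f p) =ᶠ[𝓝 y] fun _ => 0 := by
      filter_upwards [hd.continuous.continuousAt.eventually (lt_mem_nhds h)] with p hp
      simp [ramp_of_ge htz (le_of_lt hp)]
    rw [mSlope_congr this, mSlope_const]
    exact bot_le
  rcases lt_or_ge (dist y x) t with h' | h'
  · have : (fun p => (1 - ramp t z (dist p x)) * f p) =ᶠ[𝓝 y] f := by
      filter_upwards [hd.continuous.continuousAt.eventually (gt_mem_nhds h')] with p hp
      simp [ramp_of_le htz (le_of_lt hp)]
    rw [mSlope_congr this, ramp_of_le htz h'.le]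
    simp
  · rw [indicator_of_mem (show y ∈ {p | t ≤ dist p x} ∩ closedBall x z from ⟨h', h⟩)]
    have := mSlope_glue_le (lipschitzWith_ramp_comp htz hd)
      (continuousAt_const (y := (0 : ℝ))) hf (ramp_nonneg t z (dist y x))
      (ramp_le_one t z (dist y x))
    simpa [mSlope_const, ENNReal.ofReal] using this

end Slice

end Radial

section Cutoff

section Slicing

variable {X : Type*} [MetricSpace X] [MeasurableSpace X] {m : Measure X}
  {E F : Set X}

/-- The measure of the part of `E` in the closed ball of radius `r` centred at `x`. -/
def vol (m : Measure X) (E : Set X) (x : X) (r : ℝ) : ℝ := m.real (E ∩ closedBall x r)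

theorem measure_inter_closedBall_ne_top [ProperSpace X] [IsFiniteMeasureOnCompacts m] (E : Set X)
    (x : X) (r : ℝ) : m (E ∩ closedBall x r) ≠ ∞ :=
  ((measure_mono inter_subset_right).trans_lt (isCompact_closedBall x r).measure_lt_top).ne

theorem ofReal_vol [ProperSpace X] [IsFiniteMeasureOnCompacts m] (E : Set X) (x : X) (r : ℝ) :
    ENNReal.ofReal (vol m E x r) = m (E ∩ closedBall x r) :=
  ENNReal.ofReal_toReal (measure_inter_closedBall_ne_top E x r)

theorem vol_mono [ProperSpace X] [IsFiniteMeasureOnCompacts m] (E : Set X) (x : X) :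
    Monotone (vol m E x) := fun _ _ h =>
  ENNReal.toReal_mono (measure_inter_closedBall_ne_top E x _)
    (measure_mono (inter_subset_inter_right _ (closedBall_subset_closedBall h)))

variable [BorelSpace X]

theorem measure_inter_annulus [ProperSpace X] [IsFiniteMeasureOnCompacts m] {x : X} {t z : ℝ}
    (htz : t ≤ z) :
    m (E ∩ (closedBall x z \ closedBall x t)) = ENNReal.ofReal (vol m E x z - vol m E x t) := by
  have h := measure_inter_add_sdiff (μ := m) (E ∩ closedBall x z)
    (isClosed_closedBall (x := x) (ε := t)).measurableSet
  have e1 : E ∩ closedBall x z ∩ closedBall x t = E ∩ closedBall x t := by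
    rw [inter_assoc, inter_eq_right.2 (closedBall_subset_closedBall htz)]
  have hfin := measure_inter_closedBall_ne_top (m := m) E x t
  rw [ENNReal.ofReal_sub _ (show 0 ≤ vol m E x t from ENNReal.toReal_nonneg), ofReal_vol, ofReal_vol, ← h, e1,
    ENNReal.add_sub_cancel_left hfin, inter_sdiff_assoc]

theorem lintegral_mSlope_ramp_add_le [ProperSpace X] [IsFiniteMeasureOnCompacts m]
    (hE : MeasurableSet E) {Ω : Set X} (hΩ : IsOpen Ω)
    {f : X → ℝ} (hf : LocLipOn Ω f) {x : X} {t z : ℝ} (htz : t < z) (hsub : closedBall x z ⊆ Ω)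
    (hs : m (sphere x t) = 0) :
    ∫⁻ y in Ω, mSlope (fun p => ramp t z (dist p x) * f p) y ∂m +
      ∫⁻ y in Ω, mSlope (fun p => (1 - ramp t z (dist p x)) * f p) y ∂m ≤
    ∫⁻ y in Ω, mSlope f y ∂m + 2 * (ENNReal.ofReal (1 / (z - t)) *
      (∫⁻ y in closedBall x z, ENNReal.ofReal |f y - charFn E y| ∂m +
        ENNReal.ofReal (vol m E x z - vol m E x t))) := by
  have hd : LipschitzWith 1 fun p => dist p x := LipschitzWith.dist_left x
  set C : Set X := {p | t ≤ dist p x} ∩ closedBall x z with hC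
  have hCm : MeasurableSet C :=
    ((isClosed_le continuous_const hd.continuous).inter isClosed_closedBall).measurableSet
  have hCΩ : C ⊆ Ω := inter_subset_right.trans hsub
  have hc : ∀ y ∈ Ω, ContinuousAt f y := fun y hy => LocLipOn.continuousAt hΩ hf hy
  have hL : LocLipOn Ω (fun p => ramp t z (dist p x) * f p) := by
    rw [locLipOn_iff hΩ] at hf ⊢
    exact fun y hy => exists_lipschitzOn_mul
      ⟨univ, univ_mem, _, (lipschitzWith_ramp_comp htz hd).lipschitzOnWith⟩ (hf y hy)
  have hCf : ∫⁻ y in C, ENNReal.ofReal |f y| ∂m ≤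
      ∫⁻ y in closedBall x z, ENNReal.ofReal |f y - charFn E y| ∂m +
        ENNReal.ofReal (vol m E x z - vol m E x t) := by
    calc ∫⁻ y in C, ENNReal.ofReal |f y| ∂m
        ≤ ∫⁻ y in C, (ENNReal.ofReal |f y - charFn E y| + (E.indicator 1 y : ℝ≥0∞)) ∂m := by
          refine lintegral_mono fun y => ?_
          by_cases hy : y ∈ E
          · simp only [charFn, indicator_of_mem hy, Pi.one_apply]
            rw [← ENNReal.ofReal_one, ← ENNReal.ofReal_add (abs_nonneg _) zero_le_one]
            refine ENNReal.ofReal_le_ofReal ?_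
            have := abs_add_le (f y - 1) 1
            simpa using this
          · simp [charFn, indicator_of_notMem hy]
      _ = ∫⁻ y in C, ENNReal.ofReal |f y - charFn E y| ∂m + m (E ∩ C) := by
          rw [lintegral_add_right _ (measurable_one.indicator hE), lintegral_indicator_one hE,
            Measure.restrict_apply hE]
      _ ≤ _ := by
          refine add_le_add (lintegral_mono_set inter_subset_right) ?_
          rw [← measure_inter_annulus htz.le]
          refine le_trans (measure_mono (t := (E ∩ (closedBall x z \ closedBall x t)) ∪
            sphere x t) ?_) ((measure_union_le _ _).trans (by rw [hs, add_zero]))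
          rintro y ⟨hyE, hy1, hy2⟩
          rcases eq_or_lt_of_le (show t ≤ dist y x from hy1) with h | h
          · exact Or.inr h.symm
          · exact Or.inl ⟨hyE, hy2, not_le.2 h⟩
  have hpt : ∀ y ∈ Ω, mSlope (fun p => ramp t z (dist p x) * f p) y +
      mSlope (fun p => (1 - ramp t z (dist p x)) * f p) y ≤ mSlope f y +
        (2 * ENNReal.ofReal (1 / (z - t))) * C.indicator (fun p => ENNReal.ofReal |f p|) y := by
    intro y hy
    refine (add_le_add (mSlope_ramp_mul_le htz (hc y hy))
      (mSlope_one_sub_ramp_mul_le htz (hc y hy))).trans (le_of_eq ?_)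
    rw [add_add_add_comm, ← add_mul, ← ENNReal.ofReal_add (ramp_nonneg _ _ _)
      (sub_nonneg.2 (ramp_le_one _ _ _)), add_sub_cancel, ENNReal.ofReal_one, one_mul,
      ← two_mul, mul_assoc]
  rw [← lintegral_add_left' (aemeasurable_mSlope hΩ hL)]
  refine (setLIntegral_mono' hΩ.measurableSet hpt).trans ?_
  rw [lintegral_add_left' (aemeasurable_mSlope hΩ hf), lintegral_const_mul' _ _
    (ENNReal.mul_ne_top ENNReal.ofNat_ne_top ENNReal.ofReal_ne_top), mul_assoc]
  gcongr
  refine le_trans ?_ hCf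
  rw [← lintegral_indicator hCm]
  exact setLIntegral_le_lintegral _ _

theorem tendstoL1loc_ramp {Ω : Set X} {f : ℕ → X → ℝ}
    {x : X} {t : ℝ} {z : ℕ → ℝ} (htz : ∀ n, t < z n)
    (hz : Tendsto (fun n => m (closedBall x (z n) \ closedBall x t)) atTop (𝓝 0))
    (hf : TendstoL1loc m Ω f (charFn E)) :
    TendstoL1loc m Ω (fun n p => ramp t (z n) (dist p x) * f n p)
        (charFn (E \ closedBall x t)) ∧
      TendstoL1loc m Ω (fun n p => (1 - ramp t (z n) (dist p x)) * f n p)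
        (charFn (E ∩ closedBall x t)) := by
  have hmeas : ∀ n, MeasurableSet (closedBall x (z n) \ closedBall x t) := fun n =>
    isClosed_closedBall.measurableSet.diff isClosed_closedBall.measurableSet
  have key : ∀ Q : Set X, Q ⊆ Ω → IsCompact Q → ∀ g : ℕ → X → ℝ,
      (∀ n p, |g n p| ≤ |f n p - charFn E p| +
        (closedBall x (z n) \ closedBall x t).indicator (fun _ => (1 : ℝ)) p) →
      Tendsto (fun n => ∫⁻ p in Q, ENNReal.ofReal |g n p| ∂m) atTop (𝓝 0) := by
    intro Q hQ hQc g hg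
    have hlim := (hf Q hQ hQc).add hz
    rw [add_zero] at hlim
    refine tendsto_of_tendsto_of_tendsto_of_le_of_le tendsto_const_nhds hlim (fun _ => bot_le)
      fun n => ?_
    dsimp only
    calc ∫⁻ p in Q, ENNReal.ofReal |g n p| ∂m
        ≤ ∫⁻ p in Q, (ENNReal.ofReal |f n p - charFn E p| +
          ((closedBall x (z n) \ closedBall x t).indicator 1 p : ℝ≥0∞)) ∂m := by
          refine lintegral_mono fun p => (ENNReal.ofReal_le_ofReal (hg n p)).trans ?_
          refine ENNReal.ofReal_add_le.trans (add_le_add le_rfl ?_)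
          by_cases hp : p ∈ closedBall x (z n) \ closedBall x t
          · simp only [indicator_of_mem hp, ENNReal.ofReal_one, Pi.one_apply, le_refl]
          · simp only [indicator_of_notMem hp, ENNReal.ofReal_zero, le_refl]
      _ ≤ _ := by
          rw [lintegral_add_right _ (measurable_one.indicator (hmeas n)),
            lintegral_indicator_one (hmeas n), Measure.restrict_apply (hmeas n)]
          exact add_le_add le_rfl (measure_mono inter_subset_left)
  refine ⟨fun Q hQ hQc => key Q hQ hQc _ fun n p => ?_, fun Q hQ hQc => key Q hQ hQc _ fun n p => ?_⟩
  all_goals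
    have h0 := ramp_nonneg t (z n) (dist p x)
    have h1 := ramp_le_one t (z n) (dist p x)
    by_cases hp1 : p ∈ closedBall x t
    · have hr : ramp t (z n) (dist p x) = 0 := ramp_of_le (htz n) hp1
      by_cases hpE : p ∈ E <;> simp [charFn, hp1, hpE, hr]
    · by_cases hp2 : p ∈ closedBall x (z n)
      · rw [indicator_of_mem (show p ∈ closedBall x (z n) \ closedBall x t from ⟨hp2, hp1⟩)]
        by_cases hpE : p ∈ E
        · simp only [charFn, Set.mem_sdiff, mem_inter_iff, hpE, hp1, indicator, if_true, if_false,
            and_false, not_false_eq_true, and_true]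
          rw [abs_le]
          constructor <;> cases abs_cases (f n p - 1) <;> nlinarith
        · simp only [charFn, Set.mem_sdiff, mem_inter_iff, hpE, hp1, indicator, if_false,
            and_false, false_and, sub_zero]
          rw [abs_mul]
          have : |f n p| * 1 = |f n p| := mul_one _
          rw [abs_of_nonneg (by linarith)]
          nlinarith [abs_nonneg (f n p)]
      · have hr : ramp t (z n) (dist p x) = 1 :=
          ramp_of_ge (htz n) (le_of_lt (not_le.1 hp2))
        by_cases hpE : p ∈ E <;> simp [charFn, hp1, hp2, hpE, hr]

end Slicing

end Cutoff

section Slicing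

section PerSlice

variable {X : Type*} [MetricSpace X] [MeasurableSpace X] [BorelSpace X] {m : Measure X}
  {E F : Set X}

theorem exists_tendsto_slope_lt {g : ℝ → ℝ} {t t' L : ℝ} (htt' : t < t')
    (hL : ∃ᶠ z in 𝓝[>] t, slope g t z < L) :
    ∃ z : ℕ → ℝ, (∀ k, t < z k ∧ z k < t' ∧ slope g t (z k) < L) ∧ Tendsto z atTop (𝓝 t) := by
  have h : ∀ k : ℕ, ∃ z, t < z ∧ z < t' ∧ z < t + 1 / ((k : ℝ) + 1) ∧ slope g t z < L := by
    intro k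
    have hpos : t < t + 1 / ((k : ℝ) + 1) := by
      have : (0 : ℝ) < 1 / ((k : ℝ) + 1) := by positivity
      linarith
    have hev : ∀ᶠ z in 𝓝[>] t, z ∈ Ioo t t' ∩ Ioo t (t + 1 / ((k : ℝ) + 1)) :=
      inter_mem (Ioo_mem_nhdsGT htt') (Ioo_mem_nhdsGT hpos)
    obtain ⟨z, hz1, hz2, hz3⟩ := (hL.and_eventually hev).exists
    exact ⟨z, hz2.1, hz2.2, hz3.2, hz1⟩
  choose z h1 h2 h3 h4 using h
  refine ⟨z, fun k => ⟨h1 k, h2 k, h4 k⟩, ?_⟩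
  have hlim : Tendsto (fun k : ℕ => t + 1 / ((k : ℝ) + 1)) atTop (𝓝 (t + 0)) :=
    tendsto_const_nhds.add tendsto_one_div_add_atTop_nhds_zero_nat
  rw [add_zero] at hlim
  exact tendsto_of_tendsto_of_tendsto_of_le_of_le tendsto_const_nhds hlim
    (fun k => (h1 k).le) (fun k => (h3 k).le)

theorem tendsto_measure_annulus [ProperSpace X] [IsFiniteMeasureOnCompacts m] {x : X} {t : ℝ}
    {z : ℕ → ℝ} (h1 : ∀ k, t < z k) (h2 : Tendsto z atTop (𝓝 t)) :
    Tendsto (fun k => m (closedBall x (z k) \ closedBall x t)) atTop (𝓝 0) := by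
  have hm : ∀ r, NullMeasurableSet (closedBall x r \ closedBall x t) m := fun r =>
    (isClosed_closedBall.measurableSet.diff isClosed_closedBall.measurableSet).nullMeasurableSet
  have h := tendsto_measure_biInter_gt (μ := m) (s := fun r => closedBall x r \ closedBall x t)
    (a := t) (fun r _ => hm r)
    (fun i j _ hij => sdiff_subset_sdiff_left (closedBall_subset_closedBall hij))
    ⟨t + 1, by linarith, ((measure_mono sdiff_subset).trans_lt
      (isCompact_closedBall x (t + 1)).measure_lt_top).ne⟩
  have he : (⋂ r > t, closedBall x r \ closedBall x t) = ∅ := by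
    ext y
    simp only [mem_iInter, Set.mem_sdiff, mem_closedBall, mem_empty_iff_false, iff_false, not_forall]
    by_cases hy : dist y x ≤ t
    · exact ⟨t + 1, by simp, fun h => h.2 hy⟩
    · refine ⟨(t + dist y x) / 2, ?_, fun h => ?_⟩
      · show t < _
        linarith [not_le.1 hy]
      · linarith [not_le.1 hy, h.1]
  rw [he, measure_empty] at h
  exact h.comp (tendsto_nhdsWithin_iff.2 ⟨h2, Eventually.of_forall h1⟩)

/-- Cutting a set along a sphere costs at most twice the derivative of the volume. -/
theorem per_slice_le [ProperSpace X] [IsFiniteMeasureOnCompacts m] (hE : MeasurableSet E)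
    {Ω : Set X} (hΩ : IsOpen Ω) {x : X} {t t' L : ℝ} (htt' : t < t')
    (hsub : closedBall x t' ⊆ Ω) (hs : m (sphere x t) = 0)
    (hL : ∃ᶠ z in 𝓝[>] t, slope (vol m E x) t z < L) :
    Per m (E \ closedBall x t) Ω + Per m (E ∩ closedBall x t) Ω ≤
      Per m E Ω + 2 * ENNReal.ofReal L := by
  refine ENNReal.le_of_forall_pos_le_add fun ε hε hfin => ?_
  have hε' : ((ε : NNReal) : ℝ≥0∞) ≠ 0 := by exact_mod_cast hε.ne'
  obtain ⟨f, hfL, hfT, hfle⟩ := exists_seq_le_add (ENNReal.add_ne_top.1 hfin.ne).1 hε'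
  obtain ⟨z, hz, hzt⟩ := exists_tendsto_slope_lt htt' hL
  have hlim : ∀ k : ℕ, Tendsto (fun n => ENNReal.ofReal (1 / (z k - t)) *
      ∫⁻ y in closedBall x t', ENNReal.ofReal |f n y - charFn E y| ∂m) atTop (𝓝 0) := by
    intro k
    have := ENNReal.Tendsto.const_mul (a := ENNReal.ofReal (1 / (z k - t)))
      (hfT _ hsub (isCompact_closedBall x t')) (Or.inr ENNReal.ofReal_ne_top)
    simpa using this
  have hex : ∀ k : ℕ, ∃ n, k ≤ n ∧ ENNReal.ofReal (1 / (z k - t)) *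
      ∫⁻ y in closedBall x t', ENNReal.ofReal |f n y - charFn E y| ∂m ≤ ((k : ℝ≥0∞) + 1)⁻¹ := by
    intro k
    have h1 : (0 : ℝ≥0∞) < ((k : ℝ≥0∞) + 1)⁻¹ := ENNReal.inv_pos.2 (by finiteness)
    obtain ⟨n, hn1, hn2⟩ :=
      (((hlim k).eventually (gt_mem_nhds h1)).and (eventually_ge_atTop k)).exists
    exact ⟨n, hn2, hn1.le⟩
  choose ν hν1 hν2 using hex
  have hν : Tendsto ν atTop atTop := tendsto_atTop_mono hν1 tendsto_id
  obtain ⟨hT1, hT2⟩ := tendstoL1loc_ramp (fun k => (hz k).1)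
    (tendsto_measure_annulus (m := m) (x := x) (fun k => (hz k).1) hzt) (TendstoL1loc.comp hfT hν)
  have hL1 : ∀ k, LocLipOn Ω fun p => ramp t (z k) (dist p x) * f (ν k) p := fun k =>
    (locLipOn_iff hΩ).2 fun y hy => exists_lipschitzOn_mul
      ⟨univ, univ_mem, _, (lipschitzWith_ramp_comp (hz k).1
        (LipschitzWith.dist_left x)).lipschitzOnWith⟩ ((locLipOn_iff hΩ).1 (hfL _) y hy)
  have hL2 : ∀ k, LocLipOn Ω fun p => (1 - ramp t (z k) (dist p x)) * f (ν k) p := by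
    intro k
    refine (locLipOn_iff hΩ).2 fun y hy => exists_lipschitzOn_mul
      ⟨univ, univ_mem, Real.toNNReal (1 / (z k - t)), ?_⟩ ((locLipOn_iff hΩ).1 (hfL _) y hy)
    refine LipschitzOnWith.of_dist_le_mul fun p _ q _ => ?_
    rw [dist_sub_left]
    exact (lipschitzWith_ramp_comp (hz k).1 (LipschitzWith.dist_left x)).dist_le_mul p q
  refine (add_le_add (per_le_liminf hΩ hL1 hT1) (per_le_liminf hΩ hL2 hT2)).trans ?_
  refine (liminf_add_liminf_le_ennreal _ _).trans ?_
  have hbound : ∀ k, ∫⁻ y in Ω, mSlope (fun p => ramp t (z k) (dist p x) * f (ν k) p) y ∂m +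
      ∫⁻ y in Ω, mSlope (fun p => (1 - ramp t (z k) (dist p x)) * f (ν k) p) y ∂m ≤
      Per m E Ω + ε + 2 * (((k : ℝ≥0∞) + 1)⁻¹ + ENNReal.ofReal L) := by
    intro k
    obtain ⟨h1, h2, h3⟩ := hz k
    refine (lintegral_mSlope_ramp_add_le hE hΩ (hfL (ν k)) h1
      ((closedBall_subset_closedBall h2.le).trans hsub) hs).trans ?_
    refine add_le_add (hfle _) ?_
    rw [mul_add]
    gcongr
    · exact le_trans (by gcongr) (hν2 k)
    · rw [← ENNReal.ofReal_mul (by have := sub_pos.2 h1; positivity)]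
      refine ENNReal.ofReal_le_ofReal ?_
      rw [slope_def_field] at h3
      rw [one_div, inv_mul_eq_div]
      exact h3.le
  refine (liminf_le_liminf (Eventually.of_forall hbound)).trans ?_
  have h0 : Tendsto (fun k : ℕ => ((k : ℝ≥0∞) + 1)⁻¹) atTop (𝓝 0) := by
    have := (tendsto_add_atTop_iff_nat 1).2 ENNReal.tendsto_inv_nat_nhds_zero
    simpa using this
  have h1 : Tendsto (fun k : ℕ => Per m E Ω + ε + 2 * (((k : ℝ≥0∞) + 1)⁻¹ + ENNReal.ofReal L))
      atTop (𝓝 (Per m E Ω + ε + 2 * (0 + ENNReal.ofReal L))) :=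
    tendsto_const_nhds.add (ENNReal.Tendsto.const_mul (h0.add tendsto_const_nhds)
      (Or.inr ENNReal.ofNat_ne_top))
  rw [h1.liminf_eq, zero_add, add_right_comm]

end PerSlice

end Slicing

section Geometry

variable {X : Type*} [MetricSpace X]

theorem exists_path (hlen : IsLengthSpace X) (p q : X) {δ : ℝ} (hδ : 0 < δ) :
    ∃ γ : ℝ → X, ContinuousOn γ (Icc 0 1) ∧ γ 0 = p ∧ γ 1 = q ∧
      ∀ s ∈ Icc (0 : ℝ) 1, dist p (γ s) + dist (γ s) q ≤ dist p q + δ := by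
  have h : ENNReal.ofReal (dist p q) < ENNReal.ofReal (dist p q + δ) :=
    (ENNReal.ofReal_lt_ofReal_iff (by positivity)).2 (by linarith)
  rw [hlen p q] at h
  simp only [iInf_lt_iff] at h
  obtain ⟨γ, hc, h0, h1, hlt⟩ := h
  refine ⟨γ, hc, h0, h1, fun s hs => ?_⟩
  have h2 : edist p (γ s) + edist (γ s) q ≤ eVariationOn γ (Icc 0 1) := by
    have e := eVariationOn.Icc_add_Icc (s := Icc (0 : ℝ) 1) γ hs.1 hs.2 hs
    rw [inter_eq_right.2 (Icc_subset_Icc le_rfl hs.2), inter_eq_right.2 (Icc_subset_Icc hs.1 le_rfl),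
      inter_self] at e
    rw [← e, ← h0, ← h1]
    exact add_le_add (eVariationOn.edist_le γ (left_mem_Icc.2 hs.1) (right_mem_Icc.2 hs.1))
      (eVariationOn.edist_le γ (left_mem_Icc.2 hs.2) (right_mem_Icc.2 hs.2))
  rw [edist_dist, edist_dist, ← ENNReal.ofReal_add dist_nonneg dist_nonneg] at h2
  exact ((ENNReal.ofReal_lt_ofReal_iff_of_nonneg (by positivity)).1 (h2.trans_lt hlt)).le

theorem exists_dist_eq (hlen : IsLengthSpace X) (p q : X) {a δ : ℝ} (ha : 0 ≤ a)
    (haq : a ≤ dist p q) (hδ : 0 < δ) : ∃ w, dist p w = a ∧ dist w q ≤ dist p q - a + δ := by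
  obtain ⟨γ, hc, h0, h1, h⟩ := exists_path hlen p q hδ
  have hcd : ContinuousOn (fun s => dist p (γ s)) (Icc 0 1) := (continuous_const.dist continuous_id).comp_continuousOn hc
  have hmem : a ∈ Icc (dist p (γ 0)) (dist p (γ 1)) := by
    rw [h0, h1, dist_self]
    exact ⟨ha, haq⟩
  obtain ⟨s, hs, hsa⟩ := intermediate_value_Icc zero_le_one hcd hmem
  have hsa' : dist p (γ s) = a := hsa
  refine ⟨γ s, hsa', ?_⟩
  have := h s hs
  rw [hsa'] at this
  linarith

variable [MeasurableSpace X] {m : Measure X}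

theorem isFiniteMeasureOnCompacts_of_boundedlyFinite (h : BoundedlyFinite m) :
    IsFiniteMeasureOnCompacts m := ⟨fun _ hK => h _ hK.isBounded⟩

theorem eq_zero_of_ball_null {C_D : ℝ → ℝ} (h : UnifLocDoublingWith C_D m) {x : X} {r : ℝ}
    (hr : 0 < r) (h0 : m (ball x r) = 0) : m = 0 := by
  have hn : ∀ n : ℕ, m (ball x (2 ^ n * r)) = 0 := by
    intro n
    induction n with
    | zero => simpa using h0
    | succ n ih =>
      rw [pow_succ', mul_assoc]
      have := h (2 ^ n * r + 1) (by positivity) x (2 ^ n * r) (by positivity) (by linarith)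
      rw [ih, mul_zero] at this
      exact le_antisymm this bot_le
  have hu : (⋃ n : ℕ, ball x (2 ^ n * r)) = univ := by
    refine eq_univ_of_forall fun y => mem_iUnion.2 ?_
    have ht : Tendsto (fun n : ℕ => (2 : ℝ) ^ n * r) atTop atTop :=
      (tendsto_pow_atTop_atTop_of_one_lt (one_lt_two (α := ℝ))).atTop_mul_const hr
    obtain ⟨n, hn⟩ := (ht.eventually (eventually_gt_atTop (dist y x))).exists
    exact ⟨n, hn⟩
  rw [← Measure.measure_univ_eq_zero, ← hu]
  exact measure_iUnion_null hn

theorem measure_ball_two_pow_mul_le {C_D : ℝ → ℝ} (h : UnifLocDoublingWith C_D m) {R : ℝ} {x : X}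
    {r : ℝ} (hr : 0 < r) (n : ℕ) (hn : 2 ^ n * r < R) :
    m (ball x (2 ^ n * r)) ≤ ENNReal.ofReal (C_D R) ^ n * m (ball x r) := by
  induction n with
  | zero => simp
  | succ n ih =>
    rw [pow_succ'] at hn
    have hp : 0 < 2 ^ n * r := by positivity
    have := h R (by linarith) x (2 ^ n * r) hp (by linarith)
    rw [pow_succ', mul_assoc, pow_succ', mul_assoc]
    exact this.trans (by gcongr; exact ih (by linarith))

theorem properSpace_of_doubling [CompleteSpace X] [BorelSpace X] (hbf : BoundedlyFinite m)
    {C_D : ℝ → ℝ} (h : UnifLocDoublingWith C_D m) (hpos : ∀ x : X, ∀ r > 0, 0 < m (ball x r)) :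
    ProperSpace X := by
  refine ⟨fun x R => ?_⟩
  rcases lt_or_ge R 0 with hR | hR
  · simp [closedBall_eq_empty.2 hR]
  refine TotallyBounded.isCompact_of_isClosed (Metric.totallyBounded_iff.2 fun ε hε => ?_)
    isClosed_closedBall
  obtain ⟨u, hu1, hu2, hu3⟩ := Vitali.exists_disjoint_subfamily_covering_enlargement_closedBall
    (closedBall x R) (fun y => y) (fun _ => ε / 6) (ε / 6) (fun _ _ => le_rfl) 5 (by norm_num)
  obtain ⟨n, hn⟩ : ∃ n : ℕ, 2 * R + 1 < 2 ^ n * (ε / 6) :=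
    (((tendsto_pow_atTop_atTop_of_one_lt (one_lt_two (α := ℝ))).atTop_mul_const
      (show 0 < ε / 6 by positivity)).eventually (eventually_gt_atTop (2 * R + 1))).exists
  set C := ENNReal.ofReal (C_D (2 ^ n * (ε / 6) + 1)) with hC
  have hlow : ∀ y ∈ closedBall x R, m (ball x (R + 1)) ≤ C ^ n * m (closedBall y (ε / 6)) := by
    intro y hy
    have h1 : ball x (R + 1) ⊆ ball y (2 ^ n * (ε / 6)) :=
      ball_subset_ball' (by have : dist x y ≤ R := by rw [dist_comm]; exact hy
                            linarith)
    refine (measure_mono h1).trans ((measure_ball_two_pow_mul_le h (by positivity) n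
      (lt_add_one _)).trans ?_)
    gcongr
    exact ball_subset_closedBall
  have hfin : u.Finite := by
    have hc0 : 0 < m (ball x (R + 1)) := hpos x (R + 1) (by linarith)
    have hCt : C ^ n ≠ ∞ := ENNReal.pow_ne_top ENNReal.ofReal_ne_top
    have hC0 : C ^ n ≠ 0 := by
      intro h0
      have := hlow x (mem_closedBall_self hR)
      rw [h0, zero_mul] at this
      exact absurd hc0 (not_lt.2 this)
    have hb := Measure.finite_const_le_meas_of_disjoint_iUnion (ι := u) m
      (ε := m (ball x (R + 1)) / C ^ n) (As := fun y => closedBall (y : X) (ε / 6))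
      (ENNReal.div_pos hc0.ne' hCt) (fun _ => isClosed_closedBall.measurableSet)
      (fun i j hij => hu2 i.2 j.2 (fun he => hij (Subtype.ext he)))
      ((measure_mono (t := ball x (R + ε)) (iUnion_subset fun y => closedBall_subset_ball' (by
        have : dist (y : X) x ≤ R := hu1 y.2
        linarith))).trans_lt (hbf _ isBounded_ball)).ne
    have hall : {y : u | m (ball x (R + 1)) / C ^ n ≤ m (closedBall (y : X) (ε / 6))} = univ :=
      eq_univ_of_forall fun y => ENNReal.div_le_of_le_mul' (hlow y (hu1 y.2))
    rw [hall] at hb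
    exact finite_coe_iff.1 (finite_univ_iff.1 hb)
  refine ⟨u, hfin, fun y hy => ?_⟩
  obtain ⟨b, hb, hsub⟩ := hu3 y hy
  refine mem_iUnion₂.2 ⟨b, hb, ?_⟩
  have : dist y b ≤ 5 * (ε / 6) := hsub (mem_closedBall_self (by positivity))
  exact lt_of_le_of_lt this (by linarith)

/-- Quantitative form of the assumptions on the space, at scales below `1`. -/
structure LocalPI (m : Measure X) (N : ℕ) (lam P : ℝ) : Prop where
  isLength : IsLengthSpace X
  one_le_N : 1 ≤ N
  one_le_lam : 1 ≤ lam
  P_pos : 0 < P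
  ball_pos : ∀ x : X, ∀ r > 0, 0 < m.real (ball x r)
  doubling : ∀ x : X, ∀ r, 0 < r → r < 1 → m.real (ball x (2 * r)) ≤ 2 ^ N * m.real (ball x r)
  poincare : ∀ f : X → ℝ, LocLipOn univ f → ∀ x : X, ∀ r, 0 < r → r < 1 →
    ∃ θ : ℝ, ∫⁻ y in ball x r, ENNReal.ofReal |f y - θ| ∂m ≤
      ENNReal.ofReal (P * r) * ∫⁻ y in ball x (lam * r), mSlope f y ∂m
  sphere_null : ∀ x : X, ∀ r > 0, m (sphere x r) = 0

theorem measure_ball_ne_top [ProperSpace X] [IsFiniteMeasureOnCompacts m] (x : X) (r : ℝ) :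
    m (ball x r) ≠ ∞ :=
  ((measure_mono ball_subset_closedBall).trans_lt (isCompact_closedBall x r).measure_lt_top).ne

theorem sphere_null_of_doubling [SecondCountableTopology X] [BorelSpace X] [ProperSpace X]
    [IsFiniteMeasureOnCompacts m]
    (hlen : IsLengthSpace X) {D : NNReal}
    (hpos : ∀ x : X, ∀ r > 0, 0 < m (ball x r))
    (hd : ∀ x : X, ∀ r, 0 < r → r < 1 → m (ball x (2 * r)) ≤ D * m (ball x r))
    (x : X) {r : ℝ} (hr : 0 < r) : m (sphere x r) = 0 := by
  have hd2 : ∀ y : X, ∀ s, 0 < s → s < 1 / 2 → m (ball y (4 * s)) ≤ D ^ 2 * m (ball y s) := by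
    intro y s hs hs'
    have := hd y (2 * s) (by positivity) (by linarith)
    rw [show 2 * (2 * s) = 4 * s by ring] at this
    refine this.trans ?_
    rw [pow_two, mul_assoc]
    gcongr
    exact hd y s hs (by linarith)
  have hd3 : ∀ y : X, ∀ s, 0 < s → s < 1 / 4 → m (ball y (8 * s)) ≤ D ^ 3 * m (ball y s) := by
    intro y s hs hs'
    have := hd y (4 * s) (by positivity) (by linarith)
    rw [show 2 * (4 * s) = 8 * s by ring] at this
    refine this.trans ?_
    rw [pow_succ', mul_assoc]
    gcongr
    exact hd2 y s hs (by linarith)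
  have : IsUnifLocDoublingMeasure m := by
    refine ⟨⟨D ^ 2, ?_⟩⟩
    filter_upwards [Ioo_mem_nhdsGT (show (0 : ℝ) < 1 / 2 by norm_num)] with s hs y
    refine (measure_mono (closedBall_subset_ball (show 2 * s < 4 * s by linarith [hs.1]))).trans
      ((hd2 y s hs.1 hs.2).trans ?_)
    push_cast
    gcongr
    exact ball_subset_closedBall
  have hae := IsUnifLocDoublingMeasure.ae_tendsto_measure_inter_div m (sphere x r) 1
  rw [← Measure.restrict_eq_zero, ← ae_eq_bot]
  by_contra hne
  have : (ae (m.restrict (sphere x r))).NeBot := ⟨hne⟩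
  obtain ⟨z, hz, hzs⟩ := (hae.and (ae_restrict_mem isClosed_sphere.measurableSet)).exists
  have hlim := hz (l := 𝓝[>] (0 : ℝ)) (fun _ => z) (fun s => s) tendsto_id
    (by filter_upwards [self_mem_nhdsWithin] with s hs
        exact mem_closedBall_self (by rw [one_mul]; exact le_of_lt hs))
  have hD0 : ((D : ℝ≥0∞) ^ 3) ≠ ∞ := by finiteness
  have hlt : (1 : ℝ≥0∞) - ((D : ℝ≥0∞) ^ 3)⁻¹ < 1 :=
    ENNReal.sub_lt_self ENNReal.one_ne_top one_ne_zero (ENNReal.inv_ne_zero.2 hD0)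
  have hev := hlim.eventually (lt_mem_nhds hlt)
  obtain ⟨h, h1, h2⟩ := (hev.and (Ioo_mem_nhdsGT (show (0 : ℝ) < min r (1 / 2) by positivity))).exists
  have hh0 : 0 < h := h2.1
  have hhr : h < r := h2.2.trans_le (min_le_left _ _)
  have hh1 : h < 1 / 2 := h2.2.trans_le (min_le_right _ _)
  obtain ⟨w, hw1, hw2⟩ := exists_dist_eq hlen z x (a := h / 2) (δ := h / 8) (by positivity)
    (by rw [show dist z x = r from hzs]; linarith) (by positivity)
  rw [show dist z x = r from hzs] at hw2
  have hsub1 : ball w (h / 4) ⊆ closedBall z h := by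
    refine (ball_subset_closedBall).trans (closedBall_subset_closedBall' ?_)
    rw [dist_comm, hw1]
    linarith
  have hdisj : Disjoint (sphere x r ∩ closedBall z h) (ball w (h / 4)) := by
    rw [Set.disjoint_left]
    rintro y ⟨hy, -⟩ hy'
    have e1 : dist y x = r := hy
    have e2 : dist y w < h / 4 := hy'
    have e3 := dist_triangle y w x
    linarith
  have hball : m (closedBall z h) ≤ D ^ 3 * m (ball w (h / 4)) := by
    refine (measure_mono (closedBall_subset_ball' ?_)).trans (hd3 w (h / 4) (by linarith) (by linarith))
    rw [hw1]
    linarith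
  have hcb : m (closedBall z h) ≠ ∞ := (isCompact_closedBall z h).measure_lt_top.ne
  have hcb0 : m (closedBall z h) ≠ 0 :=
    ((hpos z h hh0).trans_le (measure_mono ball_subset_closedBall)).ne'
  have hadd : m (sphere x r ∩ closedBall z h) + m (ball w (h / 4)) ≤ m (closedBall z h) := by
    rw [← measure_union hdisj isOpen_ball.measurableSet]
    exact measure_mono (union_subset inter_subset_right hsub1)
  refine absurd h1 (not_lt.2 ?_)
  rw [ENNReal.div_le_iff hcb0 hcb]
  rw [ENNReal.sub_mul (fun _ _ => hcb), one_mul]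
  refine le_trans (ENNReal.le_sub_of_add_le_right (measure_ball_ne_top w _) hadd) ?_
  refine tsub_le_tsub_left ?_ _
  rw [mul_comm, ← div_eq_mul_inv]
  exact ENNReal.div_le_of_le_mul' hball

theorem exists_localPI [SecondCountableTopology X] [BorelSpace X] [ProperSpace X]
    [IsFiniteMeasureOnCompacts m] (hPI : IsPIspace m) (hlen : IsLengthSpace X)
    (hpos : ∀ x : X, ∀ r > 0, 0 < m (ball x r)) : ∃ N lam P, LocalPI m N lam P := by
  obtain ⟨⟨C_D, -, hD⟩, lam, hlam, C_P, hP0, hP⟩ := hPI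
  obtain ⟨N, hN⟩ := pow_unbounded_of_one_lt (C_D 1) (one_lt_two (α := ℝ))
  have hN' : C_D 1 ≤ 2 ^ (N + 1) := hN.le.trans (pow_le_pow_right₀ one_le_two (Nat.le_succ N))
  refine ⟨N + 1, lam, C_P 1, hlen, by omega, hlam, hP0 1 one_pos, ?_, ?_, ?_, ?_⟩
  · exact fun x r hr => ENNReal.toReal_pos (hpos x r hr).ne' (measure_ball_ne_top x r)
  · intro x r hr hr1
    have h := hD 1 one_pos x r hr hr1
    have h2 := ENNReal.toReal_mono
      (ENNReal.mul_ne_top ENNReal.ofReal_ne_top (measure_ball_ne_top x r)) h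
    rw [ENNReal.toReal_mul] at h2
    refine h2.trans (mul_le_mul_of_nonneg_right ?_ ENNReal.toReal_nonneg)
    rw [ENNReal.toReal_ofReal']
    exact max_le hN' (by positivity)
  · intro f hf x r hr hr1
    refine ⟨⨍ z in ball x r, f z ∂m, ?_⟩
    · have h := hP f hf 1 one_pos x r hr hr1
      have h0 : m (ball x r) ≠ 0 := (hpos x r hr).ne'
      have h1 := measure_ball_ne_top (m := m) x r
      rw [ENNReal.div_le_iff h0 h1] at h
      refine h.trans ?_
      rw [mul_assoc]
      gcongr
      rw [ENNReal.div_eq_inv_mul, mul_comm, ← mul_assoc]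
      refine mul_le_of_le_one_left bot_le ?_
      rw [← div_eq_mul_inv]
      exact ENNReal.div_le_of_le_mul (by
        rw [one_mul]; exact measure_mono (ball_subset_ball (by nlinarith)))
  · intro x r hr
    refine sphere_null_of_doubling hlen (D := (C_D 1).toNNReal) hpos ?_ x hr
    exact fun y s hs hs1 => hD 1 one_pos y s hs hs1

end Geometry

section Density

theorem min_measure_le_lintegral {X : Type*} [MeasurableSpace X] {m : Measure X} {G B : Set X}
    (hG : MeasurableSet G) (hB : MeasurableSet B) (θ : ℝ) :
    min (m (B ∩ G)) (m (B \ G)) ≤ ∫⁻ y in B, ENNReal.ofReal |charFn G y - θ| ∂m := by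
  rw [← lintegral_inter_add_sdiff _ B hG]
  have h1 : ∫⁻ _ in B ∩ G, ENNReal.ofReal |1 - θ| ∂m ≤
      ∫⁻ y in B ∩ G, ENNReal.ofReal |charFn G y - θ| ∂m := by
    refine setLIntegral_mono' (hB.inter hG) fun y hy => ?_
    rw [charFn, indicator_of_mem hy.2]
  have h2 : ∫⁻ _ in B \ G, ENNReal.ofReal |θ| ∂m ≤
      ∫⁻ y in B \ G, ENNReal.ofReal |charFn G y - θ| ∂m := by
    refine setLIntegral_mono' (hB.diff hG) fun y hy => ?_
    rw [charFn, indicator_of_notMem hy.2, zero_sub, abs_neg]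
  refine le_trans ?_ (add_le_add h1 h2)
  rw [setLIntegral_const, setLIntegral_const]
  have h3 : (1 : ℝ≥0∞) ≤ ENNReal.ofReal |1 - θ| + ENNReal.ofReal |θ| := by
    rw [← ENNReal.ofReal_add (abs_nonneg _) (abs_nonneg _), ← ENNReal.ofReal_one]
    refine ENNReal.ofReal_le_ofReal ?_
    have := abs_add_le (1 - θ) θ
    rwa [sub_add_cancel, abs_one] at this
  calc min (m (B ∩ G)) (m (B \ G)) = 1 * min (m (B ∩ G)) (m (B \ G)) := (one_mul _).symm
    _ ≤ (ENNReal.ofReal |1 - θ| + ENNReal.ofReal |θ|) * min (m (B ∩ G)) (m (B \ G)) := by gcongr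
    _ ≤ _ := by
      rw [add_mul]
      gcongr
      · exact min_le_left _ _
      · exact min_le_right _ _

section LocalPI

variable {X : Type*} [MetricSpace X] [MeasurableSpace X] {m : Measure X} {N : ℕ} {lam P : ℝ}

theorem LocalPI.measure_ball_le_pow [ProperSpace X] [IsFiniteMeasureOnCompacts m]
    (h : LocalPI m N lam P) (x : X) {r R : ℝ} (hr : 0 < r)
    (hrR : r ≤ R) (hR : R ≤ 1) :
    m.real (ball x R) ≤ (2 * R / r) ^ N * m.real (ball x r) := by
  obtain ⟨n, hn⟩ : ∃ n : ℕ, R ≤ 2 ^ n * r := by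
    obtain ⟨n, hn⟩ := pow_unbounded_of_one_lt (R / r) (one_lt_two (α := ℝ))
    exact ⟨n, ((div_lt_iff₀ hr).1 hn).le⟩
  induction n generalizing r with
  | zero =>
    obtain rfl : r = R := le_antisymm hrR (by simpa using hn)
    refine le_mul_of_one_le_left (h.ball_pos x r hr).le (one_le_pow₀ ?_)
    rw [mul_div_assoc, div_self hr.ne']
    norm_num
  | succ n ih =>
    rcases eq_or_lt_of_le hrR with rfl | hlt
    · refine le_mul_of_one_le_left (h.ball_pos x r hr).le (one_le_pow₀ ?_)
      rw [mul_div_assoc, div_self hr.ne']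
      norm_num
    have hd := h.doubling x r hr (hlt.trans_le hR)
    have h0 := (h.ball_pos x r hr).le
    rcases le_or_gt R (2 * r) with h2 | h2
    · refine (measureReal_mono (ball_subset_ball h2) (measure_ball_ne_top x _)).trans (hd.trans ?_)
      refine mul_le_mul_of_nonneg_right (pow_le_pow_left₀ zero_le_two ?_ N) h0
      rw [le_div_iff₀ hr]
      linarith
    · refine (ih (r := 2 * r) (by positivity) h2.le ?_).trans ?_
      · rw [pow_succ] at hn
        linarith
      · refine (mul_le_mul_of_nonneg_left hd (by have := hr.trans hlt; positivity)).trans ?_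
        rw [← mul_assoc, ← mul_pow]
        refine le_of_eq ?_
        congr 2
        field_simp

theorem LocalPI.measure_closedBall (h : LocalPI m N lam P) (x : X) {r : ℝ} (hr : 0 < r) :
    m (closedBall x r) = m (ball x r) := by
  refine le_antisymm ?_ (measure_mono ball_subset_closedBall)
  rw [← ball_union_sphere]
  refine (measure_union_le _ _).trans ?_
  rw [h.sphere_null x r hr, add_zero]

theorem LocalPI.measure_inter_closedBall (h : LocalPI m N lam P) (E : Set X) (x : X) {r : ℝ}
    (hr : 0 < r) : m (E ∩ closedBall x r) = m (E ∩ ball x r) := by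
  refine le_antisymm ?_ (measure_mono (inter_subset_inter_right _ ball_subset_closedBall))
  rw [← ball_union_sphere, inter_union_distrib_left]
  refine (measure_union_le _ _).trans ?_
  rw [measure_mono_null inter_subset_right (h.sphere_null x r hr), add_zero]

variable [ProperSpace X] [IsFiniteMeasureOnCompacts m] {E : Set X}

theorem LocalPI.isUnifLocDoublingMeasure (h : LocalPI m N lam P) :
    IsUnifLocDoublingMeasure m := by
  refine ⟨⟨2 ^ N, ?_⟩⟩
  filter_upwards [Ioo_mem_nhdsGT (show (0 : ℝ) < 1 by norm_num)] with s hs y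
  rw [h.measure_closedBall y hs.1, h.measure_closedBall y (mul_pos two_pos hs.1)]
  have := ENNReal.ofReal_le_ofReal (h.doubling y s hs.1 hs.2)
  rw [ENNReal.ofReal_mul (by positivity), Measure.real, Measure.real,
    ENNReal.ofReal_toReal (measure_ball_ne_top _ _),
    ENNReal.ofReal_toReal (measure_ball_ne_top _ _)] at this
  refine this.trans (le_of_eq ?_)
  congr 1
  rw [ENNReal.ofReal_pow zero_le_two]
  simp

variable [BorelSpace X]

theorem LocalPI.ae_tendsto_density (h : LocalPI m N lam P) (E : Set X) :
    ∀ᵐ x ∂m.restrict E,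
      Tendsto (fun r => m (E ∩ ball x r) / m (ball x r)) (𝓝[>] 0) (𝓝 1) := by
  have := h.isUnifLocDoublingMeasure
  filter_upwards [IsUnifLocDoublingMeasure.ae_tendsto_measure_inter_div m E 1] with x hx
  have := hx (l := 𝓝[>] (0 : ℝ)) (fun _ => x) (fun s => s) tendsto_id
    (by filter_upwards [self_mem_nhdsWithin] with s hs
        exact mem_closedBall_self (by rw [one_mul]; exact le_of_lt hs))
  refine this.congr' ?_
  filter_upwards [self_mem_nhdsWithin] with s hs
  rw [h.measure_inter_closedBall E x hs, h.measure_closedBall x hs]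

theorem LocalPI.continuousAt_vol (h : LocalPI m N lam P) (hE : MeasurableSet E) (y : X) {s : ℝ}
    (hs : 0 < s) : ContinuousAt (fun p : X × ℝ => vol m E p.1 p.2) (y, s) := by
  have hmeas : ∀ p : X × ℝ, MeasurableSet (E ∩ closedBall p.1 p.2) := fun p =>
    hE.inter isClosed_closedBall.measurableSet
  have hsub : ∀ᶠ p in 𝓝 (y, s), E ∩ closedBall p.1 p.2 ⊆ closedBall y (s + 2) := by
    have h1 : ∀ᶠ p : X × ℝ in 𝓝 (y, s), dist p.1 y < 1 :=
      (continuous_fst.dist continuous_const).continuousAt.eventually_lt continuousAt_const (by simp)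
    have h2 : ∀ᶠ p : X × ℝ in 𝓝 (y, s), p.2 < s + 1 :=
      continuous_snd.continuousAt.eventually_lt continuousAt_const (by simp)
    filter_upwards [h1, h2] with p hp1 hp2
    exact inter_subset_right.trans (closedBall_subset_closedBall' (by linarith))
  have hlim := tendsto_measure_of_ae_tendsto_indicator (μ := m) (𝓝 (y, s))
    (A := E ∩ closedBall y s) (As := fun p : X × ℝ => E ∩ closedBall p.1 p.2)
    (hmeas (y, s)) hmeas isClosed_closedBall.measurableSet
    (isCompact_closedBall y (s + 2)).measure_lt_top.ne hsub (by
      have hae : ∀ᵐ z ∂m, z ∉ sphere y s := measure_eq_zero_iff_ae_notMem.1 (h.sphere_null y s hs)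
      filter_upwards [hae] with z hz
      have hc : ContinuousAt (fun p : X × ℝ => dist z p.1 - p.2) (y, s) := by fun_prop
      rcases lt_or_gt_of_ne (show dist z y ≠ s from hz) with h1 | h1
      · filter_upwards [hc.eventually_lt continuousAt_const (show dist z y - s < 0 by linarith)]
          with p hp
        have e1 : dist z p.1 ≤ p.2 := by linarith
        simp only [mem_inter_iff, mem_closedBall, e1, h1.le]
      · filter_upwards [continuousAt_const.eventually_lt hc (show 0 < dist z y - s by linarith)]
          with p hp
        have e1 : ¬ dist z p.1 ≤ p.2 := by linarith
        simp only [mem_inter_iff, mem_closedBall, e1, h1.not_ge])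
  exact (ENNReal.tendsto_toReal (measure_inter_closedBall_ne_top E y s)).comp hlim

end LocalPI

/-- The relative isoperimetric inequality. -/
theorem LocalPI.relative_isoperimetric {X : Type*} [MetricSpace X] [MeasurableSpace X]
    [ProperSpace X] [BorelSpace X] {m : Measure X} {N : ℕ} {lam P : ℝ}
    (h : LocalPI m N lam P) {G : Set X} (hG : MeasurableSet G)
    (z : X) {r : ℝ} (hr : 0 < r) (hr1 : r < 1) :
    min (m (ball z r ∩ G)) (m (ball z r \ G)) ≤
      ENNReal.ofReal (P * r) * Per m G (ball z (2 * lam * r)) := by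
  have hPr : 0 < P * r := mul_pos h.P_pos hr
  have hl := h.one_le_lam
  have hlr : 0 < lam * r := by positivity
  have hrl : r ≤ lam * r := le_mul_of_one_le_left hr.le hl
  rw [← ENNReal.div_le_iff' (by simpa using hPr) ENNReal.ofReal_ne_top]
  refine le_of_forall_gt_imp_ge_of_dense fun c hc => ?_
  obtain ⟨f, hfL, hfT, hfc⟩ := exists_seq hc
  set φ : X → ℝ := fun p => 1 - ramp (5 / 4 * (lam * r)) (7 / 4 * (lam * r)) (dist p z) with hφ
  have hab : 5 / 4 * (lam * r) < 7 / 4 * (lam * r) := by linarith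
  have hφl : LipschitzWith (Real.toNNReal (1 / (7 / 4 * (lam * r) - 5 / 4 * (lam * r)))) φ := by
    refine LipschitzWith.of_dist_le_mul fun p q => ?_
    rw [hφ, dist_sub_left]
    exact (lipschitzWith_ramp_comp hab (LipschitzWith.dist_left z)).dist_le_mul p q
  have hFL : ∀ n, LocLipOn univ fun p => φ p * f n p := by
    intro n
    refine (locLipOn_iff isOpen_univ).2 fun y _ => ?_
    rcases lt_or_ge (dist y z) (2 * lam * r) with hy | hy
    · exact exists_lipschitzOn_mul ⟨univ, univ_mem, _, hφl.lipschitzOnWith⟩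
        ((locLipOn_iff isOpen_ball).1 (hfL n) y hy)
    · refine exists_lipschitzOn_congr (f := fun _ => (0 : ℝ)) ?_
        ⟨univ, univ_mem, 0, (LipschitzWith.const _).lipschitzOnWith⟩
      have : ∀ᶠ p in 𝓝 y, 7 / 4 * (lam * r) < dist p z :=
        continuousAt_const.eventually_lt (by fun_prop) (by linarith)
      filter_upwards [this] with p hp
      simp [hφ, ramp_of_ge hab hp.le]
  have hφ1 : ∀ p, dist p z ≤ 5 / 4 * (lam * r) → φ p = 1 := fun p hp => by
    simp [hφ, ramp_of_le hab hp]
  have hbound : ∀ n, min (m (ball z r ∩ G)) (m (ball z r \ G)) ≤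
      (∫⁻ y in closedBall z r, ENNReal.ofReal |f n y - charFn G y| ∂m) +
        ENNReal.ofReal (P * r) * c := by
    intro n
    obtain ⟨θ, hθ⟩ := h.poincare _ (hFL n) z r hr hr1
    have e1 : ∫⁻ y in ball z r, ENNReal.ofReal |charFn G y - θ| ∂m ≤
        (∫⁻ y in ball z r, ENNReal.ofReal |f n y - charFn G y| ∂m) +
          ∫⁻ y in ball z r, ENNReal.ofReal |φ y * f n y - θ| ∂m := by
      rw [← lintegral_add_left' ((aemeasurable_abs_sub_charFn hG isOpen_ball
        (LocLipOn.mono (hfL n) (ball_subset_ball (by linarith)))))]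
      refine setLIntegral_mono' measurableSet_ball fun y hy => ?_
      rw [hφ1 y ((mem_ball.1 hy).le.trans (by linarith)), one_mul,
        ← ENNReal.ofReal_add (abs_nonneg _) (abs_nonneg _)]
      refine ENNReal.ofReal_le_ofReal ?_
      rw [abs_sub_comm (f n y)]
      exact abs_sub_le _ _ _
    refine (min_measure_le_lintegral hG measurableSet_ball θ).trans (e1.trans (add_le_add ?_ (hθ.trans ?_)))
    · exact lintegral_mono_set ball_subset_closedBall
    · gcongr
      refine le_trans ?_ (hfc n)
      have e2 : ∫⁻ y in ball z (lam * r), mSlope (fun p => φ p * f n p) y ∂m =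
          ∫⁻ y in ball z (lam * r), mSlope (f n) y ∂m := by
        refine setLIntegral_congr_fun measurableSet_ball fun y hy => mSlope_congr ?_
        filter_upwards [isOpen_ball.mem_nhds hy] with p hp
        rw [hφ1 p ((mem_ball.1 hp).le.trans (by linarith)), one_mul]
      rw [e2]
      exact lintegral_mono_set (ball_subset_ball (by linarith))
  have hlim : Tendsto (fun n => (∫⁻ y in closedBall z r, ENNReal.ofReal |f n y - charFn G y| ∂m) +
      ENNReal.ofReal (P * r) * c) atTop (𝓝 (0 + ENNReal.ofReal (P * r) * c)) :=
    (hfT _ (closedBall_subset_ball (by linarith)) (isCompact_closedBall z r)).add_const _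
  have := ge_of_tendsto' hlim hbound
  rw [zero_add] at this
  rwa [ENNReal.div_le_iff' (by simpa using hPr) ENNReal.ofReal_ne_top]

end Density

section Isoperimetric

variable {X : Type*} [MetricSpace X] [MeasurableSpace X] {m : Measure X} {N : ℕ} {lam P : ℝ}
  [ProperSpace X] [IsFiniteMeasureOnCompacts m] [BorelSpace X] {G : Set X}

theorem LocalPI.exists_radius (h : LocalPI m N lam P) (hG : MeasurableSet G) {x z : X} {t w : ℝ}
    (ht : 0 < t) (ht1 : 2 * t < 1) (hw : 0 < w) (hsub : G ⊆ closedBall x t)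
    (hhalf : 2 * m.real G ≤ m.real (ball x t)) (hv : m.real G ≤ w ^ N * m.real (ball x t))
    (hzt : dist z x ≤ t)
    (hz : Tendsto (fun r => m (G ∩ ball z r) / m (ball z r)) (𝓝[>] 0) (𝓝 1)) :
    ∃ r, 0 < r ∧ r ≤ 2 * t ∧ r ≤ 16 * (t * w) ∧ m (ball z r) ≤
      ENNReal.ofReal (2 ^ (N + 1) * P * r) * Per m G (ball z (2 * lam * r)) := by
  have hGfin : m G ≠ ∞ := ((measure_mono hsub).trans_lt (isCompact_closedBall x t).measure_lt_top).ne
  have hxz : m.real (ball x t) ≤ m.real (ball z (2 * t)) :=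
    measureReal_mono (ball_subset_ball' (by rw [dist_comm]; linarith)) (measure_ball_ne_top _ _)
  have hex : ∃ k : ℕ, m.real (ball z (2 * t / 2 ^ k)) < 2 * m.real (G ∩ ball z (2 * t / 2 ^ k)) := by
    have hlim : Tendsto (fun k : ℕ => 2 * t / 2 ^ k) atTop (𝓝[>] 0) := by
      refine tendsto_nhdsWithin_iff.2 ⟨?_, Eventually.of_forall fun k => ?_⟩
      · exact Tendsto.const_div_atTop
          (tendsto_pow_atTop_atTop_of_one_lt (one_lt_two (α := ℝ))) (2 * t)
      · show 0 < 2 * t / 2 ^ k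
        positivity
    have hhalf1 : (2 : ℝ≥0∞)⁻¹ < 1 := ENNReal.inv_lt_one.2 (by norm_num)
    obtain ⟨k, hk⟩ := ((hz.comp hlim).eventually (lt_mem_nhds hhalf1)).exists
    refine ⟨k, ?_⟩
    have hp : 0 < 2 * t / 2 ^ k := by positivity
    have hb0 : m (ball z (2 * t / 2 ^ k)) ≠ 0 := fun h0 => by
      have := h.ball_pos z _ hp
      rw [Measure.real, h0] at this
      simp at this
    rw [Function.comp_apply, ENNReal.lt_div_iff_mul_lt (Or.inl hb0)
      (Or.inl (measure_ball_ne_top _ _))] at hk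
    have := ENNReal.toReal_strict_mono
      ((measure_mono inter_subset_left).trans_lt hGfin.lt_top).ne hk
    rw [ENNReal.toReal_mul, ENNReal.toReal_inv] at this
    simp only [ENNReal.toReal_ofNat] at this
    simp only [Measure.real]
    linarith
  classical
  obtain ⟨k, hk, hmin⟩ : ∃ k : ℕ,
      m.real (ball z (2 * t / 2 ^ k)) < 2 * m.real (G ∩ ball z (2 * t / 2 ^ k)) ∧
      ∀ j < k, 2 * m.real (G ∩ ball z (2 * t / 2 ^ j)) ≤ m.real (ball z (2 * t / 2 ^ j)) :=
    ⟨Nat.find hex, Nat.find_spec hex, fun j hj => not_lt.1 (Nat.find_min hex hj)⟩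
  have hk0 : k ≠ 0 := by
    rintro rfl
    rw [pow_zero, div_one] at hk
    have : m.real (G ∩ ball z (2 * t)) ≤ m.real G := measureReal_mono inter_subset_left hGfin
    linarith
  obtain ⟨j, rfl⟩ := Nat.exists_eq_succ_of_ne_zero hk0
  have hj := hmin j (Nat.lt_succ_self j)
  set r := 2 * t / 2 ^ j with hr
  have hr2 : 2 * t / 2 ^ (j + 1) = r / 2 := by rw [hr, pow_succ]; field_simp
  rw [Nat.succ_eq_add_one, hr2] at hk
  have hr0 : 0 < r := by positivity
  have hrt : r ≤ 2 * t := div_le_self (by positivity) (one_le_pow₀ one_le_two)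
  have hmG : m.real (G ∩ ball z (r / 2)) ≤ m.real G := measureReal_mono inter_subset_left hGfin
  refine ⟨r, hr0, hrt, ?_, ?_⟩
  · by_contra! hlt
    have h1 := h.measure_ball_le_pow z (r := r / 2) (R := 2 * t) (by positivity) (by linarith)
      ht1.le
    have h2 : m.real G ≤ (w * (2 * (2 * t) / (r / 2))) ^ N * m.real (ball z (r / 2)) := by
      rw [mul_pow, mul_assoc]
      exact hv.trans (mul_le_mul_of_nonneg_left (hxz.trans h1) (by positivity))
    have h3 : w * (2 * (2 * t) / (r / 2)) ≤ 1 / 2 := by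
      rw [show w * (2 * (2 * t) / (r / 2)) = 8 * (t * w) / r by field_simp; ring, div_le_iff₀ hr0]
      linarith
    have h4 : (w * (2 * (2 * t) / (r / 2))) ^ N ≤ 1 / 2 :=
      (pow_le_of_le_one (by positivity) (h3.trans (by norm_num))
        (Nat.one_le_iff_ne_zero.1 h.one_le_N)).trans h3
    have h5 := mul_le_mul_of_nonneg_right h4 (h.ball_pos z (r / 2) (by positivity)).le
    linarith
  · have hrel := h.relative_isoperimetric hG z hr0 (by linarith)
    have hle : m (ball z r ∩ G) ≤ m (ball z r \ G) := by
      have e := measureReal_inter_add_sdiff (μ := m) (s := ball z r) hG (measure_ball_ne_top _ _)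
      rw [inter_comm] at hj
      refine (ENNReal.toReal_le_toReal ?_ ?_).1 (show m.real _ ≤ m.real _ by linarith)
      · exact ((measure_mono inter_subset_left).trans_lt (measure_ball_ne_top z r).lt_top).ne
      · exact ((measure_mono sdiff_subset).trans_lt (measure_ball_ne_top z r).lt_top).ne
    rw [min_eq_left hle] at hrel
    have hfin : m (ball z r ∩ G) ≠ ∞ :=
      ((measure_mono inter_subset_left).trans_lt (measure_ball_ne_top z r).lt_top).ne
    have h1 : m.real (ball z r) ≤ 2 ^ (N + 1) * m.real (ball z r ∩ G) := by
      have hd := h.doubling z (r / 2) (by positivity) (by linarith)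
      rw [mul_div_cancel₀ _ two_ne_zero] at hd
      have h2 : m.real (G ∩ ball z (r / 2)) ≤ m.real (ball z r ∩ G) := by
        rw [inter_comm]
        exact measureReal_mono (inter_subset_inter_left _ (ball_subset_ball (by linarith))) hfin
      rw [pow_succ, mul_assoc]
      exact hd.trans (mul_le_mul_of_nonneg_left (by linarith) (by positivity))
    have h3 : m (ball z r) ≤ ENNReal.ofReal (2 ^ (N + 1)) * m (ball z r ∩ G) := by
      have := ENNReal.ofReal_le_ofReal h1
      rwa [ENNReal.ofReal_mul (by positivity), Measure.real, Measure.real, ENNReal.ofReal_toReal hfin,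
        ENNReal.ofReal_toReal (measure_ball_ne_top _ _)] at this
    refine h3.trans ?_
    rw [mul_assoc (2 ^ (N + 1)), ENNReal.ofReal_mul (by positivity), mul_assoc]
    gcongr

/-- The constant in the isoperimetric inequality for small sets. -/
def isoConst (N : ℕ) (lam P : ℝ) : ℝ := (32 * lam) ^ N * (2 ^ (N + 1) * P * 16)

theorem LocalPI.isoConst_pos {X : Type*} [MetricSpace X] [MeasurableSpace X] {m : Measure X}
    (h : LocalPI m N lam P) : 0 < isoConst N lam P := by
  have := h.one_le_lam
  have := h.P_pos
  unfold isoConst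
  positivity

/-- An isoperimetric inequality for sets of small density in a ball. -/
theorem LocalPI.isoperimetric (h : LocalPI m N lam P) (hG : MeasurableSet G) {x : X} {t w : ℝ}
    (ht : 0 < t) (ht1 : 32 * lam * t ≤ 1) (hw : 0 < w) (hsub : G ⊆ closedBall x t)
    (hhalf : 2 * m.real G ≤ m.real (ball x t)) (hv : m.real G ≤ w ^ N * m.real (ball x t))
    {Ω : Set X} (hΩ : ball x (5 * lam * t) ⊆ Ω) :
    m G ≤ ENNReal.ofReal (isoConst N lam P * (t * w)) * Per m G Ω := by
  have hl := h.one_le_lam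
  have hlt : t ≤ lam * t := le_mul_of_one_le_left ht.le hl
  set S : Set X := {z | z ∈ G ∧ Tendsto (fun r => m (G ∩ ball z r) / m (ball z r)) (𝓝[>] 0) (𝓝 1)}
    with hS
  have hmS : m G ≤ m S := by
    have : m (G \ S) = 0 := by
      have h1 := h.ae_tendsto_density G
      rw [ae_restrict_iff' hG] at h1
      refine measure_mono_null ?_ h1
      rintro z ⟨hz1, hz2⟩ hz3
      exact hz2 ⟨hz1, hz3 hz1⟩
    calc m G ≤ m (S ∪ (G \ S)) := measure_mono (by rw [union_sdiff_self]; exact subset_union_right)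
      _ ≤ m S + m (G \ S) := measure_union_le _ _
      _ = m S := by rw [this, add_zero]
  have hrad : ∀ z : X, ∃ r, z ∈ S → 0 < r ∧ r ≤ 2 * t ∧ r ≤ 16 * (t * w) ∧ m (ball z r) ≤
      ENNReal.ofReal (2 ^ (N + 1) * P * r) * Per m G (ball z (2 * lam * r)) := by
    intro z
    by_cases hz : z ∈ S
    · obtain ⟨r, hr⟩ := h.exists_radius hG ht (by linarith) hw hsub hhalf hv (hsub hz.1) hz.2
      exact ⟨r, fun _ => hr⟩
    · exact ⟨0, fun h => absurd h hz⟩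
  choose ρ hρ using hrad
  obtain ⟨u, huS, hud, hu⟩ := Vitali.exists_disjoint_subfamily_covering_enlargement_closedBall
    S (fun z => z) (fun z => 2 * lam * ρ z) (4 * lam * t)
    (fun z hz => by nlinarith [(hρ z hz).2.1]) 5 (by norm_num)
  have hpos : ∀ z ∈ S, 0 < 2 * lam * ρ z := fun z hz => by
    have := (hρ z hz).1
    positivity
  have hcount : u.Countable := by
    refine hud.countable_of_nonempty_interior fun z hz => ⟨z, ?_⟩
    exact ball_subset_interior_closedBall (mem_ball_self (hpos z (huS hz)))
  have hcover : S ⊆ ⋃ b ∈ u, closedBall b (5 * (2 * lam * ρ b)) := by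
    intro z hz
    obtain ⟨b, hb, hsub'⟩ := hu z hz
    exact mem_iUnion₂.2 ⟨b, hb, hsub' (mem_closedBall_self (hpos z hz).le)⟩
  have hPp := h.P_pos
  have hball : ∀ b : u, m (closedBall (b : X) (5 * (2 * lam * ρ b))) ≤
      ENNReal.ofReal (isoConst N lam P * (t * w)) * Per m G (ball b (2 * lam * ρ b)) := by
    rintro ⟨b, hb⟩
    obtain ⟨h1, h2, h3, h4⟩ := hρ b (huS hb)
    have h5 : lam * ρ b ≤ lam * (2 * t) := by gcongr
    have h6 : ρ b ≤ lam * ρ b := le_mul_of_one_le_left h1.le hl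
    have h7 := h.measure_ball_le_pow b (r := ρ b) (R := 16 * lam * ρ b) h1 (by linarith)
      (by linarith)
    rw [show 2 * (16 * lam * ρ b) / ρ b = 32 * lam by field_simp; ring] at h7
    have h8 : m (ball b (16 * lam * ρ b)) ≤ ENNReal.ofReal ((32 * lam) ^ N) * m (ball b (ρ b)) := by
      have := ENNReal.ofReal_le_ofReal h7
      rwa [ENNReal.ofReal_mul (by positivity), Measure.real, Measure.real,
        ENNReal.ofReal_toReal (measure_ball_ne_top _ _),
        ENNReal.ofReal_toReal (measure_ball_ne_top _ _)] at this
    refine (measure_mono (closedBall_subset_ball (by linarith))).trans (h8.trans ?_)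
    have h9 : isoConst N lam P * (t * w) = (32 * lam) ^ N * (2 ^ (N + 1) * P * (16 * (t * w))) := by
      unfold isoConst
      ring
    rw [h9, ENNReal.ofReal_mul (by positivity), mul_assoc]
    gcongr
    refine h4.trans ?_
    gcongr
  have : Countable u := hcount.to_subtype
  calc m G ≤ m S := hmS
    _ ≤ m (⋃ b ∈ u, closedBall b (5 * (2 * lam * ρ b))) := measure_mono hcover
    _ ≤ ∑' b : u, m (closedBall (b : X) (5 * (2 * lam * ρ b))) := measure_biUnion_le m hcount _
    _ ≤ ∑' b : u, ENNReal.ofReal (isoConst N lam P * (t * w)) *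
        Per m G (ball b (2 * lam * ρ b)) := ENNReal.tsum_le_tsum hball
    _ = ENNReal.ofReal (isoConst N lam P * (t * w)) *
        ∑' b : u, Per m G (ball b (2 * lam * ρ b)) := ENNReal.tsum_mul_left
    _ ≤ _ := by
      gcongr
      refine tsum_per_le (fun b => isOpen_ball) (fun b c hbc => ?_) fun b => ?_
      · exact (hud b.2 c.2 (fun e => hbc (Subtype.ext e))).mono ball_subset_closedBall
          ball_subset_closedBall
      · refine subset_trans (ball_subset_ball' ?_) hΩ
        have h1 : dist (b : X) x ≤ t := hsub (huS b.2).1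
        have h5 : lam * ρ b ≤ lam * (2 * t) := by
          gcongr
          exact (hρ b (huS b.2)).2.1
        linarith

end Isoperimetric

section Competitors

section Competitor

variable {X : Type*} [MetricSpace X] [MeasurableSpace X] [BorelSpace X] {m : Measure X}
  {E F : Set X}

theorem HasLocFinPer.compl (h : HasLocFinPer m E) : HasLocFinPer m Eᶜ := by
  intro x
  obtain ⟨r, hr, h⟩ := h x
  exact ⟨r, hr, by rwa [per_compl]⟩

theorem VolConstMin.compl [IsFiniteMeasureOnCompacts m] (h : VolConstMin m E) :
    VolConstMin m Eᶜ := by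
  refine ⟨h.1.compl, HasLocFinPer.compl h.2.1, fun F K hF hK h1 h2 => ?_⟩
  rw [per_compl, ← per_compl F]
  refine h.2.2 Fᶜ K hF.compl hK ?_ ?_
  · refine measure_mono_null ?_ h1
    rintro y ⟨hy, hyK⟩
    refine ⟨?_, hyK⟩
    simp only [mem_symmDiff, mem_compl_iff] at hy ⊢
    tauto
  · have e : ∀ G : Set X, MeasurableSet G → m (G ∩ K) = m K - m (Gᶜ ∩ K) := by
      intro G hG
      have hfin : m (Gᶜ ∩ K) ≠ ∞ := ((measure_mono inter_subset_right).trans_lt hK.measure_lt_top).ne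
      rw [← measure_inter_add_sdiff K hG, inter_comm K G, Set.sdiff_eq, inter_comm K Gᶜ,
        ENNReal.add_sub_cancel_right hfin]
    rw [e E h.1, h2, e Fᶜ hF.compl, compl_compl]

theorem exists_annulus_per_le {U : Set X} {y : X} {s s' : ℝ} (hss : s < s')
    (hU : closedBall y s' ⊆ U) (hfin : Per m E U ≠ ∞) {ε : ℝ≥0∞} (hε : ε ≠ 0) :
    ∃ α β, s < α ∧ α < β ∧ β < s' ∧ Per m E (ball y β \ closedBall y α) ≤ ε := by
  obtain ⟨u, hu, hus, -⟩ := exists_seq_strictMono_tendsto' hss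
  have hsum : ∑' k, Per m E (ball y (u (k + 1)) \ closedBall y (u k)) ≤ Per m E U := by
    refine tsum_per_le (fun k => isOpen_ball.sdiff isClosed_closedBall) ?_ fun k => ?_
    · have key : ∀ i j, i < j → Disjoint (ball y (u (i + 1)) \ closedBall y (u i))
          (ball y (u (j + 1)) \ closedBall y (u j)) := by
        intro i j hij
        rw [Set.disjoint_left]
        rintro p ⟨hp, -⟩ ⟨-, hp'⟩
        have h1 : u (i + 1) ≤ u j := hu.monotone hij
        exact hp' (mem_closedBall.2 ((mem_ball.1 hp).le.trans h1))
      intro i j hij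
      rcases lt_or_gt_of_ne hij with h | h
      · exact key i j h
      · exact (key j i h).symm
    · exact sdiff_subset.trans ((ball_subset_closedBall.trans
        (closedBall_subset_closedBall (hus (k + 1)).2.le)).trans hU)
  have hlim := ENNReal.tendsto_atTop_zero_of_tsum_ne_top
    ((hsum.trans_lt hfin.lt_top).ne)
  obtain ⟨k, hk⟩ := (hlim.eventually (ge_mem_nhds (pos_iff_ne_zero.2 hε))).exists
  exact ⟨u k, u (k + 1), (hus k).1, hu (Nat.lt_succ_self k), (hus (k + 1)).2, hk⟩

variable [ProperSpace X]

/-- The deformation property, uniformly on compact sets. -/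
theorem exists_uniform_deformation (hdef : DeformationProperty m) (hE : MeasurableSet E)
    (hfin : HasLocFinPer m E) {W : Set X} (hW : IsCompact W) :
    ∃ R₀ C₀ : ℝ, 0 < R₀ ∧ 0 ≤ C₀ ∧ ∀ y ∈ W, ∀ s, 0 < s → s < R₀ →
      ∃ U, IsOpen U ∧ closedBall y R₀ ⊆ U ∧ Per m E U ≠ ∞ ∧
        Per m (E ∪ ball y s) U ≤
          ENNReal.ofReal C₀ * m (ball y s \ E) / ENNReal.ofReal s + Per m E U := by
  choose R hR0 _ C hC0 hRC using fun x => hdef E hE hfin x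
  obtain ⟨T, -, hT⟩ := hW.elim_nhds_subcover (fun x => ball x (R x / 2))
    fun x _ => ball_mem_nhds x (half_pos (hR0 x))
  have h1 : ∀ᶠ r in 𝓝[>] (0 : ℝ), 0 < r ∧ ∀ i ∈ T, r < R i / 2 := by
    refine eventually_mem_nhdsWithin.and ((Finset.eventually_all T).2 fun i _ => ?_)
    exact nhdsWithin_le_nhds (gt_mem_nhds (half_pos (hR0 i)))
  have h2 : ∀ᶠ c in (atTop : Filter ℝ), 0 ≤ c ∧ ∀ i ∈ T, C i ≤ c :=
    (eventually_ge_atTop 0).and ((Finset.eventually_all T).2 fun i _ => eventually_ge_atTop _)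
  obtain ⟨R₀, hR₀, hR₀T⟩ := h1.exists
  obtain ⟨C₀, hC₀, hC₀T⟩ := h2.exists
  refine ⟨R₀, C₀, hR₀, hC₀, fun y hy s hs hsR => ?_⟩
  obtain ⟨i, hi, hyi⟩ := mem_iUnion₂.1 (hT hy)
  have hyi' : dist y i < R i / 2 := hyi
  have hRi := hR₀T i hi
  refine ⟨ball i (2 * R i), isOpen_ball, closedBall_subset_ball' (by linarith [hR0 i]), ?_, ?_⟩
  · obtain ⟨V, -, hV, hVfin⟩ := exists_isOpen_per_lt_top hE hfin (isCompact_closedBall i (2 * R i))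
    exact ((per_mono (ball_subset_closedBall.trans hV)).trans_lt hVfin).ne
  · refine ((hRC i y (by rw [mem_ball]; linarith [hR0 i]) s ⟨hs, by linarith [hR0 i]⟩).2).trans ?_
    gcongr
    exact hC₀T i hi

/-- Adding a ball far from the place where `E` has been modified costs at most what it costs for
`E`. -/
theorem per_union_ball_le (hE : MeasurableSet E) {U : Set X} (hUo : IsOpen U)
    {x y : X} {t s s' : ℝ} (hss : s < s') (hxy : t + s' ≤ dist x y)
    (hU : closedBall y s' ⊆ U) (hfin : Per m E U ≠ ∞) {κ : ℝ≥0∞}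
    (hκ : Per m (E ∪ ball y s) U ≤ κ + Per m E U) {Ω : Set X} (hΩ : IsOpen Ω)
    (hyΩ : closedBall y s' ⊆ Ω) {ε : ℝ≥0∞} (hε : ε ≠ 0) :
    Per m ((E \ closedBall x t) ∪ ball y s) Ω ≤ Per m (E \ closedBall x t) Ω + κ + ε := by
  obtain ⟨α, β, hsα, hαβ, hβ, hann⟩ := exists_annulus_per_le hss hU hfin hε
  obtain ⟨α', h1, h2⟩ := exists_between hαβ
  obtain ⟨β', h3, h4⟩ := exists_between h2
  have hsub : ∀ {p r}, dist p y ≤ r → r ≤ s' → p ∈ Ω := fun hp hr =>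
    hyΩ (mem_closedBall.2 (hp.trans hr))
  have hsubU : ∀ {p r}, dist p y ≤ r → r ≤ s' → p ∈ U := fun hp hr =>
    hU (mem_closedBall.2 (hp.trans hr))
  have hfar : ∀ p r, r ≤ s' → p ∈ ball y r → p ∉ closedBall x t := by
    intro p r hr hp hp'
    have e1 : dist p y < r := hp
    have e2 : dist p x ≤ t := hp'
    have e3 := dist_triangle_left x y p
    linarith
  set A := E \ closedBall x t with hA
  have hAm : MeasurableSet A := hE.diff isClosed_closedBall.measurableSet
  have hAE : ∀ r ≤ s', Per m A (ball y r) = Per m E (ball y r) := by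
    intro r hr
    refine per_congr_inter isOpen_ball ?_
    ext p
    constructor
    · exact fun hp => ⟨hp.1.1, hp.2⟩
    · exact fun hp => ⟨⟨hp.1, hfar p r hr hp.2⟩, hp.2⟩
  have s1 : Per m (A ∪ ball y s) Ω ≤
      Per m A (Ω \ closedBall y α') + Per m (E ∪ ball y s) (ball y β') := by
    refine (per_le_add_radial (hAm.union measurableSet_ball) hΩ h3
      fun p _ hp => hsub hp (by linarith)).trans (add_le_add (le_of_eq ?_) ?_)
    · refine per_congr_inter (hΩ.sdiff isClosed_closedBall) ?_
      ext p
      simp only [mem_inter_iff, mem_union, Set.mem_sdiff, mem_ball, mem_closedBall, not_le]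
      constructor
      · rintro ⟨h | h, h'⟩
        · exact ⟨h, h'⟩
        · linarith [h'.2]
      · rintro ⟨h, h'⟩
        exact ⟨Or.inl h, h'⟩
    · refine (per_mono inter_subset_right).trans (le_of_eq (per_congr_inter isOpen_ball ?_))
      ext p
      constructor
      · rintro ⟨hp | hp, hp'⟩
        · exact ⟨Or.inl hp.1, hp'⟩
        · exact ⟨Or.inr hp, hp'⟩
      · rintro ⟨hp | hp, hp'⟩
        · exact ⟨Or.inl ⟨hp, hfar p β' (by linarith) hp'⟩, hp'⟩
        · exact ⟨Or.inr hp, hp'⟩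
  have s2 : Per m (E ∪ ball y s) (ball y β') + Per m E (U \ closedBall y β') ≤
      κ + Per m E U := by
    refine le_trans ?_ hκ
    rw [← per_congr_inter (E := E ∪ ball y s) (F := E) (hUo.sdiff isClosed_closedBall)]
    · refine per_add_le_of_disjoint isOpen_ball (hUo.sdiff isClosed_closedBall) ?_ ?_ sdiff_subset
      · exact disjoint_sdiff_right.mono_left ball_subset_closedBall
      · exact fun p hp => hsubU (mem_ball.1 hp).le (by linarith)
    · ext p
      simp only [mem_inter_iff, mem_union, Set.mem_sdiff, mem_ball, mem_closedBall, not_le]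
      constructor
      · rintro ⟨h | h, h'⟩
        · exact ⟨h, h'⟩
        · linarith [h'.2]
      · rintro ⟨h, h'⟩
        exact ⟨Or.inl h, h'⟩
  have s3 : Per m E U ≤ Per m E (U \ closedBall y β') + Per m E (ball y β) :=
    (per_le_add_radial hE hUo h4 fun p _ hp => hsubU hp hβ.le).trans
      (add_le_add le_rfl (per_mono inter_subset_right))
  have s4 : Per m E (ball y β) ≤ ε + Per m A (ball y α') := by
    obtain ⟨α'', h5, h6⟩ := exists_between h1
    rw [hAE α' (by linarith)]
    refine (per_le_add_radial hE isOpen_ball h6 fun p _ hp => mem_ball.2 (by linarith)).trans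
      (add_le_add ((per_mono ?_).trans hann) (per_mono inter_subset_right))
    exact sdiff_subset_sdiff_right (closedBall_subset_closedBall h5.le)
  have s5 : Per m A (Ω \ closedBall y α') + Per m A (ball y α') ≤ Per m A Ω := by
    refine per_add_le_of_disjoint (hΩ.sdiff isClosed_closedBall) isOpen_ball ?_ sdiff_subset ?_
    · exact disjoint_sdiff_left.mono_right ball_subset_closedBall
    · exact fun p hp => hsub (mem_ball.1 hp).le (by linarith)
  have hfin' : Per m E (U \ closedBall y β') ≠ ∞ :=
    ((per_mono sdiff_subset).trans_lt hfin.lt_top).ne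
  have s6 : Per m (E ∪ ball y s) (ball y β') ≤ κ + Per m E (ball y β) := by
    rw [← ENNReal.add_le_add_iff_right hfin']
    refine s2.trans ((add_le_add le_rfl s3).trans (le_of_eq ?_))
    rw [add_comm (Per m E (U \ closedBall y β')), add_assoc]
  calc Per m (A ∪ ball y s) Ω
      ≤ Per m A (Ω \ closedBall y α') + (κ + (ε + Per m A (ball y α'))) :=
        s1.trans (add_le_add le_rfl (s6.trans (add_le_add le_rfl s4)))
    _ = Per m A (Ω \ closedBall y α') + Per m A (ball y α') + κ + ε := by ring
    _ ≤ _ := by gcongr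

variable [IsFiniteMeasureOnCompacts m]

/-- Comparison of a volume-constrained minimizer with the competitor obtained by removing a ball
and adding a set of the same volume. -/
theorem VolConstMin.per_inter_closedBall_le (hE : VolConstMin m E) {x : X} {t L : ℝ}
    (hs : m (sphere x t) = 0) (hL : ∃ᶠ z in 𝓝[>] t, slope (vol m E x) t z < L) {V : Set X}
    (hVm : MeasurableSet V) {M : ℝ} (hVM : V ⊆ closedBall x M)
    (hvol : m (V \ (E \ closedBall x t)) = m (E ∩ closedBall x t)) {κ : ℝ≥0∞}
    (hκ : ∀ Ω, IsOpen Ω → closedBall x M ⊆ Ω → ∀ ε : ℝ≥0∞, ε ≠ 0 →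
      Per m ((E \ closedBall x t) ∪ V) Ω ≤ Per m (E \ closedBall x t) Ω + κ + ε) (ρ : ℝ) :
    Per m (E ∩ closedBall x t) (ball x ρ) ≤ 2 * ENNReal.ofReal L + κ := by
  set M' := max (max M ρ) (t + 1) with hM'
  have hMM' : M ≤ M' := (le_max_left _ _).trans (le_max_left _ _)
  have hρM' : ρ ≤ M' := (le_max_right _ _).trans (le_max_left _ _)
  have htM' : t + 1 ≤ M' := le_max_right _ _
  set K := closedBall x M' with hK
  have hKc : IsCompact K := isCompact_closedBall x M'
  set A := E \ closedBall x t with hA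
  have hAm : MeasurableSet A := hE.1.diff isClosed_closedBall.measurableSet
  have htK : closedBall x t ⊆ K := closedBall_subset_closedBall (by linarith)
  have hVK : V ⊆ K := hVM.trans (closedBall_subset_closedBall hMM')
  have hmin : Per m E K ≤ Per m (A ∪ V) K := by
    refine hE.2.2 _ K (hAm.union hVm) hKc ?_ ?_
    · rw [show (E ∆ (A ∪ V)) \ K = ∅ from ?_, measure_empty]
      ext p
      simp only [Set.mem_sdiff, mem_symmDiff, mem_union, mem_empty_iff_false, iff_false, hA]
      have h1 := @htK p
      have h2 := @hVK p
      tauto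
    · have e1 : (A ∪ V) ∩ K = (A ∩ K) ∪ (V \ A) := by
        ext p
        have h2 := @hVK p
        simp only [Set.mem_sdiff, mem_inter_iff, mem_union]
        tauto
      have e2 : E ∩ K = (A ∩ K) ∪ (E ∩ closedBall x t) := by
        ext p
        have h1 := @htK p
        simp only [Set.mem_sdiff, mem_inter_iff, mem_union, hA]
        tauto
      rw [e1, e2, measure_union _ (hVm.diff hAm), hvol, measure_union _
        (hE.1.inter isClosed_closedBall.measurableSet)]
      · exact disjoint_left.2 fun p hp hp' => hp.1.2 hp'.2
      · exact disjoint_left.2 fun p hp hp' => hp'.2 hp.1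
  have hKfin : Per m E K ≠ ∞ := by
    obtain ⟨V, -, hV, hVfin⟩ := exists_isOpen_per_lt_top hE.1 hE.2.1 hKc
    exact ((per_mono hV).trans_lt hVfin).ne
  refine ENNReal.le_of_forall_pos_le_add fun ε hε _ => ?_
  have hε2 : ((ε : ℝ≥0∞) / 2) ≠ 0 := by
    simpa using hε.ne'
  obtain ⟨Ω, hΩ, hKΩ, hΩlt⟩ := exists_isOpen_per_lt (ENNReal.lt_add_right hKfin hε2)
  have hcut := per_slice_le hE.1 hΩ (x := x) (t := t) (t' := t + 1) (lt_add_one t)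
    ((closedBall_subset_closedBall htM').trans hKΩ) hs hL
  have hEΩ : Per m E Ω ≤ Per m A Ω + κ + ε / 2 + ε / 2 := by
    refine hΩlt.le.trans (add_le_add (hmin.trans ((per_mono hKΩ).trans ?_)) le_rfl)
    exact hκ Ω hΩ ((closedBall_subset_closedBall hMM').trans hKΩ) _ hε2
  have hAfin : Per m A Ω ≠ ∞ := by
    have h1 : Per m E Ω + 2 * ENNReal.ofReal L ≠ ∞ :=
      ENNReal.add_ne_top.2 ⟨hΩlt.ne_top, by finiteness⟩
    exact (lt_of_le_of_lt (le_self_add.trans hcut) h1.lt_top).ne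
  have hle : Per m (E ∩ closedBall x t) Ω ≤ 2 * ENNReal.ofReal L + κ + ε := by
    rw [← ENNReal.add_le_add_iff_left hAfin]
    refine hcut.trans ((add_le_add hEΩ le_rfl).trans (le_of_eq ?_))
    rw [add_assoc (_ + κ), ENNReal.add_halves]
    ring
  exact (per_mono ((ball_subset_closedBall.trans
    (closedBall_subset_closedBall hρM')).trans hKΩ)).trans hle

/-- The comparison estimate when the volume is restored by adding a ball. -/
theorem VolConstMin.per_inter_le_of_ball (hE : VolConstMin m E) {x y : X} {t s s' L : ℝ}
    (hs : m (sphere x t) = 0) (hL : ∃ᶠ z in 𝓝[>] t, slope (vol m E x) t z < L)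
    (hss : s < s') (hxy : t + s' ≤ dist x y) {U : Set X} (hUo : IsOpen U)
    (hU : closedBall y s' ⊆ U) (hfin : Per m E U ≠ ∞) {κ : ℝ≥0∞}
    (hκ : Per m (E ∪ ball y s) U ≤ κ + Per m E U)
    (hvol : m (ball y s \ E) = m (E ∩ closedBall x t)) (ρ : ℝ) :
    Per m (E ∩ closedBall x t) (ball x ρ) ≤ 2 * ENNReal.ofReal L + κ := by
  have hsub : closedBall y s' ⊆ closedBall x (dist x y + s') :=
    closedBall_subset_closedBall' (by rw [dist_comm x y, add_comm])
  refine VolConstMin.per_inter_closedBall_le hE hs hL measurableSet_ball (M := dist x y + s')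
    ((ball_subset_closedBall.trans (closedBall_subset_closedBall hss.le)).trans hsub) ?_
    (fun Ω hΩ hΩM ε hε => per_union_ball_le hE.1 hUo hss hxy hU hfin hκ hΩ (hsub.trans hΩM) hε) ρ
  rw [← hvol]
  congr 1
  ext p
  simp only [Set.mem_sdiff, mem_ball, mem_closedBall]
  refine and_congr_right fun hp => ?_
  have : ¬ dist p x ≤ t := fun h => by
    have := dist_triangle_left x y p
    linarith
  simp [this]

end Competitor

end Competitors

section DifferentialInequalities

section DifferentialInequality

/-- `c` is a lower bound of the lower right Dini derivative of `a` at `t`. -/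
def SlopeGE (a : ℝ → ℝ) (t c : ℝ) : Prop := ∀ L, (∃ᶠ z in 𝓝[>] t, slope a t z < L) → c ≤ L

theorem SlopeGE.of_le {a b : ℝ → ℝ} {t c : ℝ} (h : SlopeGE a t c) (hab : ∀ z, a z ≤ b z)
    (ht : a t = b t) : SlopeGE b t c := by
  refine fun L hL => h L ((hL.and_eventually self_mem_nhdsWithin).mono ?_)
  rintro z ⟨hz, hz' : t < z⟩
  refine lt_of_le_of_lt ?_ hz
  rw [slope_def_field, slope_def_field, ht]
  have : 0 < z - t := sub_pos.2 hz'
  gcongr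
  exact hab z

theorem slope_nonneg_of_monotone {a : ℝ → ℝ} (ha : Monotone a) {t z : ℝ} (h : t < z) :
    0 ≤ slope a t z := by
  rw [slope_def_field]
  exact div_nonneg (sub_nonneg.2 (ha h.le)) (sub_nonneg.2 h.le)

theorem le_of_slopeGE {a B B' : ℝ → ℝ} {α β : ℝ} (ha : Monotone a)
    (hac : ContinuousOn a (Icc α β)) (hαβ : α ≤ β) (h0 : B α ≤ a α)
    (hB : ∀ t ∈ Icc α β, HasDerivAt B (B' t) t)
    (bound : ∀ t ∈ Ico α β, a t = B t → ∃ c > B' t, SlopeGE a t c) : B β ≤ a β := by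
  classical
  choose! c hc1 hc2 using bound
  have key := image_le_of_liminf_slope_right_lt_deriv_boundary' (f := fun t => -a t)
    (f' := fun t => if a t = B t then -c t else 0) (a := α) (b := β) hac.neg
    (B := fun t => -B t) (B' := fun t => -B' t) ?_ (neg_le_neg h0)
    (fun t ht => (hB t ht).continuousAt.continuousWithinAt.neg)
    (fun t ht => (hB t (Ico_subset_Icc_self ht)).neg.hasDerivWithinAt) ?_
    (right_mem_Icc.2 hαβ)
  · exact neg_le_neg_iff.1 key
  · intro t ht r hr
    have hs : ∀ z, slope (fun t => -a t) t z = -slope a t z := fun z => by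
      rw [slope_def_field, slope_def_field]
      ring
    refine Eventually.frequently ?_
    by_cases he : a t = B t
    · rw [if_pos he] at hr
      obtain ⟨L, hL1, hL2⟩ := exists_between (neg_lt.1 hr)
      have : ¬ ∃ᶠ z in 𝓝[>] t, slope a t z < L := fun hf => absurd (hc2 t ht he L hf) (not_le.2 hL2)
      filter_upwards [not_frequently.1 this] with z hz
      rw [hs]
      linarith [not_lt.1 hz]
    · rw [if_neg he] at hr
      filter_upwards [self_mem_nhdsWithin] with z hz
      rw [hs]
      linarith [slope_nonneg_of_monotone ha hz]
  · intro t ht he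
    have he' : a t = B t := neg_inj.1 he
    simp only [if_pos he']
    exact neg_lt_neg (hc1 t ht he')

theorem pow_le_of_slopeGE {a : ℝ → ℝ} {α β M k c : ℝ} {N : ℕ} (hN : 1 ≤ N) (ha : Monotone a)
    (hac : ContinuousOn a (Icc α β)) (hαβ : α ≤ β) (h0 : 0 < a α) (hM : 0 < M) (hk : 0 < k)
    (hc : N * k < c)
    (bound : ∀ t ∈ Ico α β, ∀ w, 0 < w → a t = w ^ N * M →
      SlopeGE a t (c * (w ^ (N - 1) * M))) : M * (k * (β - α)) ^ N ≤ a β := by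
  refine le_of_slopeGE (B := fun t => M * (k * (t - α)) ^ N)
    (B' := fun t => M * (N * (k * (t - α)) ^ (N - 1) * k)) ha hac hαβ ?_ ?_ ?_
  · simp only [sub_self, mul_zero]
    rw [zero_pow (by omega), mul_zero]
    exact h0.le
  · intro t _
    have h1 : HasDerivAt (fun t => k * (t - α)) k t := by
      simpa using ((hasDerivAt_id t).sub_const α).const_mul k
    exact (h1.pow N).const_mul M
  · intro t ht he
    have hat : 0 < a t := h0.trans_le (ha ht.1)
    have hw : 0 < k * (t - α) := by
      refine mul_pos hk (lt_of_le_of_ne (sub_nonneg.2 ht.1) fun h => ?_)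
      rw [he, ← h, mul_zero, zero_pow (by omega), mul_zero] at hat
      exact lt_irrefl _ hat
    refine ⟨_, ?_, bound t ht _ hw (by rw [he, mul_comm])⟩
    have : 0 < (k * (t - α)) ^ (N - 1) * M := by positivity
    calc M * (N * (k * (t - α)) ^ (N - 1) * k) = N * k * ((k * (t - α)) ^ (N - 1) * M) := by ring
      _ < _ := mul_lt_mul_of_pos_right hc this

theorem mul_div_pow_le_of_slopeGE {a : ℝ → ℝ} {α β : ℝ} {K : ℕ} (ha : Monotone a)
    (hac : ContinuousOn a (Icc α β)) (hα : 0 < α) (hαβ : α ≤ β) (h0 : 0 < a α)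
    (bound : ∀ t ∈ Ico α β, SlopeGE a t ((K + 1) * (a t / t))) : a α * (β / α) ^ K ≤ a β := by
  refine le_of_slopeGE (B := fun t => a α * (t / α) ^ K)
    (B' := fun t => a α * (K * (t / α) ^ (K - 1) * (1 / α))) ha hac hαβ ?_ ?_ ?_
  · rw [div_self hα.ne', one_pow, mul_one]
  · intro t _
    exact (((hasDerivAt_id t).div_const α).pow K).const_mul (a α)
  · intro t ht he
    have hat : 0 < a t := h0.trans_le (ha ht.1)
    have ht0 : 0 < t := hα.trans_le ht.1
    refine ⟨_, ?_, bound t ht⟩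
    have h1 : a α * (K * (t / α) ^ (K - 1) * (1 / α)) = K * (a t / t) := by
      rw [he]
      rcases K with _ | K
      · simp
      · simp only [Nat.add_sub_cancel]
        rw [pow_succ]
        field_simp
    rw [h1]
    have : 0 < a t / t := by positivity
    linarith

theorem exists_frequently_slope_lt {a : ℝ → ℝ} {α β L : ℝ} (ha : Monotone a) (hαβ : α < β)
    (hac : ContinuousOn a (Icc α β)) (h : a β - a α < L * (β - α)) :
    ∃ t ∈ Ico α β, ∃ᶠ z in 𝓝[>] t, slope a t z < L := by
  by_contra! hcon
  have hpos : 0 < β - α := sub_pos.2 hαβ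
  obtain ⟨L', hL1, hL2⟩ := exists_between ((div_lt_iff₀ hpos).2 h)
  have key : a α + L' * (β - α) ≤ a β := by
    refine le_of_slopeGE (B := fun t => a α + L' * (t - α)) (B' := fun _ => L') ha hac hαβ.le
      (by simp) ?_ ?_
    · intro t _
      simpa using (((hasDerivAt_id t).sub_const α).const_mul L').const_add (a α)
    · refine fun t ht _ => ⟨L, hL2, fun M hM => le_of_not_gt fun hlt => ?_⟩
      exact (hM.and_eventually (hcon t ht)).exists.elim fun z hz => by linarith [hz.1, hz.2]
  rw [div_lt_iff₀ hpos] at hL1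
  linarith

end DifferentialInequality

section Core

variable {X : Type*} [MetricSpace X] [MeasurableSpace X] [ProperSpace X]
  {m : Measure X} [IsFiniteMeasureOnCompacts m] {N : ℕ} {lam P : ℝ} {E : Set X}

theorem LocalPI.ofReal_vol_compl (h : LocalPI m N lam P) (E : Set X) (y : X) {s : ℝ} (hs : 0 < s) :
    ENNReal.ofReal (vol m Eᶜ y s) = m (ball y s \ E) := by
  rw [ofReal_vol, h.measure_inter_closedBall _ _ hs, Set.sdiff_eq, inter_comm]

variable [BorelSpace X]

/-- The differential inequality for the volume of a volume-constrained minimizer. -/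
theorem LocalPI.vol_le_mul_slope (h : LocalPI m N lam P) (hE : VolConstMin m E) {x y : X}
    {t s s' w L C₀ : ℝ} (ht : 0 < t) (ht1 : 32 * lam * t ≤ 1) (hw : 0 < w)
    (hhalf : 2 * vol m E x t ≤ m.real (ball x t)) (hv : vol m E x t ≤ w ^ N * m.real (ball x t))
    (hs : 0 < s) (hss : s < s') (hxy : t + s' ≤ dist x y)
    (hU : ∃ U, IsOpen U ∧ closedBall y s' ⊆ U ∧ Per m E U ≠ ∞ ∧ Per m (E ∪ ball y s) U ≤
      ENNReal.ofReal C₀ * m (ball y s \ E) / ENNReal.ofReal s + Per m E U)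
    (hvol : vol m Eᶜ y s = vol m E x t) (hC₀ : 0 ≤ C₀)
    (hC : 2 * isoConst N lam P * w * C₀ * t ≤ s)
    (hL : ∃ᶠ z in 𝓝[>] t, slope (vol m E x) t z < L) :
    vol m E x t ≤ 4 * isoConst N lam P * (t * w) * L := by
  obtain ⟨U, hUo, hyU, hUfin, hUle⟩ := hU
  have hI := h.isoConst_pos
  have hL0 : 0 ≤ L := by
    obtain ⟨z, hz, hz'⟩ := (hL.and_eventually self_mem_nhdsWithin).exists
    exact (slope_nonneg_of_monotone (vol_mono E x) hz').trans hz.le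
  set a := vol m E x t with ha
  have ha0 : 0 ≤ a := ENNReal.toReal_nonneg
  have hm : m (ball y s \ E) = ENNReal.ofReal a := by rw [← h.ofReal_vol_compl E y hs, hvol]
  have hκ : ENNReal.ofReal C₀ * m (ball y s \ E) / ENNReal.ofReal s =
      ENNReal.ofReal (C₀ * a / s) := by
    rw [hm, ← ENNReal.ofReal_mul hC₀, ENNReal.ofReal_div_of_pos hs]
  rw [hκ] at hUle
  have h1 := VolConstMin.per_inter_le_of_ball hE (h.sphere_null x t ht) hL hss hxy hUo hyU hUfin hUle
    (by rw [hm, ofReal_vol]) (5 * lam * t)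
  have h2 := h.isoperimetric (hE.1.inter isClosed_closedBall.measurableSet) ht ht1 hw
    (inter_subset_right) hhalf hv (Ω := ball x (5 * lam * t)) subset_rfl
  have h3 : ENNReal.ofReal a ≤
      ENNReal.ofReal (isoConst N lam P * (t * w) * (2 * L + C₀ * a / s)) := by
    rw [ofReal_vol]
    refine h2.trans ?_
    have : ENNReal.ofReal (isoConst N lam P * (t * w) * (2 * L + C₀ * a / s)) =
        ENNReal.ofReal (isoConst N lam P * (t * w)) *
          (2 * ENNReal.ofReal L + ENNReal.ofReal (C₀ * a / s)) := by
      rw [ENNReal.ofReal_mul (p := isoConst N lam P * (t * w)) (by positivity),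
        ENNReal.ofReal_add (by positivity) (by positivity), ENNReal.ofReal_mul zero_le_two,
        ENNReal.ofReal_ofNat]
    rw [this]
    gcongr
  have h4 := (ENNReal.ofReal_le_ofReal_iff (by positivity)).1 h3
  have h5 : isoConst N lam P * (t * w) * (C₀ * a / s) ≤ a / 2 := by
    rw [mul_div_assoc', div_le_iff₀ hs]
    nlinarith
  linarith

end Core

end DifferentialInequalities

section NullBall

theorem SlopeGE.mono {a : ℝ → ℝ} {t c c' : ℝ} (h : SlopeGE a t c) (hc : c' ≤ c) :
    SlopeGE a t c' := fun L hL => hc.trans (h L hL)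

theorem le_of_slopeGE_isoperimetric {f : ℝ → ℝ} {α M I w₀ : ℝ} {N : ℕ} (hN : 1 ≤ N)
    (hf : Monotone f) (hα : 0 < α) (hfc : ContinuousOn f (Icc α (2 * α))) (h0 : 0 < f α)
    (hM : 0 < M) (hI : 0 < I) (hw₀ : 0 < w₀) (hfw : f (2 * α) ≤ w₀ ^ N * M)
    (bound : ∀ t, α ≤ t → t < 2 * α → ∀ w, 0 < w → w ≤ w₀ → f t = w ^ N * M →
      SlopeGE f t (f t / (4 * I * (t * w)))) :
    M * (1 / (16 * I * N)) ^ N ≤ f (2 * α) := by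
  have hN0 : (0 : ℝ) < N := by exact_mod_cast hN
  have key := pow_le_of_slopeGE (c := 1 / (8 * I * α)) (k := 1 / (16 * I * N * α)) hN hf hfc
    (by linarith) h0 hM (by positivity) ?_ ?_
  · convert key using 3
    field_simp
    ring
  · rw [mul_one_div, div_lt_div_iff₀ (by positivity) (by positivity)]
    have : 0 < N * (8 * I * α) := by positivity
    nlinarith
  · intro t ht w hw he
    have ht0 : 0 < t := hα.trans_le ht.1
    have hww : w ≤ w₀ := by
      refine le_of_pow_le_pow_left₀ (n := N) (by omega) hw₀.le (le_of_mul_le_mul_right ?_ hM)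
      exact he ▸ (hf ht.2.le).trans hfw
    refine (bound t ht.1 ht.2 w hw hww he).mono ?_
    rw [he]
    obtain ⟨n, rfl⟩ : ∃ n, N = n + 1 := ⟨N - 1, by omega⟩
    rw [Nat.add_sub_cancel, one_div_mul_eq_div, div_le_div_iff₀ (by positivity) (by positivity)]
    have : 0 < w ^ n * M * I * w := by positivity
    calc w ^ n * M * (4 * I * (t * w)) = 4 * t * (w ^ n * M * I * w) := by ring
      _ ≤ 8 * α * (w ^ n * M * I * w) :=
        mul_le_mul_of_nonneg_right (by linarith [ht.2]) this.le
      _ = _ := by ring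

/-- The uniform deformation inequality for `E` at the centre `y`. -/
def LocalDeform {X : Type*} [MetricSpace X] [MeasurableSpace X] (m : Measure X) (E : Set X)
    (R₀ C₀ : ℝ) (y : X) : Prop :=
  ∀ s, 0 < s → s < R₀ → ∃ U, IsOpen U ∧ closedBall y R₀ ⊆ U ∧ Per m E U ≠ ∞ ∧
    Per m (E ∪ ball y s) U ≤ ENNReal.ofReal C₀ * m (ball y s \ E) / ENNReal.ofReal s + Per m E U

theorem LocalDeform.mono {X : Type*} [MetricSpace X] [MeasurableSpace X] {m : Measure X}
    {E : Set X} {R₀ R₁ C₀ C₁ : ℝ} {y : X} (h : LocalDeform m E R₀ C₀ y) (hR : R₁ ≤ R₀)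
    (hC : C₀ ≤ C₁) : LocalDeform m E R₁ C₁ y := by
  intro s hs hs'
  obtain ⟨U, h1, h2, h3, h4⟩ := h s hs (hs'.trans_le hR)
  refine ⟨U, h1, (closedBall_subset_closedBall hR).trans h2, h3, h4.trans ?_⟩
  gcongr

section Core

variable {X : Type*} [MetricSpace X] [MeasurableSpace X] [ProperSpace X]
  {m : Measure X} [IsFiniteMeasureOnCompacts m] {N : ℕ} {lam P : ℝ} {E : Set X}

theorem eventually_vol_le (h : LocalPI m N lam P) {x : X} (hx : x ∈ essExt m E) {ε : ℝ}
    (hε : 0 < ε) : ∃ T > 0, ∀ t, 0 < t → t < T → vol m E x t ≤ ε * m.real (ball x t) := by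
  have := (ENNReal.tendsto_nhds_zero.1 (show Tendsto _ _ _ from hx)) (ENNReal.ofReal ε)
    (by simpa using hε)
  obtain ⟨T, hT, hT'⟩ := mem_nhdsGT_iff_exists_Ioo_subset.1 this
  refine ⟨T, hT, fun t ht htT => ?_⟩
  have h1 := hT' ⟨ht, htT⟩
  have hfin := measure_ball_ne_top (m := m) x t
  have h0 : m (ball x t) ≠ 0 := fun h0 => (h.ball_pos x t ht).ne' (by simp [Measure.real, h0])
  have h2 : m (E ∩ ball x t) ≤ ENNReal.ofReal ε * m (ball x t) :=
    (ENNReal.div_le_iff h0 hfin).1 h1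
  rw [vol, Measure.real, h.measure_inter_closedBall E x ht]
  refine (ENNReal.toReal_mono (ENNReal.mul_ne_top ofReal_ne_top hfin) h2).trans_eq ?_
  rw [ENNReal.toReal_mul, ENNReal.toReal_ofReal hε.le, Measure.real]

variable [BorelSpace X]

theorem LocalPI.slopeGE_vol (h : LocalPI m N lam P) (hE : VolConstMin m E) {x y : X}
    {t s R₀ w C₀ : ℝ} (hD : LocalDeform m E R₀ C₀ y) (hC₀ : 0 ≤ C₀) (ht : 0 < t)
    (ht1 : 32 * lam * t ≤ 1) (hw : 0 < w) (hwN : 2 * w ^ N ≤ 1)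
    (hv : vol m E x t ≤ w ^ N * m.real (ball x t)) (hs : 0 < s) {s' : ℝ} (hss : s < s')
    (hs' : s' ≤ R₀) (hxy : t + s' ≤ dist x y) (hvol : vol m Eᶜ y s = vol m E x t)
    (hC : 2 * isoConst N lam P * w * C₀ * t ≤ s) :
    SlopeGE (vol m E x) t (vol m E x t / (4 * isoConst N lam P * (t * w))) := by
  intro L hL
  have hI := h.isoConst_pos
  rw [div_le_iff₀ (by positivity), mul_comm L]
  obtain ⟨U, h1, h2, h3, h4⟩ := hD s hs (hss.trans_le hs')
  refine h.vol_le_mul_slope hE ht ht1 hw ?_ hv hs hss hxy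
    ⟨U, h1, (closedBall_subset_closedBall hs').trans h2, h3, h4⟩ hvol hC₀ hC hL
  have : 0 ≤ m.real (ball x t) := measureReal_nonneg
  nlinarith

theorem LocalPI.continuousOn_vol (h : LocalPI m N lam P) (hE : MeasurableSet E) (x : X) :
    ContinuousOn (vol m E x) (Ioi 0) := fun s hs =>
  ((h.continuousAt_vol hE x hs).comp (f := fun s => (x, s))
    (by fun_prop)).continuousWithinAt

theorem LocalPI.slopeGE_vol_of_le (h : LocalPI m N lam P) (hE : VolConstMin m E) {x y : X}
    {t t₁ R₀ w C₀ : ℝ} (hD : LocalDeform m E R₀ C₀ y) (hC₀ : 0 ≤ C₀) (ht : 0 < t)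
    (htt : t ≤ t₁) (ht₁ : t₁ < R₀) (hxy : t₁ + R₀ ≤ dist x y) (ht1 : 32 * lam * t ≤ 1)
    (hw : 0 < w) (hwN : 2 * w ^ N ≤ 1) (hwC : 2 * isoConst N lam P * w * C₀ ≤ 1)
    (hv : vol m E x t ≤ w ^ N * m.real (ball x t)) (hba : vol m Eᶜ y t ≤ vol m E x t)
    (hab : vol m E x t ≤ vol m Eᶜ y t₁) :
    SlopeGE (vol m E x) t (vol m E x t / (4 * isoConst N lam P * (t * w))) := by
  obtain ⟨s, hs, hs'⟩ := intermediate_value_Icc htt ((h.continuousOn_vol hE.1.compl y).mono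
    fun s hs => ht.trans_le hs.1) ⟨hba, hab⟩
  refine h.slopeGE_vol hE hD hC₀ ht ht1 hw hwN hv (ht.trans_le hs.1) (hs.2.trans_lt ht₁) le_rfl
    (by linarith) hs' ?_
  calc _ ≤ 1 * t := by gcongr
    _ ≤ s := by linarith [hs.1]

theorem LocalPI.not_forall_vol_pos (h : LocalPI m N lam P) (hE : VolConstMin m E) {x y : X}
    {R₀ C₀ : ℝ} (hR₀ : 0 < R₀) (hC₀ : 0 ≤ C₀) (hxy : 2 * R₀ ≤ dist x y)
    (hDy : LocalDeform m E R₀ C₀ y) (hDx : LocalDeform m Eᶜ R₀ C₀ x)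
    (hx : x ∈ essExt m E) (hy : y ∈ essExt m Eᶜ) (hax : ∀ r > 0, 0 < vol m E x r)
    (hby : ∀ r > 0, 0 < vol m Eᶜ y r) : False := by
  have hI := h.isoConst_pos
  have hlam := h.one_le_lam
  have hN := h.one_le_N
  set I := isoConst N lam P with hIdef
  set a := vol m E x with ha
  set b := vol m Eᶜ y with hb
  set f : ℝ → ℝ := fun t => max (a t) (b t) with hf
  have hfm : Monotone f := fun s t hst => max_le_max (vol_mono E x hst) (vol_mono Eᶜ y hst)
  have hfc : ContinuousOn f (Ioi 0) :=
    (h.continuousOn_vol hE.1 x).sup (h.continuousOn_vol hE.1.compl y)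
  have hfpos : ∀ r > 0, 0 < f r := fun r hr => (hax r hr).trans_le (le_max_left _ _)
  obtain ⟨w₀, hw₀, hw1, hw2, hw3⟩ : ∃ w₀ : ℝ, 0 < w₀ ∧ 4 * I * w₀ * (N + 2) ≤ 1 ∧ w₀ ≤ 1 / 2 ∧
      2 * I * w₀ * C₀ ≤ 1 := by
    refine ⟨min (1 / 2) (1 / (4 * I * (N + 2) + 2 * I * C₀)), by positivity, ?_, min_le_left _ _, ?_⟩
    all_goals
      have h1 := min_le_right (1 / 2 : ℝ) (1 / (4 * I * (N + 2) + 2 * I * C₀))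
      set w := min (1 / 2 : ℝ) (1 / (4 * I * (N + 2) + 2 * I * C₀)) with hw
      have hw0 : 0 < w := by rw [hw]; positivity
      rw [le_div_iff₀ (by positivity)] at h1
      have h2 : 0 ≤ w * (4 * I * (N + 2)) := by positivity
      have h3 : 0 ≤ w * (2 * I * C₀) := by positivity
      linarith
  have hwpow : ∀ w, 0 < w → w ≤ w₀ → 2 * w ^ N ≤ 1 := fun w hw hww => by
    have := pow_le_of_le_one hw.le (by linarith) (show N ≠ 0 by omega)
    linarith
  obtain ⟨ε, hε, hε1, hε2, hε3⟩ : ∃ ε > 0, ε ≤ w₀ ^ N ∧ ε * m.real (ball x 1) ≤ b (R₀ / 2) ∧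
      ε * m.real (ball y 1) ≤ a (R₀ / 2) := by
    have h1 := h.ball_pos x 1 one_pos
    have h2 := h.ball_pos y 1 one_pos
    have h3 := hby (R₀ / 2) (by positivity)
    have h4 := hax (R₀ / 2) (by positivity)
    refine ⟨min (w₀ ^ N) (min (b (R₀ / 2) / m.real (ball x 1)) (a (R₀ / 2) / m.real (ball y 1))),
      lt_min (by positivity) (lt_min (div_pos h3 h1) (div_pos h4 h2)), min_le_left _ _, ?_, ?_⟩
    · rw [← le_div_iff₀ h1]
      exact (min_le_right _ _).trans (min_le_left _ _)
    · rw [← le_div_iff₀ h2]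
      exact (min_le_right _ _).trans (min_le_right _ _)
  obtain ⟨Tx, hTx, hTx'⟩ := eventually_vol_le h hx hε
  obtain ⟨Ty, hTy, hTy'⟩ := eventually_vol_le h hy hε
  obtain ⟨t₂, ht₂, ht₂x, ht₂y, ht₂R, ht₂l, ht₂1⟩ : ∃ t₂ : ℝ, 0 < t₂ ∧ t₂ < Tx ∧ t₂ < Ty ∧
      t₂ ≤ R₀ / 2 ∧ 32 * lam * t₂ ≤ 1 ∧ t₂ ≤ 1 := by
    have hm : 0 < min (min (Tx / 2) (Ty / 2)) (min (R₀ / 2) (1 / (32 * lam))) := by positivity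
    have h1 := min_le_left (min (Tx / 2) (Ty / 2)) (min (R₀ / 2) (1 / (32 * lam)))
    have h2 := min_le_right (min (Tx / 2) (Ty / 2)) (min (R₀ / 2) (1 / (32 * lam)))
    have h3 := h1.trans (min_le_left _ _)
    have h4 := h1.trans (min_le_right _ _)
    have h5 := h2.trans (min_le_left _ _)
    have h6 := h2.trans (min_le_right _ _)
    refine ⟨_, hm, by linarith, by linarith, h5, ?_, ?_⟩
    · rw [le_div_iff₀ (by positivity)] at h6
      linarith
    · refine h6.trans ?_
      rw [div_le_one (by positivity)]
      linarith
  have hball : ∀ z t, t ≤ t₂ → m.real (ball z t) ≤ m.real (ball z 1) := fun z t ht =>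
    measureReal_mono (ball_subset_ball (ht.trans ht₂1)) (measure_ball_ne_top z 1)
  have hslope : ∀ t, 0 < t → t ≤ t₂ → ∀ w, 0 < w → w ≤ w₀ → a t ≤ w ^ N * m.real (ball x t) →
      b t ≤ w ^ N * m.real (ball y t) → SlopeGE f t (f t / (4 * I * (t * w))) := by
    intro t ht htt w hw hww h1 h2
    have hl : 32 * lam * t ≤ 1 := le_trans (by gcongr) ht₂l
    have hwC : 2 * I * w * C₀ ≤ 1 := le_trans (by gcongr) hw3
    rcases le_total (b t) (a t) with hab | hab
    · have hft : f t = a t := max_eq_left hab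
      rw [hft]
      refine (h.slopeGE_vol_of_le hE hDy hC₀ ht (htt.trans ht₂R) (by linarith) (by linarith) hl hw
        (hwpow w hw hww) hwC h1 hab ?_).of_le (fun z => le_max_left _ _) hft.symm
      refine (hTx' t ht (htt.trans_lt ht₂x)).trans (le_trans ?_ hε2)
      exact mul_le_mul_of_nonneg_left (hball x t htt) hε.le
    · have hft : f t = b t := max_eq_right hab
      rw [hft]
      refine (h.slopeGE_vol_of_le (VolConstMin.compl hE) hDx hC₀ ht (htt.trans ht₂R) (by linarith)
        (by rw [dist_comm]; linarith) hl hw (hwpow w hw hww) hwC h2 (by rwa [compl_compl])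
        ?_).of_le (fun z => le_max_right _ _) hft.symm
      rw [compl_compl]
      refine (hTy' t ht (htt.trans_lt ht₂y)).trans (le_trans ?_ hε3)
      exact mul_le_mul_of_nonneg_left (hball y t htt) hε.le
  have hupper : ∀ σ, 0 < σ → σ ≤ t₂ → f σ * (t₂ / σ) ^ (N + 1) ≤ f t₂ := by
    intro σ hσ hσt
    refine mul_div_pow_le_of_slopeGE hfm (hfc.mono fun s hs => hσ.trans_le hs.1) hσ hσt (hfpos σ hσ)
      fun t ht => ?_
    have ht0 : 0 < t := hσ.trans_le ht.1
    refine (hslope t ht0 ht.2.le w₀ hw₀ le_rfl ?_ ?_).mono ?_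
    · refine (hTx' t ht0 (ht.2.trans ht₂x)).trans ?_
      gcongr
    · refine (hTy' t ht0 (ht.2.trans ht₂y)).trans ?_
      gcongr
    · have hft := hfpos t ht0
      push_cast
      rw [mul_div_assoc', div_le_div_iff₀ ht0 (by positivity)]
      calc _ = f t * t * (4 * I * w₀ * (N + 2)) := by ring
        _ ≤ f t * t * 1 := by gcongr
        _ = _ := by ring
  set c := min (m.real (ball x 1)) (m.real (ball y 1)) / 2 ^ N with hc
  have hc0 : 0 < c := div_pos (lt_min (h.ball_pos x 1 one_pos) (h.ball_pos y 1 one_pos))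
    (by positivity)
  have hlow : ∀ z, min (m.real (ball x 1)) (m.real (ball y 1)) ≤ m.real (ball z 1) → ∀ t, 0 < t →
      t ≤ t₂ → c * t ^ N ≤ m.real (ball z t) := by
    intro z hz t ht htt
    have := h.measure_ball_le_pow z ht (htt.trans ht₂1) le_rfl
    calc c * t ^ N ≤ m.real (ball z 1) / 2 ^ N * t ^ N := by rw [hc]; gcongr
      _ ≤ (2 * 1 / t) ^ N * m.real (ball z t) / 2 ^ N * t ^ N := by gcongr
      _ = _ := by
        rw [mul_one, div_pow]
        field_simp
  set κ := (1 / (16 * I * N)) ^ N with hκ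
  have hN0 : (0 : ℝ) < N := by exact_mod_cast hN
  have hκ0 : 0 < κ := by positivity
  set A := f t₂ / t₂ ^ (N + 1) * 2 ^ (N + 1) with hA
  have hA0 : 0 < A := mul_pos (div_pos (hfpos t₂ ht₂) (by positivity)) (by positivity)
  obtain ⟨σ, hσ, hσ1, hσ2, hσ3⟩ : ∃ σ : ℝ, 0 < σ ∧ 2 * σ ≤ t₂ ∧ A * σ < c * κ ∧
      A * σ ≤ w₀ ^ N * c := by
    refine ⟨min (t₂ / 2) (min (c * κ / (2 * A)) (w₀ ^ N * c / A)), by positivity, ?_, ?_, ?_⟩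
    · linarith [min_le_left (t₂ / 2) (min (c * κ / (2 * A)) (w₀ ^ N * c / A))]
    · refine lt_of_le_of_lt (mul_le_mul_of_nonneg_left ((min_le_right _ _).trans (min_le_left _ _))
        hA0.le) ?_
      have : 0 < c * κ := by positivity
      rw [mul_div_assoc', div_lt_iff₀ (by positivity)]
      nlinarith [mul_pos hA0 this]
    · refine (mul_le_mul_of_nonneg_left ((min_le_right _ _).trans (min_le_right _ _))
        hA0.le).trans_eq ?_
      field_simp
  have hf2 : f (2 * σ) ≤ A * σ * σ ^ N := by
    have := hupper (2 * σ) (by positivity) hσ1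
    rw [div_pow, mul_div_assoc', div_le_iff₀ (by positivity)] at this
    rw [hA, mul_pow] at *
    rw [div_mul_eq_mul_div, div_mul_eq_mul_div, div_mul_eq_mul_div, le_div_iff₀ (by positivity)]
    refine this.trans_eq (by ring)
  have hfin := le_of_slopeGE_isoperimetric (f := f) (M := c * σ ^ N) (I := I) (w₀ := w₀) hN hfm hσ
    (hfc.mono fun s hs => hσ.trans_le hs.1) (hfpos σ hσ) (by positivity) hI hw₀ ?_ ?_
  · have : A * σ * σ ^ N < c * κ * σ ^ N := by gcongr
    linarith [hfin.trans hf2, show c * σ ^ N * κ = c * κ * σ ^ N by ring]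
  · refine hf2.trans ?_
    rw [← mul_assoc]
    gcongr
  · intro t hσt ht2 w hw hww hft
    have ht0 : 0 < t := hσ.trans_le hσt
    have htt : t ≤ t₂ := ht2.le.trans hσ1
    refine hslope t ht0 htt w hw hww ((le_max_left _ _).trans (hft.le.trans ?_))
      ((le_max_right _ _).trans (hft.le.trans ?_))
    · refine mul_le_mul_of_nonneg_left (le_trans ?_ (hlow x (min_le_left _ _) t ht0 htt))
        (by positivity)
      gcongr
    · refine mul_le_mul_of_nonneg_left (le_trans ?_ (hlow y (min_le_right _ _) t ht0 htt))
        (by positivity)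
      gcongr

end Core

end NullBall

section SmallVolume

theorem exists_path_enter {X : Type*} [MetricSpace X] (hlen : IsLengthSpace X) {q x : X} {ρ : ℝ} (hρ : 0 ≤ ρ)
    (hqx : ρ ≤ dist q x) : ∃ (γ : ℝ → X) (u : ℝ), 0 ≤ u ∧ ContinuousOn γ (Icc 0 u) ∧ γ 0 = q ∧
      dist (γ u) x = ρ ∧ ∀ v ∈ Icc 0 u, ρ ≤ dist (γ v) x ∧ dist (γ v) q ≤ dist q x + 1 := by
  obtain ⟨γ, hc, h0, h1, h⟩ := exists_path hlen q x one_pos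
  have hdc : ContinuousOn (fun v => dist (γ v) x) (Icc 0 1) :=
    (continuous_id.dist continuous_const).comp_continuousOn hc
  have hcomp : IsCompact (Icc (0 : ℝ) 1 ∩ (fun v => dist (γ v) x) ⁻¹' Iic ρ) :=
    isCompact_Icc.of_isClosed_subset (hdc.preimage_isClosed_of_isClosed isClosed_Icc isClosed_Iic)
      inter_subset_left
  obtain ⟨u, ⟨hu, hu'⟩, hmin⟩ := hcomp.exists_isLeast ⟨1, right_mem_Icc.2 zero_le_one, by simpa [h1]⟩
  obtain ⟨v, hv, hv'⟩ : ρ ∈ (fun v => dist (γ v) x) '' Icc 0 u :=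
    intermediate_value_Icc' hu.1 (hdc.mono (Icc_subset_Icc_right hu.2)) ⟨hu', by simpa [h0]⟩
  have hvu : v = u := le_antisymm hv.2
    (hmin ⟨⟨hv.1, hv.2.trans hu.2⟩, hv'.le⟩)
  subst hvu
  refine ⟨γ, v, hu.1, hc.mono (Icc_subset_Icc_right hu.2), h0, hv', fun z hz => ⟨?_, ?_⟩⟩
  · by_contra! hlt
    have : v ≤ z := hmin ⟨⟨hz.1, hz.2.trans hu.2⟩, hlt.le⟩
    rw [le_antisymm hz.2 this, show dist (γ v) x = ρ from hv'] at hlt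
    exact lt_irrefl _ hlt
  · have := h z ⟨hz.1, hz.2.trans hu.2⟩
    rw [dist_comm]
    linarith [dist_nonneg (x := γ z) (y := x)]

variable {X : Type*} [MetricSpace X] [MeasurableSpace X] [ProperSpace X]
  {m : Measure X} [IsFiniteMeasureOnCompacts m] {N : ℕ} {lam P : ℝ} {E : Set X}

theorem LocalPI.vol_add_vol_compl (h : LocalPI m N lam P) (hE : MeasurableSet E) (x : X) {r : ℝ}
    (hr : 0 < r) : vol m E x r + vol m Eᶜ x r = m.real (ball x r) := by
  have hfin := measure_ball_ne_top (m := m) x r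
  rw [vol, vol, Measure.real, Measure.real, Measure.real, h.measure_inter_closedBall _ _ hr,
    h.measure_inter_closedBall _ _ hr, ← ENNReal.toReal_add, inter_comm, inter_comm Eᶜ,
    ← Set.sdiff_eq, measure_inter_add_sdiff _ hE]
  · exact measure_ne_top_of_subset inter_subset_right hfin
  · exact measure_ne_top_of_subset inter_subset_right hfin

variable [BorelSpace X]

theorem LocalPI.exists_vol_eq_zero (h : LocalPI m N lam P) (hdef : DeformationProperty m)
    (hE : VolConstMin m E) {x y : X} (hx : x ∈ essExt m E) (hy : y ∈ essExt m Eᶜ) :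
    (∃ r > 0, vol m E x r = 0) ∨ ∃ r > 0, vol m Eᶜ y r = 0 := by
  have hxy : x ≠ y := by
    rintro rfl
    obtain ⟨T, hT, hT'⟩ := eventually_vol_le h hx (ε := 1 / 4) (by norm_num)
    obtain ⟨S, hS, hS'⟩ := eventually_vol_le h hy (ε := 1 / 4) (by norm_num)
    have hm : 0 < min T S / 2 := by positivity
    have h1 := hT' _ hm (by linarith [min_le_left T S])
    have h2 := hS' _ hm (by linarith [min_le_right T S])
    have h3 := h.vol_add_vol_compl hE.1 x hm
    linarith [h.ball_pos x _ hm]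
  by_contra! hcon
  have hW : IsCompact ({x, y} : Set X) := (toFinite _).isCompact
  obtain ⟨R₁, C₁, hR₁, hC₁, h₁⟩ := exists_uniform_deformation hdef hE.1 hE.2.1 hW
  obtain ⟨R₂, C₂, hR₂, hC₂, h₂⟩ := exists_uniform_deformation hdef hE.1.compl
    (HasLocFinPer.compl hE.2.1) hW
  have hd : 0 < dist x y := dist_pos.2 hxy
  refine h.not_forall_vol_pos hE (x := x) (y := y) (R₀ := min (min R₁ R₂) (dist x y / 2))
    (C₀ := max C₁ C₂) (by positivity) (hC₁.trans (le_max_left _ _)) ?_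
    (LocalDeform.mono (h₁ y (by simp)) ((min_le_left _ _).trans (min_le_left _ _)) (le_max_left _ _))
    (LocalDeform.mono (h₂ x (by simp)) ((min_le_left _ _).trans (min_le_right _ _))
      (le_max_right _ _)) hx hy
    (fun r hr => lt_of_le_of_ne ENNReal.toReal_nonneg (hcon.1 r hr).symm)
    (fun r hr => lt_of_le_of_ne ENNReal.toReal_nonneg (hcon.2 r hr).symm)
  linarith [min_le_right (min R₁ R₂) (dist x y / 2)]

theorem LocalPI.vol_eq_zero_of_le (h : LocalPI m N lam P) (hdef : DeformationProperty m)
    (hE : VolConstMin m E) {q : X} {s₀ : ℝ} (hs₀ : 0 < s₀) (hq : vol m Eᶜ q s₀ = 0) {B : Set X}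
    (hB : IsBounded B) : ∃ R > 0, ∃ ε > 0, ∀ x ∈ B, ∀ t, 0 < t → t < R →
      vol m E x t ≤ ε * m.real (ball x t) → vol m E x (t / 20) = 0 := by
  have hI := h.isoConst_pos
  have hlam := h.one_le_lam
  have hN := h.one_le_N
  have hN0 : (0 : ℝ) < N := by exact_mod_cast hN
  set I := isoConst N lam P with hIdef
  obtain ⟨D, hBD⟩ := hB.subset_closedBall q
  obtain ⟨R₀, C₀, hR₀, hC₀, hdeform⟩ := exists_uniform_deformation hdef hE.1 hE.2.1
    (isCompact_closedBall q (D + 1))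
  obtain ⟨w₀, hw₀, hw2, hw3⟩ : ∃ w₀ : ℝ, 0 < w₀ ∧ w₀ ≤ 1 / 2 ∧ 4 * I * w₀ * C₀ ≤ 1 := by
    refine ⟨min (1 / 2) (1 / (4 * I * (C₀ + 1))), by positivity, min_le_left _ _, ?_⟩
    have h1 := min_le_right (1 / 2 : ℝ) (1 / (4 * I * (C₀ + 1)))
    set w := min (1 / 2 : ℝ) (1 / (4 * I * (C₀ + 1))) with hw
    have hw0 : 0 < w := by rw [hw]; positivity
    rw [le_div_iff₀ (by positivity)] at h1
    have h2 : 0 < w * I := by positivity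
    nlinarith
  have hwpow : ∀ w, 0 < w → w ≤ w₀ → 2 * w ^ N ≤ 1 := fun w hw hww => by
    have := pow_le_of_le_one hw.le (by linarith) (show N ≠ 0 by omega)
    linarith
  set κ := (1 / (16 * I * N)) ^ N with hκ
  have hκ0 : 0 < κ := by positivity
  obtain ⟨ε, hε, hε1, hε2, hε3⟩ : ∃ ε : ℝ, 0 < ε ∧ 2 * (ε * 80 ^ N) ≤ 1 ∧ ε * 40 ^ N ≤ w₀ ^ N ∧
      ε * 40 ^ N < κ := by
    refine ⟨min (1 / (2 * 80 ^ N)) (min (w₀ ^ N / 40 ^ N) (κ / (2 * 40 ^ N))), by positivity,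
      ?_, ?_, ?_⟩
    · have := min_le_left (1 / (2 * 80 ^ N)) (min (w₀ ^ N / 40 ^ N) (κ / (2 * 40 ^ N)))
      rw [le_div_iff₀ (by positivity)] at this
      linarith
    · rw [← le_div_iff₀ (by positivity)]
      exact (min_le_right _ _).trans (min_le_left _ _)
    · rw [← lt_div_iff₀ (by positivity)]
      refine ((min_le_right _ _).trans (min_le_right _ _)).trans_lt ?_
      rw [div_lt_div_iff₀ (by positivity) (by positivity)]
      have : 0 < κ * 40 ^ N := by positivity
      linarith
  have hεlt : ε < 1 := by
    have : ε * 1 ≤ ε * 80 ^ N := by gcongr; exact one_le_pow₀ (by norm_num)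
    linarith
  refine ⟨min (min R₀ (s₀ / 2)) (1 / (32 * lam)), by positivity, ε, hε, fun x hx t ht htR hv => ?_⟩
  have htR₀ : t < R₀ := htR.trans_le ((min_le_left _ _).trans (min_le_left _ _))
  have hts₀ : t < s₀ / 2 := htR.trans_le ((min_le_left _ _).trans (min_le_right _ _))
  have htl : 32 * lam * t < 1 := by
    have := htR.trans_le (min_le_right _ _)
    rw [lt_div_iff₀ (by positivity)] at this
    linarith
  have ht32 : 32 * t < 1 := by nlinarith
  have hmx := h.ball_pos x t ht
  by_contra hne
  have hpos : 0 < vol m E x (t / 20) := lt_of_le_of_ne ENNReal.toReal_nonneg (Ne.symm hne)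
  have hdist : s₀ / 2 ≤ dist q x := by
    by_contra! hlt
    have h1 : m (Eᶜ ∩ ball x t) = 0 := by
      have h2 : m (Eᶜ ∩ closedBall q s₀) = 0 :=
        ((measureReal_eq_zero_iff (measure_inter_closedBall_ne_top _ _ _)).1 hq)
      refine measure_mono_null (inter_subset_inter_right _ fun z hz => ?_) h2
      rw [mem_closedBall]
      rw [mem_ball] at hz
      linarith [dist_triangle z x q, dist_comm q x]
    have h3 : vol m Eᶜ x t = 0 := by
      rw [vol, Measure.real, h.measure_inter_closedBall _ _ ht, h1, ENNReal.toReal_zero]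
    have h4 := h.vol_add_vol_compl hE.1 x ht
    nlinarith
  obtain ⟨γ, u, hu, hγc, hγ0, hγu, hγ⟩ := exists_path_enter h.isLength (q := q) (x := x)
    (ρ := t / 2) (by positivity) (by linarith)
  have hα : 0 < t / 20 := by positivity
  have hvolc : ContinuousOn (fun v => vol m Eᶜ (γ v) (t / 20)) (Icc 0 u) := fun v hv =>
    (h.continuousAt_vol hE.1.compl (γ v) hα).comp_continuousWithinAt (f := fun v => (γ v, t / 20))
      ((hγc v hv).prodMk continuousWithinAt_const)
  have hstart : vol m Eᶜ (γ 0) (t / 20) ≤ 0 := by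
    rw [hγ0, ← hq]
    exact vol_mono Eᶜ q (by linarith)
  have hend : vol m E x t ≤ vol m Eᶜ (γ u) (t / 20) := by
    have h1 := h.vol_add_vol_compl hE.1 (γ u) hα
    have h2 : vol m E (γ u) (t / 20) ≤ vol m E x t := by
      refine ENNReal.toReal_mono (measure_inter_closedBall_ne_top _ _ _) (measure_mono
        (inter_subset_inter_right _ (closedBall_subset_closedBall' ?_)))
      rw [hγu]
      linarith
    have h3 : m.real (ball x t) ≤ 80 ^ N * m.real (ball (γ u) (t / 20)) := by
      have := h.measure_ball_le_pow (γ u) (r := t / 20) (R := 2 * t) hα (by linarith) (by linarith)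
      rw [show 2 * (2 * t) / (t / 20) = 80 by field_simp; norm_num] at this
      refine le_trans (measureReal_mono (ball_subset_ball' ?_) (measure_ball_ne_top _ _)) this
      rw [dist_comm, hγu]
      linarith
    have h4 : ε * m.real (ball x t) ≤ ε * 80 ^ N * m.real (ball (γ u) (t / 20)) := by
      rw [mul_assoc]
      gcongr
    have h5 := h.ball_pos (γ u) _ hα
    nlinarith
  have hxt : m.real (ball x t) ≤ 40 ^ N * m.real (ball x (t / 20)) := by
    have := h.measure_ball_le_pow x (r := t / 20) (R := t) hα (by linarith) (by linarith)
    rwa [show 2 * t / (t / 20) = 40 by field_simp; norm_num] at this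
  have hM := h.ball_pos x _ hα
  have hup : vol m E x (2 * (t / 20)) ≤ ε * 40 ^ N * m.real (ball x (t / 20)) := by
    refine (vol_mono E x (by linarith)).trans (hv.trans ?_)
    rw [mul_assoc]
    gcongr
  have key := le_of_slopeGE_isoperimetric (f := vol m E x) (M := m.real (ball x (t / 20))) (I := I)
    (w₀ := w₀) hN (vol_mono E x) hα ((h.continuousOn_vol hE.1 x).mono fun s hs => hα.trans_le hs.1)
    hpos hM hI hw₀ (hup.trans (by gcongr)) ?_
  · have := mul_lt_mul_of_pos_right hε3 hM
    rw [mul_comm κ] at this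
    linarith [key.trans hup]
  · intro τ hτ1 hτ2 w hw hww he
    have hτ : 0 < τ := hα.trans_le hτ1
    obtain ⟨v, hv', hvv⟩ : vol m E x τ ∈ (fun v => vol m Eᶜ (γ v) (t / 20)) '' Icc 0 u :=
      intermediate_value_Icc hu hvolc
        ⟨hstart.trans ENNReal.toReal_nonneg, (vol_mono E x (by linarith)).trans hend⟩
    obtain ⟨hγ1, hγ2⟩ := hγ v hv'
    have hxq : dist q x ≤ D := by
      rw [dist_comm]
      exact mem_closedBall.1 (hBD hx)
    refine h.slopeGE_vol hE (hdeform (γ v) (mem_closedBall.2 (by linarith))) hC₀ hτ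
      (le_trans (by gcongr; linarith) htl.le) hw (hwpow w hw hww) ?_ hα (s' := t / 10) (by linarith)
      (by linarith) (by rw [dist_comm]; linarith) hvv ?_
    · rw [he]
      gcongr
      · exact measure_ball_ne_top _ _
    · calc 2 * I * w * C₀ * τ ≤ 2 * I * w₀ * C₀ * (2 * (t / 20)) := by gcongr
        _ = 4 * I * w₀ * C₀ * (t / 20) := by ring
        _ ≤ 1 * (t / 20) := by gcongr
        _ = _ := one_mul _

end SmallVolume

section DensityEstimates

theorem LocalPI.measure_ball_ne_zero {X : Type*} [MetricSpace X] [MeasurableSpace X] {m : Measure X}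
    {N : ℕ} {lam P : ℝ} (h : LocalPI m N lam P) (x : X) {r : ℝ} (hr : 0 < r) :
    m (ball x r) ≠ 0 := fun h0 => (h.ball_pos x r hr).ne' (by simp [Measure.real, h0])

variable {X : Type*} [MetricSpace X] [MeasurableSpace X] [ProperSpace X]
  {m : Measure X} [IsFiniteMeasureOnCompacts m] {N : ℕ} {lam P : ℝ} {E : Set X}

section EssentialBoundary

theorem mem_essExt_of_vol_eq_zero {x : X} {r : ℝ} (hr : 0 < r)
    (h0 : vol m E x r = 0) : x ∈ essExt m E := by
  refine (tendsto_const_nhds (x := (0 : ℝ≥0∞))).congr' ?_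
  filter_upwards [Ioo_mem_nhdsGT hr] with s hs
  have h1 : m (E ∩ closedBall x r) = 0 :=
    (measureReal_eq_zero_iff (measure_inter_closedBall_ne_top _ _ _)).1 h0
  rw [measure_mono_null (inter_subset_inter_right _ (ball_subset_closedBall.trans
    (closedBall_subset_closedBall hs.2.le))) h1, ENNReal.zero_div]

theorem vol_pos_of_mem_essBdry {x : X} (hx : x ∈ essBdry m E)
    {r : ℝ} (hr : 0 < r) : 0 < vol m E x r :=
  lt_of_le_of_ne ENNReal.toReal_nonneg fun h0 =>
    hx (Or.inr (mem_essExt_of_vol_eq_zero hr h0.symm))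

theorem LocalPI.density_compl (h : LocalPI m N lam P) (hE : MeasurableSet E) (x : X) {r : ℝ}
    (hr : 0 < r) :
    m (Eᶜ ∩ ball x r) / m (ball x r) = 1 - m (E ∩ ball x r) / m (ball x r) := by
  have hfin := measure_ball_ne_top (m := m) x r
  have h0 := h.measure_ball_ne_zero x hr
  refine ENNReal.eq_sub_of_add_eq (ENNReal.div_lt_top
    (measure_ne_top_of_subset inter_subset_right hfin) h0).ne ?_
  rw [← ENNReal.add_div, inter_comm, inter_comm E, ← Set.sdiff_eq, add_comm,
    measure_inter_add_sdiff _ hE, ENNReal.div_self h0 hfin]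

theorem LocalPI.essInt_subset (h : LocalPI m N lam P) (hE : MeasurableSet E) :
    essInt m E ⊆ essExt m Eᶜ := by
  intro x hx
  have := ENNReal.Tendsto.sub (tendsto_const_nhds (x := (1 : ℝ≥0∞)) (f := 𝓝[>] (0 : ℝ)))
    (show Tendsto _ _ _ from hx) (Or.inl one_ne_top)
  rw [tsub_self] at this
  exact this.congr' (eventually_nhdsWithin_of_forall fun r hr => (h.density_compl hE x hr).symm)

theorem LocalPI.essExt_compl_subset (h : LocalPI m N lam P) (hE : MeasurableSet E) :
    essExt m Eᶜ ⊆ essInt m E := by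
  intro x hx
  have := ENNReal.Tendsto.sub (tendsto_const_nhds (x := (1 : ℝ≥0∞)) (f := 𝓝[>] (0 : ℝ)))
    (show Tendsto _ _ _ from hx) (Or.inl one_ne_top)
  rw [tsub_zero] at this
  refine this.congr' (eventually_nhdsWithin_of_forall fun r hr => ?_)
  have := h.density_compl hE.compl x hr
  rw [compl_compl] at this
  exact this.symm

theorem LocalPI.essBdry_compl_subset (h : LocalPI m N lam P) (hE : MeasurableSet E) :
    essBdry m E ⊆ essBdry m Eᶜ := by
  refine compl_subset_compl.2 (union_subset ?_ ?_)
  · have h1 := h.essInt_subset hE.compl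
    rw [compl_compl] at h1
    exact h1.trans subset_union_right
  · exact (h.essExt_compl_subset hE).trans subset_union_left

variable [BorelSpace X]

theorem LocalPI.essInt_nonempty (h : LocalPI m N lam P) (hE : (essBdry m E).Nonempty) :
    (essInt m E).Nonempty := by
  obtain ⟨x, hx⟩ := hE
  have h0 : m.restrict E ≠ 0 := by
    rw [Ne, Measure.restrict_eq_zero]
    intro h0
    refine (vol_pos_of_mem_essBdry hx one_pos).ne' ?_
    rw [vol, Measure.real, measure_mono_null inter_subset_left h0, ENNReal.toReal_zero]
  have : (ae (m.restrict E)).NeBot := ae_neBot.2 h0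
  exact (h.ae_tendsto_density E).exists

theorem LocalPI.essExt_nonempty (h : LocalPI m N lam P) (hE : MeasurableSet E)
    (hne : (essBdry m E).Nonempty) : (essExt m E).Nonempty := by
  obtain ⟨x, hx⟩ := h.essInt_nonempty (hne.mono (h.essBdry_compl_subset hE))
  have := h.essInt_subset hE.compl hx
  rw [compl_compl] at this
  exact ⟨x, this⟩

end EssentialBoundary

section VolumeDensity

variable [BorelSpace X]

theorem LocalPI.exists_vol_eq_zero_of_compl (h : LocalPI m N lam P) (hdef : DeformationProperty m)
    (hE : VolConstMin m E) {x y : X} (hx : x ∈ essExt m E) {r : ℝ} (hr : 0 < r)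
    (hy : vol m Eᶜ y r = 0) : ∃ s > 0, vol m E x s = 0 := by
  obtain ⟨R, hR, ε, hε, h1⟩ := h.vol_eq_zero_of_le hdef hE hr hy (isBounded_singleton (x := x))
  obtain ⟨T, hT, hT'⟩ := eventually_vol_le h hx hε
  have hm : 0 < min R T / 2 := by positivity
  refine ⟨min R T / 2 / 20, by positivity, h1 x rfl _ hm ?_ (hT' _ hm ?_)⟩
  · linarith [min_le_left R T]
  · linarith [min_le_right R T]

theorem LocalPI.exists_null_balls (h : LocalPI m N lam P) (hdef : DeformationProperty m)
    (hE : VolConstMin m E) (hne : (essBdry m E).Nonempty) :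
    (∃ x, ∃ r > 0, vol m E x r = 0) ∧ ∃ y, ∃ r > 0, vol m Eᶜ y r = 0 := by
  obtain ⟨x, hx⟩ := h.essExt_nonempty hE.1 hne
  obtain ⟨y, hy⟩ := h.essInt_nonempty hne
  have hy' := h.essInt_subset hE.1 hy
  rcases h.exists_vol_eq_zero hdef hE hx hy' with ⟨r, hr, h0⟩ | ⟨r, hr, h0⟩
  · refine ⟨⟨x, r, hr, h0⟩, y, ?_⟩
    exact h.exists_vol_eq_zero_of_compl hdef (VolConstMin.compl hE) hy' hr (by rwa [compl_compl])
  · exact ⟨⟨x, h.exists_vol_eq_zero_of_compl hdef hE hx hr h0⟩, y, r, hr, h0⟩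

theorem LocalPI.exists_volume_density (h : LocalPI m N lam P) (hdef : DeformationProperty m)
    (hE : VolConstMin m E) (hne : (essBdry m E).Nonempty) {B : Set X} (hB : IsBounded B) :
    ∃ R > 0, ∃ ε > 0, ∀ x ∈ essBdry m E ∩ B, ∀ t, 0 < t → t < R →
      ε * m.real (ball x t) ≤ vol m E x t := by
  obtain ⟨-, y, r, hr, hy⟩ := h.exists_null_balls hdef hE hne
  obtain ⟨R, hR, ε, hε, h1⟩ := h.vol_eq_zero_of_le hdef hE hr hy hB
  refine ⟨R, hR, ε, hε, fun x hx t ht htR => le_of_not_ge fun hle => ?_⟩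
  exact (vol_pos_of_mem_essBdry hx.1 (by positivity)).ne' (h1 x hx.2 t ht htR hle)

end VolumeDensity

section PerimeterDensity

variable [BorelSpace X]

theorem LocalPI.le_mul_per_ball (h : LocalPI m N lam P) (hE : MeasurableSet E) {x : X} {r ε : ℝ}
    (hr : 0 < r) (hr1 : r < 1) (hε : 0 ≤ ε)
    (h1 : ε * m.real (ball x (r / (2 * lam))) ≤ vol m E x (r / (2 * lam)))
    (h2 : ε * m.real (ball x (r / (2 * lam))) ≤ vol m Eᶜ x (r / (2 * lam))) :
    ENNReal.ofReal (ε / (4 * lam) ^ N * (2 * lam / P)) * m (ball x r) ≤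
      ENNReal.ofReal r * Per m E (ball x r) := by
  have hlam := h.one_le_lam
  have hP := h.P_pos
  have hρ : 0 < r / (2 * lam) := by positivity
  have hρr : r / (2 * lam) ≤ r := div_le_self hr.le (by linarith)
  have key := h.relative_isoperimetric hE x hρ (hρr.trans_lt hr1)
  rw [mul_div_cancel₀ _ (by positivity)] at key
  have hmin : ENNReal.ofReal (ε * m.real (ball x (r / (2 * lam)))) ≤
      min (m (ball x (r / (2 * lam)) ∩ E)) (m (ball x (r / (2 * lam)) \ E)) := by
    refine le_min ?_ ?_
    · rw [inter_comm, ← h.measure_inter_closedBall _ _ hρ, ← ofReal_vol]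
      exact ENNReal.ofReal_le_ofReal h1
    · rw [← h.ofReal_vol_compl E x hρ]
      exact ENNReal.ofReal_le_ofReal h2
  have hdoub := h.measure_ball_le_pow x hρ hρr hr1.le
  rw [show 2 * r / (r / (2 * lam)) = 4 * lam by field_simp; norm_num] at hdoub
  calc ENNReal.ofReal (ε / (4 * lam) ^ N * (2 * lam / P)) * m (ball x r)
      = ENNReal.ofReal (2 * lam / P) * ENNReal.ofReal (ε / (4 * lam) ^ N * m.real (ball x r)) := by
        rw [← ENNReal.ofReal_toReal (measure_ball_ne_top (m := m) x r),
          ← ENNReal.ofReal_mul (by positivity), ← ENNReal.ofReal_mul (by positivity), Measure.real]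
        congr 1
        ring
    _ ≤ ENNReal.ofReal (2 * lam / P) * ENNReal.ofReal (ε * m.real (ball x (r / (2 * lam)))) := by
        refine mul_le_mul_right (ENNReal.ofReal_le_ofReal ?_) _
        rw [div_mul_eq_mul_div, div_le_iff₀ (by positivity)]
        calc _ ≤ ε * ((4 * lam) ^ N * m.real (ball x (r / (2 * lam)))) := by gcongr
          _ = _ := by ring
    _ ≤ ENNReal.ofReal (2 * lam / P) *
          (ENNReal.ofReal (P * (r / (2 * lam))) * Per m E (ball x r)) := by
        gcongr
        exact hmin.trans key
    _ = ENNReal.ofReal r * Per m E (ball x r) := by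
        rw [← mul_assoc, ← ENNReal.ofReal_mul (by positivity)]
        congr 2
        field_simp

theorem LocalPI.reverse_doubling (h : LocalPI m N lam P) {x p : X} {t : ℝ} (ht : 0 < t)
    (ht1 : 2 * t ≤ 1) (hp : t / 2 ≤ dist x p) :
    m.real (ball x (t / 4)) ≤ (1 - 1 / 16 ^ N) * m.real (ball x t) := by
  obtain ⟨w, hw, -⟩ := exists_dist_eq h.isLength x p (by positivity) hp one_pos
  have hd : Disjoint (ball x (t / 4)) (ball w (t / 4)) := ball_disjoint_ball (by linarith)
  have h1 : m.real (ball x (t / 4)) + m.real (ball w (t / 4)) ≤ m.real (ball x t) := by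
    rw [← measureReal_union hd measurableSet_ball (measure_ball_ne_top _ _)
      (measure_ball_ne_top _ _)]
    refine measureReal_mono (union_subset (ball_subset_ball (by linarith)) (ball_subset_ball' ?_))
      (measure_ball_ne_top _ _)
    rw [dist_comm]
    linarith
  have h2 : m.real (ball x t) ≤ m.real (ball w (2 * t)) := by
    refine measureReal_mono (ball_subset_ball' ?_) (measure_ball_ne_top _ _)
    linarith
  have h3 := h.measure_ball_le_pow w (r := t / 4) (R := 2 * t) (by positivity) (by linarith) ht1
  rw [show 2 * (2 * t) / (t / 4) = 16 by field_simp; norm_num] at h3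
  have h4 : m.real (ball x t) / 16 ^ N ≤ m.real (ball w (t / 4)) := by
    rw [div_le_iff₀ (by positivity)]
    linarith
  rw [sub_mul, one_mul, one_div_mul_eq_div]
  linarith

theorem LocalPI.reverse_doubling_iterate (h : LocalPI m N lam P) {x p : X} {t : ℝ} (ht : 0 < t)
    (ht1 : 2 * t ≤ 1) (hp : t / 2 ≤ dist x p) (k : ℕ) :
    m.real (ball x (t / 4 ^ k)) ≤ (1 - 1 / 16 ^ N) ^ k * m.real (ball x t) := by
  induction k with
  | zero => simp
  | succ k ih =>
    have hle : t / 4 ^ k ≤ t := div_le_self ht.le (one_le_pow₀ (by norm_num))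
    have h1 := h.reverse_doubling (x := x) (p := p) (t := t / 4 ^ k) (by positivity) (by linarith)
      (by linarith)
    have h2 : (0 : ℝ) ≤ 1 - 1 / 16 ^ N := by
      rw [sub_nonneg, div_le_one (by positivity)]
      exact one_le_pow₀ (by norm_num)
    rw [div_div, ← pow_succ] at h1
    refine h1.trans ?_
    rw [pow_succ', mul_assoc]
    gcongr

theorem LocalPI.per_ball_le (h : LocalPI m N lam P) (hE : VolConstMin m E) {x : X}
    {r R₀ C₀ δ : ℝ} (hD : LocalDeform m ∅ R₀ C₀ x) (hC₀ : 0 ≤ C₀) (hr : 0 < r) (hr1 : r < 1)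
    (hrR : 2 * r < R₀) (hδ : 0 < δ) (hδ1 : δ ≤ 1)
    (hlow : ∀ t, r ≤ t → t ≤ 2 * r → m.real (ball x (δ * t)) ≤ vol m E x t) :
    ENNReal.ofReal r * Per m E (ball x r) ≤
      ENNReal.ofReal (2 ^ N * (4 + C₀ / δ)) * m (ball x r) := by
  have hc := (h.continuousOn_vol hE.1 x).mono
    (show Icc r (2 * r) ⊆ Ioi 0 from fun s hs => hr.trans_le hs.1)
  have huniv : ∀ {s}, 0 < s → vol m univ x s = m.real (ball x s) := fun {s} hs => by
    rw [vol, univ_inter, Measure.real, h.measure_closedBall x hs, Measure.real]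
  have hvle : ∀ {s}, 0 < s → vol m E x s ≤ m.real (ball x s) := fun {s} hs => by
    rw [← huniv hs]
    exact ENNReal.toReal_mono (measure_inter_closedBall_ne_top _ _ _)
      (measure_mono (inter_subset_inter_left _ (subset_univ _)))
  set V := m.real (ball x (2 * r)) with hV
  have hV0 : 0 < V := h.ball_pos x _ (by positivity)
  obtain ⟨t, ht, hL⟩ := exists_frequently_slope_lt (L := 2 * V / r) (vol_mono E x)
    (show r < 2 * r by linarith) hc (by
      have h1 : vol m E x (2 * r) ≤ V := hvle (by positivity)
      have h2 : 0 ≤ vol m E x r := ENNReal.toReal_nonneg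
      rw [show 2 * V / r * (2 * r - r) = 2 * V by field_simp; ring]
      linarith)
  have ht0 : 0 < t := hr.trans_le ht.1
  obtain ⟨s, hs, hs'⟩ : vol m E x t ∈ vol m univ x '' Icc (δ * t) t := by
    refine intermediate_value_Icc (mul_le_of_le_one_left ht0.le hδ1)
      ((h.continuousOn_vol MeasurableSet.univ x).mono fun s hs => ?_) ⟨?_, ?_⟩
    · exact (show 0 < δ * t by positivity).trans_le hs.1
    · rw [huniv (by positivity)]
      exact hlow t ht.1 ht.2.le
    · rw [huniv ht0]
      exact hvle ht0
  have hs0 : 0 < s := (show 0 < δ * t by positivity).trans_le hs.1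
  have hsub : ball x s ⊆ closedBall x t := ball_subset_closedBall.trans
    (closedBall_subset_closedBall hs.2)
  have htR : t < R₀ := ht.2.trans hrR
  have hdisj : Disjoint (E \ closedBall x t) (ball x s) := disjoint_sdiff_left.mono_right hsub
  obtain ⟨U, hUo, hUx, -, hU⟩ := hD s hs0 (hs.2.trans_lt htR)
  rw [empty_union, Set.sdiff_empty, per_empty_left hUo, add_zero] at hU
  have key := VolConstMin.per_inter_closedBall_le hE (h.sphere_null x t ht0) hL
    (V := ball x s) measurableSet_ball (M := R₀)
    (ball_subset_closedBall.trans (closedBall_subset_closedBall (hs.2.trans htR.le)))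
    (κ := ENNReal.ofReal C₀ * m (ball x s) / ENNReal.ofReal s) ?_ ?_ r
  · have hcongr : Per m E (ball x r) = Per m (E ∩ closedBall x t) (ball x r) := by
      refine per_congr_inter isOpen_ball ?_
      rw [inter_assoc, inter_eq_right.2
        (ball_subset_closedBall.trans (closedBall_subset_closedBall ht.1))]
    have hms : m (ball x s) ≤ ENNReal.ofReal V := by
      rw [hV, Measure.real, ENNReal.ofReal_toReal (measure_ball_ne_top _ _)]
      exact measure_mono (ball_subset_ball (hs.2.trans ht.2.le))
    have hsr : δ * r ≤ s := le_trans (by gcongr; exact ht.1) hs.1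
    have hdoub : V ≤ 2 ^ N * m.real (ball x r) := h.doubling x r hr hr1
    rw [hcongr]
    calc ENNReal.ofReal r * Per m (E ∩ closedBall x t) (ball x r)
        ≤ ENNReal.ofReal r * (2 * ENNReal.ofReal (2 * V / r) +
            ENNReal.ofReal C₀ * ENNReal.ofReal V / ENNReal.ofReal (δ * r)) := by
          refine mul_le_mul_right (key.trans ?_) _
          gcongr
      _ = ENNReal.ofReal ((4 + C₀ / δ) * V) := by
          rw [← ENNReal.ofReal_mul hC₀, ← ENNReal.ofReal_div_of_pos (by positivity),
            ← ENNReal.ofReal_ofNat 2, ← ENNReal.ofReal_mul (by norm_num),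
            ← ENNReal.ofReal_add (by positivity) (by positivity), ← ENNReal.ofReal_mul hr.le]
          congr 1
          field_simp
          ring
      _ ≤ ENNReal.ofReal ((4 + C₀ / δ) * (2 ^ N * m.real (ball x r))) := by gcongr
      _ = _ := by
          rw [← mul_assoc, mul_comm (4 + C₀ / δ), ENNReal.ofReal_mul (by positivity), Measure.real,
            ENNReal.ofReal_toReal (measure_ball_ne_top _ _)]
  · rw [hdisj.symm.sdiff_eq_left, ← ofReal_vol, ← hs', ofReal_vol, univ_inter,
      h.measure_closedBall x hs0]
  · intro Ω hΩ hxΩ ε _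
    refine (per_union_le_add (hE.1.diff isClosed_closedBall.measurableSet) hΩ hdisj).trans
      (le_trans ?_ le_self_add)
    gcongr
    have hout : Per m (ball x s) (Ω \ closedBall x t) = 0 := by
      rw [← per_empty_left (m := m) (hΩ.sdiff isClosed_closedBall (t := closedBall x t))]
      refine per_congr_inter (hΩ.sdiff isClosed_closedBall) ?_
      rw [empty_inter]
      exact (disjoint_sdiff_right.mono_left hsub).inter_eq
    have hglue := per_le_add_radial (m := m) (E := ball x s) measurableSet_ball hΩ (z := x) htR
      fun y _ hy => hxΩ (mem_closedBall.2 hy)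
    rw [hout, zero_add] at hglue
    refine hglue.trans ((per_mono ?_).trans hU)
    exact inter_subset_right.trans (ball_subset_closedBall.trans hUx)

end PerimeterDensity

end DensityEstimates

theorem essBdry_zero {X : Type*} [MetricSpace X] [MeasurableSpace X] {m : Measure X} (hm : m = 0)
    (E : Set X) : essBdry m E = ∅ := by
  have : essExt m E = univ := eq_univ_of_forall fun x => by
    simp only [essExt, hm, mem_ofPred_eq, Measure.coe_zero, Pi.zero_apply, ENNReal.zero_div]
    exact tendsto_const_nhds
  rw [essBdry, this, union_univ, compl_univ]

theorem LocalPI.exists_perimeter_upper {X : Type*} [MetricSpace X] [MeasurableSpace X]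
    [BorelSpace X] [ProperSpace X] {m : Measure X} [IsFiniteMeasureOnCompacts m] {N : ℕ}
    {lam P : ℝ} {E : Set X} (h : LocalPI m N lam P) (hdef : DeformationProperty m)
    (hE : VolConstMin m E) (hne : (essBdry m E).Nonempty) {B : Set X} (hB : IsBounded B) {R ε : ℝ}
    (hR : 0 < R) (hε : 0 < ε) (hvol : ∀ x ∈ essBdry m E ∩ B, ∀ t, 0 < t → t < R →
      ε * m.real (ball x t) ≤ vol m E x t) :
    ∃ R' > 0, ∃ C > 0, ∀ x ∈ essBdry m E ∩ B, ∀ r, 0 < r → r < R' →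
      ENNReal.ofReal r * Per m E (ball x r) ≤ ENNReal.ofReal C * m (ball x r) := by
  obtain ⟨p, hp⟩ := h.essExt_nonempty hE.1 hne
  obtain ⟨p', hp'⟩ := hne
  have hpp : 0 < dist p p' := dist_pos.2 fun he => hp' (Or.inr (he ▸ hp))
  have hfar : ∀ x t, t ≤ dist p p' → ∃ q, t / 2 ≤ dist x q := fun x t ht => by
    by_contra! hcon
    have h2 := add_lt_add (hcon p) (hcon p')
    rw [add_halves] at h2
    exact absurd (dist_triangle_left p p' x) (not_le.2 (h2.trans_le ht))
  obtain ⟨R₀, C₀, hR₀, hC₀, hD⟩ := exists_uniform_deformation hdef MeasurableSet.empty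
    (m := m) (fun x => ⟨1, one_pos, by rw [per_empty_left isOpen_ball]; exact zero_lt_top⟩)
    hB.isCompact_closure
  obtain ⟨k, hk⟩ := exists_pow_lt_of_lt_one hε
    (show 1 - 1 / (16 : ℝ) ^ N < 1 by linarith [show 0 < 1 / (16 : ℝ) ^ N by positivity])
  refine ⟨min (min (R / 2) (R₀ / 2)) (min (1 / 4) (dist p p' / 2)), by positivity,
    2 ^ N * (4 + C₀ / (1 / 4 ^ k)), by positivity, fun x hx r hr hrR => ?_⟩
  simp only [lt_min_iff] at hrR
  obtain ⟨⟨h1, h2⟩, h3, h4⟩ := hrR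
  refine h.per_ball_le hE (hD x (subset_closure hx.2)) hC₀ hr (by linarith) (by linarith)
    (by positivity) ?_ fun t ht ht2 => ?_
  · rw [div_le_one (by positivity)]
    exact one_le_pow₀ (by norm_num)
  · have ht0 : 0 < t := hr.trans_le ht
    obtain ⟨q, hq⟩ := hfar x t (by linarith)
    have := h.reverse_doubling_iterate ht0 (by linarith) hq k
    rw [one_div_mul_eq_div]
    refine this.trans (le_trans ?_ (hvol x hx t ht0 (by linarith)))
    gcongr

theorem LocalPI.exists_density_estimates {X : Type*} [MetricSpace X] [MeasurableSpace X]
    [BorelSpace X] [ProperSpace X] {m : Measure X} [IsFiniteMeasureOnCompacts m] {N : ℕ}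
    {lam P : ℝ} {E : Set X} (h : LocalPI m N lam P) (hdef : DeformationProperty m)
    (hE : VolConstMin m E) (hne : (essBdry m E).Nonempty) {B : Set X} (hB : IsBounded B) :
    ∃ rbar > (0 : ℝ), ∃ C : ℝ, 1 < C ∧ ∀ x ∈ essBdry m E ∩ B, ∀ r : ℝ, 0 < r → r < rbar →
      (ENNReal.ofReal (1 / C) ≤ m (ball x r ∩ E) / m (ball x r) ∧
        m (ball x r ∩ E) / m (ball x r) ≤ ENNReal.ofReal (1 - 1 / C)) ∧
      (ENNReal.ofReal (1 / C) ≤ ENNReal.ofReal r * Per m E (ball x r) / m (ball x r) ∧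
        ENNReal.ofReal r * Per m E (ball x r) / m (ball x r) ≤ ENNReal.ofReal C) := by
  have hlam := h.one_le_lam
  have hP := h.P_pos
  obtain ⟨R₁, hR₁, ε₁, hε₁, h₁⟩ := h.exists_volume_density hdef hE hne hB
  obtain ⟨R₂, hR₂, ε₂, hε₂, h₂⟩ := h.exists_volume_density hdef (VolConstMin.compl hE)
    (hne.mono (h.essBdry_compl_subset hE.1)) hB
  obtain ⟨R₃, hR₃, C₃, hC₃, h₃⟩ := h.exists_perimeter_upper hdef hE hne hB hR₁ hε₁ h₁
  set ε := min ε₁ ε₂ with hεdef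
  have hε : 0 < ε := lt_min hε₁ hε₂
  set c := ε / (4 * lam) ^ N * (2 * lam / P) with hc
  have hc0 : 0 < c := by positivity
  set C := 2 + 1 / ε + 1 / c + C₃ with hC
  have hε' : 0 < 1 / ε := by positivity
  have hc' : 0 < 1 / c := by positivity
  have hC0 : 0 < C := by positivity
  have hCε : 1 / C ≤ ε := by
    rw [div_le_comm₀ hC0 hε]
    linarith
  have hCc : 1 / C ≤ c := by
    rw [div_le_comm₀ hC0 hc0]
    linarith
  refine ⟨min (min R₁ R₂) (min R₃ 1), by positivity, C, by linarith, fun x hx r hr hrR => ?_⟩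
  simp only [lt_min_iff] at hrR
  obtain ⟨⟨hr₁, hr₂⟩, hr₃, hr1⟩ := hrR
  have hfin := measure_ball_ne_top (m := m) x r
  have h0 := h.measure_ball_ne_zero x hr
  have hlow : ∀ t, 0 < t → t ≤ r → ε * m.real (ball x t) ≤ vol m E x t ∧
      ε * m.real (ball x t) ≤ vol m Eᶜ x t := fun t ht htr =>
    ⟨le_trans (by gcongr; exact min_le_left _ _) (h₁ x hx t ht (htr.trans_lt hr₁)),
      le_trans (by gcongr; exact min_le_right _ _)
        (h₂ x ⟨h.essBdry_compl_subset hE.1 hx.1, hx.2⟩ t ht (htr.trans_lt hr₂))⟩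
  have hball : m (ball x r) = ENNReal.ofReal (m.real (ball x r)) := by
    rw [Measure.real, ENNReal.ofReal_toReal hfin]
  have hvol : m (ball x r ∩ E) = ENNReal.ofReal (vol m E x r) := by
    rw [ofReal_vol, h.measure_inter_closedBall _ _ hr, inter_comm]
  have hball0 := h.ball_pos x r hr
  have hsum := h.vol_add_vol_compl hE.1 x hr
  refine ⟨⟨?_, ?_⟩, ?_, ?_⟩
  · rw [ENNReal.le_div_iff_mul_le (Or.inl h0) (Or.inl hfin), hvol, hball,
      ← ENNReal.ofReal_mul (by positivity)]
    exact ENNReal.ofReal_le_ofReal (le_trans (by gcongr) (hlow r hr le_rfl).1)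
  · rw [ENNReal.div_le_iff h0 hfin, hvol, hball, ← ENNReal.ofReal_mul]
    · refine ENNReal.ofReal_le_ofReal ?_
      have h4 : 1 / C * m.real (ball x r) ≤ ε * m.real (ball x r) := by gcongr
      linarith [(hlow r hr le_rfl).2]
    · rw [sub_nonneg, div_le_one hC0]
      linarith
  · rw [ENNReal.le_div_iff_mul_le (Or.inl h0) (Or.inl hfin)]
    have hρr : r / (2 * lam) ≤ r := div_le_self hr.le (by linarith)
    have hl := hlow (r / (2 * lam)) (by positivity) hρr
    refine le_trans ?_ (h.le_mul_per_ball hE.1 hr hr1 hε.le hl.1 hl.2)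
    gcongr
  · rw [ENNReal.div_le_iff h0 hfin]
    refine (h₃ x hx r hr hr₃).trans ?_
    gcongr
    linarith

end PerimeterDensity

/-- **Boundary density estimates** (Theorem 3.10): a volume-constrained minimizer of
the perimeter in a length PI space with the deformation property satisfies volume
and perimeter density estimates at points of the essential boundary lying in a
given bounded set. -/
theorem boundary_density_estimates
    {X : Type*} [MetricSpace X] [CompleteSpace X] [TopologicalSpace.SeparableSpace X]
    [MeasurableSpace X] [BorelSpace X] (m : Measure X)
    (hbf : BoundedlyFinite m) (hPI : IsPIspace m) (hlen : IsLengthSpace X)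
    (hdef : DeformationProperty m) (E : Set X) (hE : VolConstMin m E)
    (B : Set X) (hB : Bornology.IsBounded B) :
    ∃ rbar > (0:ℝ), ∃ C : ℝ, 1 < C ∧
      ∀ x ∈ essBdry m E ∩ B, ∀ r : ℝ, 0 < r → r < rbar →
        (ENNReal.ofReal (1 / C) ≤ m (Metric.ball x r ∩ E) / m (Metric.ball x r) ∧
          m (Metric.ball x r ∩ E) / m (Metric.ball x r) ≤ ENNReal.ofReal (1 - 1 / C)) ∧
        (ENNReal.ofReal (1 / C) ≤
            ENNReal.ofReal r * Per m E (Metric.ball x r) / m (Metric.ball x r) ∧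
          ENNReal.ofReal r * Per m E (Metric.ball x r) / m (Metric.ball x r) ≤
            ENNReal.ofReal C) := by
  rcases (essBdry m E).eq_empty_or_nonempty with hne | hne
  · exact ⟨1, one_pos, 2, one_lt_two, fun x hx => absurd (hne ▸ hx.1) (notMem_empty x)⟩
  obtain ⟨C_D, -, hD⟩ := hPI.1
  have hpos : ∀ x : X, ∀ r > 0, 0 < m (ball x r) := fun x r hr => pos_iff_ne_zero.2 fun h0 =>
    hne.ne_empty (PerimeterDensity.essBdry_zero (PerimeterDensity.eq_zero_of_ball_null hD hr h0) E)
  have := PerimeterDensity.isFiniteMeasureOnCompacts_of_boundedlyFinite hbf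
  have := PerimeterDensity.properSpace_of_doubling hbf hD hpos
  have := UniformSpace.secondCountable_of_separable X
  obtain ⟨N, lam, P, h⟩ := PerimeterDensity.exists_localPI hPI hlen hpos
  exact h.exists_density_estimates hdef hE hne hB

end
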